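/- Let k be a perfect field of characteristic p > 0. For every natural number n, the k-vector space Ext^n_{F(P_k,k)}(I, I) is one-dimensional if n is even, and is zero if n is odd. -/

import Mathlib

/-! STATEMENT 1: for a perfect field `k` of characteristic `p > 0`, the `k`-vector space
`Ext^n_{F(P_k,k)}(I, I)` is one-dimensional when `n` is even and zero when `n` is odd. -/

universe w u

open CategoryTheory

namespace CategoryTheory.Abelian.Ext

variable {R : Type*} [CommRing R] {C : Type*} [Category C] [Abelian C] [Linear R C]
  [HasExt.{w} C]

lemma mk₀_add' {X Y : C} (f g : X ⟶ Y) :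
    Ext.mk₀ (f + g) = (Ext.mk₀ f + Ext.mk₀ g : Ext X Y 0) := by
  letI := HasDerivedCategory.standard C
  ext
  rw [Ext.add_hom, Ext.mk₀_hom, Ext.mk₀_hom, Ext.mk₀_hom, Functor.map_add]
  simp [ShiftedHom.mk₀, Preadditive.add_comp]

/-- Scalar multiplication on Ext-groups in an `R`-linear abelian category, given by
Yoneda composition with `c • 𝟙 X`.  With this action, `Ext X Y n` is an `R`-module
(a `k`-vector space when `R = k` is a field). -/
noncomputable instance module (X Y : C) (n : ℕ) : Module R (Ext X Y n) where
  smul c α := (Ext.mk₀ (c • 𝟙 X)).comp α (zero_add n)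
  one_smul α := by
    show (Ext.mk₀ ((1 : R) • 𝟙 X)).comp α (zero_add n) = α
    rw [one_smul]
    exact Ext.mk₀_id_comp α
  mul_smul c d α := by
    show (Ext.mk₀ ((c * d) • 𝟙 X)).comp α (zero_add n) =
      (Ext.mk₀ (c • 𝟙 X)).comp ((Ext.mk₀ (d • 𝟙 X)).comp α (zero_add n)) (zero_add n)
    rw [Ext.mk₀_comp_mk₀_assoc, Linear.smul_comp, Linear.comp_smul, smul_smul, Category.id_comp]
  smul_zero c := by
    show (Ext.mk₀ (c • 𝟙 X)).comp (0 : Ext X Y n) (zero_add n) = 0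
    simp
  smul_add c α β := by
    show (Ext.mk₀ (c • 𝟙 X)).comp (α + β) (zero_add n) = _
    rw [Ext.comp_add]
    rfl
  add_smul c d α := by
    show (Ext.mk₀ ((c + d) • 𝟙 X)).comp α (zero_add n) = _
    rw [add_smul, mk₀_add', Ext.add_comp]
    rfl
  zero_smul α := by
    show (Ext.mk₀ ((0 : R) • 𝟙 X)).comp α (zero_add n) = 0
    rw [zero_smul, Ext.mk₀_zero, Ext.zero_comp]

end CategoryTheory.Abelian.Ext

open CategoryTheory Abelian

namespace DjamentTouze

/-- The inclusion functor `I : P_k → V_k`, regarded as an object of the functor category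
`F(P_k, k)` of all functors from finite-dimensional `k`-vector spaces to `k`-vector spaces. -/
noncomputable def inclusionFunctor (k : Type u) [Field k] : FGModuleCat k ⥤ ModuleCat.{u} k :=
  forget₂ (FGModuleCat k) (ModuleCat k)

section ExtComputation

namespace ExtLinear

/-- The linear structure on `Ext` given by Mathlib. -/
noncomputable scoped instance (priority := 2000) extModule {R : Type*} [CommRing R] {C : Type*}
    [Category C] [Abelian C] [Linear R C] [HasExt C] (X Y : C) (n : ℕ) : Module R (Ext X Y n) :=
  Ext.instModule

end ExtLinear

open scoped ExtLinear

section ExtGeneral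

universe w' v v' u' r

variable (k : Type r) [Field k] {A : Type u} [Category.{v} A] [Abelian A] [Linear k A]
  [HasExt.{w} A] (X : A)

/-- The map on `Ext X - t` induced by a morphism in the second variable. -/
noncomputable def push {F G : A} (f : F ⟶ G) (t : ℕ) : Ext X F t →ₗ[k] Ext X G t :=
  Ext.postcompOfLinear (Ext.mk₀ f) k X (add_zero t)

/-- The connecting map of a short exact sequence in the second variable. -/
noncomputable def conn {S : ShortComplex A} (hS : S.ShortExact) (t : ℕ) :
    Ext X S.X₃ t →ₗ[k] Ext X S.X₁ (t + 1) :=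
  Ext.postcompOfLinear hS.extClass k X rfl

/-- The map on `Ext - F t` induced by a morphism in the first variable. -/
noncomputable def pull {X Y : A} (f : X ⟶ Y) (F : A) (t : ℕ) : Ext Y F t →ₗ[k] Ext X F t :=
  Ext.precompOfLinear (Ext.mk₀ f) k F (zero_add t)

lemma push_apply {F G : A} (f : F ⟶ G) (t : ℕ) (x : Ext X F t) :
    push k X f t x = x.comp (Ext.mk₀ f) (add_zero t) := rfl

lemma conn_apply {S : ShortComplex A} (hS : S.ShortExact) (t : ℕ) (x : Ext X S.X₃ t) :
    conn k X hS t x = x.comp hS.extClass rfl := rfl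

lemma pull_apply {X Y : A} (f : X ⟶ Y) (F : A) (t : ℕ) (x : Ext Y F t) :
    pull k f F t x = (Ext.mk₀ f).comp x (zero_add t) := rfl

lemma push_comp {F G H : A} (f : F ⟶ G) (g : G ⟶ H) (t : ℕ) (x : Ext X F t) :
    push k X (f ≫ g) t x = push k X g t (push k X f t x) := by
  simp [push_apply]

lemma push_id {F : A} (t : ℕ) (x : Ext X F t) : push k X (𝟙 F) t x = x := by
  simp [push_apply]

lemma push_add {F G : A} (f g : F ⟶ G) (t : ℕ) (x : Ext X F t) :
    push k X (f + g) t x = push k X f t x + push k X g t x := by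
  simp [push_apply, Ext.mk₀_add]

lemma push_smul {F G : A} (c : k) (f : F ⟶ G) (t : ℕ) (x : Ext X F t) :
    push k X (c • f) t x = c • push k X f t x := by
  simp [push_apply, Ext.mk₀_smul]

lemma push_zero {F G : A} (t : ℕ) (x : Ext X F t) : push k X (0 : F ⟶ G) t x = 0 := by
  simp [push_apply]

lemma push_mk₀ {F G : A} (f : F ⟶ G) (g : X ⟶ F) :
    push k X f 0 (Ext.mk₀ g) = Ext.mk₀ (g ≫ f) := by
  simp [push_apply]

lemma pull_push {X Y F G : A} (f : X ⟶ Y) (g : F ⟶ G) (t : ℕ) (x : Ext Y F t) :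
    pull k f G t (push k Y g t x) = push k X g t (pull k f F t x) := by
  simp [push_apply, pull_apply, Ext.comp_assoc_of_third_deg_zero]

lemma pull_comp {X Y Z F : A} (f : X ⟶ Y) (g : Y ⟶ Z) (t : ℕ) (x : Ext Z F t) :
    pull k (f ≫ g) F t x = pull k f F t (pull k g F t x) := by
  simp [pull_apply]

variable {X}

lemma push_bijective_of_iso {F G : A} (e : F ≅ G) (t : ℕ) :
    Function.Bijective (push k X e.hom t) := by
  refine ⟨fun x y h ↦ ?_, fun x ↦ ⟨push k X e.inv t x, ?_⟩⟩
  · have := congrArg (push k X e.inv t) h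
    simpa [← push_comp, push_id] using this
  · simp [← push_comp, push_id]

lemma push_eq_zero_of_factor {F G H : A} {t : ℕ} [Subsingleton (Ext X G t)] (f : F ⟶ G)
    (g : G ⟶ H) (x : Ext X F t) : push k X (f ≫ g) t x = 0 := by
  rw [push_comp, Subsingleton.elim (push k X f t x) 0, map_zero]

variable {S : ShortComplex A} (hS : S.ShortExact)

include hS in
lemma exists_push_f (t : ℕ) (x : Ext X S.X₂ t) (h : push k X S.g t x = 0) :
    ∃ y, push k X S.f t y = x := Ext.covariant_sequence_exact₂ X hS x h

lemma exists_push_g (t : ℕ) (x : Ext X S.X₃ t) (h : conn k X hS t x = 0) :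
    ∃ y, push k X S.g t y = x := Ext.covariant_sequence_exact₃ X hS x rfl h

lemma exists_conn (t : ℕ) (x : Ext X S.X₁ (t + 1)) (h : push k X S.f (t + 1) x = 0) :
    ∃ y, conn k X hS t y = x := Ext.covariant_sequence_exact₁ X hS x h rfl

lemma conn_push_g (t : ℕ) (x : Ext X S.X₂ t) : conn k X hS t (push k X S.g t x) = 0 := by
  rw [conn_apply, push_apply, Ext.comp_assoc_of_second_deg_zero, hS.comp_extClass,
    Ext.comp_zero]

lemma push_f_conn (t : ℕ) (x : Ext X S.X₃ t) : push k X S.f (t + 1) (conn k X hS t x) = 0 := by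
  rw [conn_apply, push_apply, Ext.comp_assoc_of_third_deg_zero, hS.extClass_comp,
    Ext.comp_zero]

include hS in
lemma push_f_injective_zero : Function.Injective (push k X S.f 0) :=
  have := hS.mono_f
  Ext.postcomp_mk₀_injective_of_mono X S.f

include hS in
lemma push_f_injective (t : ℕ) [Subsingleton (Ext X S.X₃ t)] :
    Function.Injective (push k X S.f (t + 1)) := by
  rw [injective_iff_map_eq_zero]
  intro x hx
  obtain ⟨y, rfl⟩ := exists_conn k hS t x hx
  rw [Subsingleton.elim y 0, map_zero]

include hS in
lemma push_f_surjective (t : ℕ) [Subsingleton (Ext X S.X₃ t)] :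
    Function.Surjective (push k X S.f t) :=
  fun x ↦ exists_push_f k hS t x (Subsingleton.elim _ _)

lemma conn_surjective (t : ℕ) [Subsingleton (Ext X S.X₂ (t + 1))] :
    Function.Surjective (conn k X hS t) :=
  fun x ↦ exists_conn k hS t x (Subsingleton.elim _ _)

lemma conn_injective (t : ℕ) [Subsingleton (Ext X S.X₂ t)] :
    Function.Injective (conn k X hS t) := by
  rw [injective_iff_map_eq_zero]
  intro x hx
  obtain ⟨y, rfl⟩ := exists_push_g k hS t x hx
  rw [Subsingleton.elim y 0, map_zero]

lemma conn_naturality {S' : ShortComplex A} (hS' : S'.ShortExact) (f : S ⟶ S') (t : ℕ)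
    (x : Ext X S.X₃ t) :
    push k X f.τ₁ (t + 1) (conn k X hS t x) = conn k X hS' t (push k X f.τ₃ t x) := by
  simp only [push_apply, conn_apply]
  rw [Ext.comp_assoc_of_third_deg_zero, ShortComplex.ShortExact.extClass_naturality hS hS' f,
    Ext.comp_assoc_of_second_deg_zero]

omit [Linear k A] in
include hS in
lemma subsingleton_ext₁_zero [Subsingleton (Ext X S.X₂ 0)] : Subsingleton (Ext X S.X₁ 0) :=
  have := hS.mono_f
  (Ext.postcomp_mk₀_injective_of_mono X S.f).subsingleton

omit [Linear k A] in
include hS in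
lemma subsingleton_ext₁_succ (t : ℕ) [Subsingleton (Ext X S.X₃ t)]
    [Subsingleton (Ext X S.X₂ (t + 1))] : Subsingleton (Ext X S.X₁ (t + 1)) :=
  subsingleton_of_forall_eq 0 fun x ↦ by
    obtain ⟨y, rfl⟩ := Ext.covariant_sequence_exact₁ X hS x (Subsingleton.elim _ _) rfl
    rw [Subsingleton.elim y 0, Ext.zero_comp]

omit [Linear k A] in
lemma subsingleton_ext_of_injective (E : A) [Injective E] (t : ℕ) :
    Subsingleton (Ext X E (t + 1)) :=
  Ext.subsingleton_of_injective X E t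

omit [HasExt.{w} A] [Linear k A] in
/-- The kernel-cokernel short exact sequence of a monomorphism. -/
lemma shortExact_cokernel {F G : A} (f : F ⟶ G) [Mono f] :
    (ShortComplex.mk f (Limits.cokernel.π f) (Limits.cokernel.condition f)).ShortExact where
  exact := ShortComplex.exact_cokernel f

lemma rank_ext_of_bijective {F G : A} {s t : ℕ} (f : Ext X F s →ₗ[k] Ext X G t)
    (hf : Function.Bijective f) : Module.rank k (Ext X F s) = Module.rank k (Ext X G t) :=
  (LinearEquiv.ofBijective f hf).rank_eq

include hS in
/-- Rank additivity for the three-term exact sequence `0 → Ext X₃ t → Ext X₁ (t+1) → Ext X₂ (t+1) → 0`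
given by the vanishing of the two neighbouring groups. -/
lemma rank_ext_add (t : ℕ) [Subsingleton (Ext X S.X₂ t)] [Subsingleton (Ext X S.X₃ (t + 1))] :
    Module.rank k (Ext X S.X₃ t) + Module.rank k (Ext X S.X₂ (t + 1)) =
      Module.rank k (Ext X S.X₁ (t + 1)) := by
  rw [← (push k X S.f (t + 1)).rank_range_add_rank_ker, add_comm]
  congr 1
  · rw [LinearMap.range_eq_top.2 (push_f_surjective k hS (t + 1)), rank_top]
  · have : LinearMap.ker (push k X S.f (t + 1)) = LinearMap.range (conn k X hS t) := by
      ext x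
      refine ⟨fun h ↦ exists_conn k hS t x h, ?_⟩
      rintro ⟨y, rfl⟩
      exact push_f_conn k hS t y
    rw [this]
    exact (LinearEquiv.ofInjective _ (conn_injective k hS t)).rank_eq

end ExtGeneral

section Comparison

universe w' v v' u' r

variable (k : Type r) [Field k] {A : Type u} [Category.{v} A] [Abelian A] [Linear k A]
  [HasExt.{w} A] {B : Type u'} [Category.{v'} B] [Abelian B] [Linear k B] [HasExt.{w'} B]
  (T : A ⥤ B) [T.Additive] [T.Linear k] [Limits.PreservesFiniteLimits T]
  [Limits.PreservesFiniteColimits T] {X : A} {Y : B} (α : Y ⟶ T.obj X)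

/-- The comparison map on `Ext` given by an exact functor `T` and a morphism `Y ⟶ T.obj X`. -/
noncomputable def compare (F : A) (t : ℕ) : Ext X F t →ₗ[k] Ext Y (T.obj F) t :=
  (pull k α (T.obj F) t).comp (T.mapExtLinearMap k X F t)

lemma compare_conn {S : ShortComplex A} (hS : S.ShortExact) (t : ℕ) (x : Ext X S.X₃ t) :
    conn k Y (hS.map_of_exact T) t (compare k T α S.X₃ t x) =
      compare k T α S.X₁ (t + 1) (conn k X hS t x) := by
  change ((Ext.mk₀ α).comp (T.mapExtLinearMap k X S.X₃ t x) (zero_add t)).comp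
      (hS.map_of_exact T).extClass rfl = (Ext.mk₀ α).comp
        (T.mapExtLinearMap k X S.X₁ (t + 1) (x.comp hS.extClass rfl)) (zero_add (t + 1))
  rw [Functor.mapExtLinearMap_apply, Functor.mapExtLinearMap_apply, Ext.mapExactFunctor_comp,
    Ext.mapExactFunctor_extClass]
  exact Ext.comp_assoc (Y := T.obj X) (Z := T.obj S.X₃) (T := T.obj S.X₁) (Ext.mk₀ α)
    (x.mapExactFunctor T) (hS.map_of_exact T).extClass (zero_add t) rfl (by omega)

lemma compare_bijective (h₀ : ∀ F : A, Function.Bijective fun f : X ⟶ F ↦ α ≫ T.map f)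
    (hE : ∀ F : A, ∃ (E : A) (i : F ⟶ E), Mono i ∧ ∀ t,
      Subsingleton (Ext X E (t + 1)) ∧ Subsingleton (Ext Y (T.obj E) (t + 1)))
    (F : A) (t : ℕ) : Function.Bijective (compare k T α F t) := by
  induction t generalizing F with
  | zero =>
    have : ⇑(compare k T α F 0) =
        Ext.mk₀ ∘ (fun f : X ⟶ F ↦ α ≫ T.map f) ∘ Ext.homEquiv₀ := by
      ext x
      obtain ⟨f, rfl⟩ := Ext.homEquiv₀.symm.surjective x
      change (Ext.mk₀ α).comp (T.mapExtLinearMap k X F 0 (Ext.mk₀ f)) (zero_add 0) =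
        Ext.mk₀ (α ≫ T.map (Ext.homEquiv₀ (Ext.homEquiv₀.symm f)))
      rw [Equiv.apply_symm_apply, Functor.mapExtLinearMap_apply, Ext.mapExactFunctor_mk₀,
        Ext.mk₀_comp_mk₀]
    rw [this]
    exact (Ext.mk₀_bijective _ _).comp ((h₀ F).comp Ext.homEquiv₀.bijective)
  | succ t ih =>
    obtain ⟨E, i, _, hE⟩ := hE F
    have := (hE t).1
    have hEY := (hE t).2
    have hS := shortExact_cokernel i
    have hT := hS.map_of_exact T
    refine AddMonoidHom.bijective_of_surjective_of_bijective_of_right_exact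
      (push k X (Limits.cokernel.π i) t).toAddMonoidHom (conn k X hS t).toAddMonoidHom
      (push k Y (T.map (Limits.cokernel.π i)) t).toAddMonoidHom (conn k Y hT t).toAddMonoidHom
      (compare k T α E t).toAddMonoidHom (compare k T α _ t).toAddMonoidHom
      (compare k T α F (t + 1)).toAddMonoidHom ?_ ?_ ?_ ?_ (ih _).surjective (ih _) ?_ ?_
    · ext x
      simp [compare, push_apply, pull_apply, Functor.mapExtLinearMap_apply,
        Ext.mapExactFunctor_comp, Ext.mapExactFunctor_mk₀, Ext.comp_assoc_of_third_deg_zero]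
    · ext x
      exact compare_conn k T α hS t x
    · exact fun x ↦ ⟨fun h ↦ exists_push_g k hS t x h, by rintro ⟨y, rfl⟩; exact conn_push_g k hS t y⟩
    · exact fun x ↦ ⟨fun h ↦ exists_push_g k hT t x h, by rintro ⟨y, rfl⟩; exact conn_push_g k hT t y⟩
    · exact fun x ↦ exists_conn k hS t x (Subsingleton.elim _ _)
    · exact fun x ↦ exists_conn k hT t x (hEY.elim _ _)

end Comparison

section FunctorCategory

universe v v' u' s

variable {C : Type u'} [Category.{v'} C] {k : Type u} [Field k]

/-- A functor to `k`-modules from linear data. -/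
def funMk (obj : C → Type s) [∀ V, AddCommGroup (obj V)] [∀ V, Module k (obj V)]
    (map : ∀ {V W : C}, (V ⟶ W) → obj V →ₗ[k] obj W)
    (map_id : ∀ V (x : obj V), map (𝟙 V) x = x)
    (map_comp : ∀ {U V W : C} (f : U ⟶ V) (g : V ⟶ W) (x : obj U),
      map (f ≫ g) x = map g (map f x)) : C ⥤ ModuleCat.{s} k where
  obj V := ModuleCat.of k (obj V)
  map f := ModuleCat.ofHom (map f)
  map_id V := by ext x; exact map_id V x
  map_comp f g := by ext x; exact map_comp f g x

/-- A natural transformation between functors to `k`-modules from linear data. -/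
def homMk {F G : C ⥤ ModuleCat.{s} k} (φ : ∀ V, F.obj V →ₗ[k] G.obj V)
    (h : ∀ {V W : C} (g : V ⟶ W) (x : F.obj V), φ W (F.map g x) = G.map g (φ V x)) : F ⟶ G where
  app V := ModuleCat.ofHom (φ V)
  naturality V W g := by ext x; exact h g x

@[simp]
lemma homMk_app {F G : C ⥤ ModuleCat.{s} k} (φ : ∀ V, F.obj V →ₗ[k] G.obj V)
    (h : ∀ {V W : C} (g : V ⟶ W) (x : F.obj V), φ W (F.map g x) = G.map g (φ V x))
    (V : C) (x : F.obj V) : (homMk φ h).app V x = φ V x := rfl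

lemma nat_apply {F G : C ⥤ ModuleCat.{s} k} (φ : F ⟶ G) {V W : C} (g : V ⟶ W) (x : F.obj V) :
    φ.app W (F.map g x) = G.map g (φ.app V x) :=
  NatTrans.naturality_apply φ g x

lemma map_comp_apply (F : C ⥤ ModuleCat.{s} k) {U V W : C} (f : U ⟶ V) (g : V ⟶ W)
    (x : F.obj U) : F.map (f ≫ g) x = F.map g (F.map f x) := by simp

lemma map_id_apply (F : C ⥤ ModuleCat.{s} k) {U : C} (x : F.obj U) : F.map (𝟙 U) x = x := by
  simp

lemma hom_ext_apply {F G : C ⥤ ModuleCat.{s} k} {φ ψ : F ⟶ G}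
    (h : ∀ V (x : F.obj V), φ.app V x = ψ.app V x) : φ = ψ := by
  ext V x; exact h V x

@[simp]
lemma comp_app_apply {F G H : C ⥤ ModuleCat.{s} k} (φ : F ⟶ G) (ψ : G ⟶ H) (V : C)
    (x : F.obj V) : (φ ≫ ψ).app V x = ψ.app V (φ.app V x) := rfl

@[simp]
lemma id_app_apply {F : C ⥤ ModuleCat.{s} k} (V : C) (x : F.obj V) : (𝟙 F :).app V x = x := rfl

@[simp]
lemma zero_app_apply {F G : C ⥤ ModuleCat.{s} k} (V : C) (x : F.obj V) :
    (0 : F ⟶ G).app V x = 0 := rfl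

@[simp]
lemma add_app_apply {F G : C ⥤ ModuleCat.{s} k} (φ ψ : F ⟶ G) (V : C) (x : F.obj V) :
    (φ + ψ).app V x = φ.app V x + ψ.app V x := rfl

@[simp]
lemma sub_app_apply {F G : C ⥤ ModuleCat.{s} k} (φ ψ : F ⟶ G) (V : C) (x : F.obj V) :
    (φ - ψ).app V x = φ.app V x - ψ.app V x := rfl

@[simp]
lemma smul_app_apply {F G : C ⥤ ModuleCat.{s} k} (c : k) (φ : F ⟶ G) (V : C) (x : F.obj V) :
    (c • φ).app V x = c • φ.app V x := rfl

lemma mono_iff_injective {F G : C ⥤ ModuleCat.{s} k} (φ : F ⟶ G) :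
    Mono φ ↔ ∀ V, Function.Injective (φ.app V) := by
  rw [NatTrans.mono_iff_mono_app]
  exact forall_congr' fun V ↦ ModuleCat.mono_iff_injective _

lemma epi_iff_surjective {F G : C ⥤ ModuleCat.{s} k} (φ : F ⟶ G) :
    Epi φ ↔ ∀ V, Function.Surjective (φ.app V) := by
  rw [NatTrans.epi_iff_epi_app]
  exact forall_congr' fun V ↦ ModuleCat.epi_iff_surjective _

lemma exact_iff_app (S : ShortComplex (C ⥤ ModuleCat.{s} k)) :
    S.Exact ↔ ∀ V, (S.map ((evaluation _ _).obj V)).Exact := by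
  rw [ShortComplex.exact_iff_isZero_homology, Functor.isZero_iff]
  exact forall_congr' fun V ↦ ((S.mapHomologyIso ((evaluation _ _).obj V)).symm).isZero_iff.trans
    (ShortComplex.exact_iff_isZero_homology _).symm

lemma shortExact_iff (S : ShortComplex (C ⥤ ModuleCat.{s} k)) :
    S.ShortExact ↔ (∀ V, Function.Injective (S.f.app V)) ∧ (∀ V, Function.Surjective (S.g.app V)) ∧
      ∀ V (x : S.X₂.obj V), S.g.app V x = 0 → ∃ y, S.f.app V y = x := by
  have h : S.Exact ↔ ∀ V (x : S.X₂.obj V), S.g.app V x = 0 → ∃ y, S.f.app V y = x := by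
    rw [exact_iff_app]
    exact forall_congr' fun V ↦ ShortComplex.moduleCat_exact_iff _
  rw [← h, ← mono_iff_injective, ← epi_iff_surjective]
  exact ⟨fun h ↦ ⟨h.mono_f, h.epi_g, h.exact⟩, fun h ↦ { exact := h.2.2, mono_f := h.1, epi_g := h.2.1 }⟩

/-- A short exact sequence of functors from pointwise exactness. -/
lemma shortExact_mk {F G H : C ⥤ ModuleCat.{s} k} (i : F ⟶ G) (q : G ⟶ H)
    (hi : ∀ V, Function.Injective (i.app V)) (hq : ∀ V, Function.Surjective (q.app V))
    (h₀ : ∀ V x, q.app V (i.app V x) = 0)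
    (h : ∀ V (x : G.obj V), q.app V x = 0 → ∃ y, i.app V y = x) :
    (ShortComplex.mk i q (hom_ext_apply h₀)).ShortExact :=
  (shortExact_iff _).2 ⟨hi, hq, h⟩

lemma shortExact_precomp {D : Type*} [Category D] (T : D ⥤ C)
    {S : ShortComplex (C ⥤ ModuleCat.{s} k)} (hS : S.ShortExact) :
    (S.map ((Functor.whiskeringLeft _ _ _).obj T)).ShortExact := by
  rw [shortExact_iff] at hS ⊢
  exact ⟨fun V ↦ hS.1 (T.obj V), fun V ↦ hS.2.1 (T.obj V), fun V ↦ hS.2.2 (T.obj V)⟩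

/-- Subfunctors of a functor to `k`-modules. -/
structure Subfun (F : C ⥤ ModuleCat.{s} k) where
  /-- The submodule of sections. -/
  carrier : ∀ V, Submodule k (F.obj V)
  map_mem : ∀ {V W : C} (f : V ⟶ W) (x : F.obj V), x ∈ carrier V → F.map f x ∈ carrier W

namespace Subfun

variable {F : C ⥤ ModuleCat.{s} k} (N : Subfun F)

/-- The functor underlying a subfunctor. -/
def toFunctor : C ⥤ ModuleCat.{s} k :=
  funMk (fun V ↦ N.carrier V) (fun f ↦ (F.map f).hom.restrict (N.map_mem f))
    (fun V x ↦ Subtype.ext (map_id_apply F x.1)) (fun f g x ↦ Subtype.ext (map_comp_apply F f g x.1))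

/-- The inclusion of a subfunctor. -/
def ι : N.toFunctor ⟶ F := homMk (fun V ↦ (N.carrier V).subtype) fun _ _ ↦ rfl

lemma ι_injective (V : C) : Function.Injective (N.ι.app V) := Subtype.val_injective

lemma ι_mem (V : C) (x : N.toFunctor.obj V) : N.ι.app V x ∈ N.carrier V := Subtype.property (p := (· ∈ N.carrier V)) x

/-- Corestriction of a morphism to a subfunctor. -/
def lift {G : C ⥤ ModuleCat.{s} k} (φ : G ⟶ F) (h : ∀ V x, φ.app V x ∈ N.carrier V) :
    G ⟶ N.toFunctor :=
  homMk (fun V ↦ (φ.app V).hom.codRestrict (N.carrier V) (h V))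
    fun g x ↦ Subtype.ext (nat_apply φ g x)

@[simp]
lemma lift_ι {G : C ⥤ ModuleCat.{s} k} (φ : G ⟶ F) (h : ∀ V x, φ.app V x ∈ N.carrier V) :
    N.lift φ h ≫ N.ι = φ := rfl

/-- The quotient by a subfunctor. -/
def quot : C ⥤ ModuleCat.{s} k :=
  funMk (fun V ↦ F.obj V ⧸ N.carrier V)
    (fun f ↦ Submodule.mapQ _ _ (F.map f).hom (N.map_mem f))
    (fun V x ↦ by
      obtain ⟨x, rfl⟩ := Submodule.Quotient.mk_surjective _ x
      exact congrArg _ (map_id_apply F x))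
    (fun f g x ↦ by
      obtain ⟨x, rfl⟩ := Submodule.Quotient.mk_surjective _ x
      exact congrArg _ (map_comp_apply F f g x))

/-- The projection onto the quotient by a subfunctor. -/
def π : F ⟶ N.quot := homMk (fun V ↦ (N.carrier V).mkQ) fun _ _ ↦ rfl

lemma π_surjective (V : C) : Function.Surjective (N.π.app V) :=
  Submodule.Quotient.mk_surjective _

lemma π_eq_zero_iff (V : C) (x : F.obj V) : N.π.app V x = 0 ↔ x ∈ N.carrier V :=
  Submodule.Quotient.mk_eq_zero _

/-- The map induced on quotients. -/
def quotMap {G : C ⥤ ModuleCat.{s} k} (N' : Subfun G) (φ : F ⟶ G)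
    (h : ∀ V, N.carrier V ≤ (N'.carrier V).comap (φ.app V).hom) : N.quot ⟶ N'.quot :=
  homMk (fun V ↦ Submodule.mapQ _ _ (φ.app V).hom (h V)) fun g x ↦ by
    obtain ⟨x, rfl⟩ := Submodule.Quotient.mk_surjective _ x
    exact congrArg _ (nat_apply φ g x)

end Subfun

/-- The image of a natural transformation. -/
def imageSubfun {F G : C ⥤ ModuleCat.{s} k} (φ : F ⟶ G) : Subfun G where
  carrier V := LinearMap.range (φ.app V).hom
  map_mem := by
    rintro _ _ f _ ⟨y, rfl⟩
    exact ⟨F.map f y, nat_apply φ f y⟩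

/-- The short exact sequence of an injective natural transformation and the quotient by its
image. -/
lemma shortExact_image {F G : C ⥤ ModuleCat.{s} k} (φ : F ⟶ G)
    (h : ∀ V, Function.Injective (φ.app V)) :
    (ShortComplex.mk φ (imageSubfun φ).π (hom_ext_apply fun V x ↦
      ((imageSubfun φ).π_eq_zero_iff V _).2 ⟨x, rfl⟩)).ShortExact :=
  shortExact_mk _ _ h (imageSubfun φ).π_surjective
    (fun V x ↦ ((imageSubfun φ).π_eq_zero_iff V _).2 ⟨x, rfl⟩)
    fun V _ hx ↦ ((imageSubfun φ).π_eq_zero_iff V _).1 hx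

/-- The kernel of a natural transformation. -/
def kerSubfun {F G : C ⥤ ModuleCat.{s} k} (φ : F ⟶ G) : Subfun F where
  carrier V := LinearMap.ker (φ.app V).hom
  map_mem f x hx := by
    have : φ.app _ x = 0 := hx
    change φ.app _ (F.map f x) = 0
    rw [nat_apply, this, map_zero]

end FunctorCategory

section Injectives

universe v v' u' s

variable {C : Type u'} [Category.{v'} C] {k : Type u} [Field k]

/-- The functor `V ↦ Map(V ⟶ W, U)`. -/
def coRep (W : C) (U : ModuleCat.{max v' s} k) : C ⥤ ModuleCat.{max v' s} k :=
  funMk (fun V ↦ (V ⟶ W) → U)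
    (fun f ↦ { toFun := fun g a ↦ g (f ≫ a), map_add' := fun _ _ ↦ rfl, map_smul' := fun _ _ ↦ rfl })
    (fun V x ↦ by ext a; simp) (fun f g x ↦ by ext a; simp)

lemma exists_extend_of_injective {M N U : Type*} [AddCommGroup M] [AddCommGroup N] [AddCommGroup U]
    [Module k M] [Module k N] [Module k U] (i : M →ₗ[k] N) (hi : Function.Injective i)
    (f : M →ₗ[k] U) : ∃ g : N →ₗ[k] U, ∀ x, g (i x) = f x := by
  obtain ⟨r, hr⟩ := i.exists_leftInverse_of_injective (LinearMap.ker_eq_bot.2 hi)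
  exact ⟨f ∘ₗ r, fun x ↦ congrArg f (LinearMap.congr_fun hr x)⟩

/-- The natural transformation into `Map(- ⟶ W, U)` given by a linear map at `W`. -/
def toCoRep {F : C ⥤ ModuleCat.{max v' s} k} (W : C) (U : ModuleCat.{max v' s} k)
    (f : F.obj W →ₗ[k] U) : F ⟶ coRep.{u, v', u', s} W U :=
  homMk (fun V ↦ LinearMap.pi fun a ↦ f ∘ₗ (F.map a).hom)
    fun g x ↦ funext fun a ↦ congrArg f (map_comp_apply F g a x).symm

instance (W : C) (U : ModuleCat.{max v' s} k) : Injective (coRep.{u, v', u', s} W U) where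
  factors {F G} g f hf := by
    rw [mono_iff_injective] at hf
    obtain ⟨h, hh⟩ := exists_extend_of_injective (f.app W).hom (hf W)
      ((LinearMap.proj (𝟙 W)) ∘ₗ (g.app W).hom : F.obj W →ₗ[k] U)
    refine ⟨toCoRep W U h, hom_ext_apply fun V x ↦ funext fun a ↦ ?_⟩
    change h (G.map a (f.app V x)) = _
    rw [← nat_apply]
    refine (hh _).trans ?_
    change (g.app W (F.map a x) : (W ⟶ W) → U) (𝟙 W) = _
    rw [nat_apply]
    change (g.app V x : (V ⟶ W) → U) (a ≫ 𝟙 W) = _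
    rw [Category.comp_id]

/-- The pointwise product of a sequence of functors. -/
def piFun {J : Type} (E : J → C ⥤ ModuleCat.{s} k) : C ⥤ ModuleCat.{s} k :=
  funMk (fun V ↦ ∀ j, (E j).obj V) (fun f ↦ LinearMap.pi fun j ↦ ((E j).map f).hom ∘ₗ LinearMap.proj j)
    (fun V x ↦ funext fun j ↦ map_id_apply _ _) (fun f g x ↦ funext fun j ↦ map_comp_apply _ _ _ _)

/-- The projections of a product of functors. -/
def piProj {J : Type} (E : J → C ⥤ ModuleCat.{s} k) (j : J) : piFun E ⟶ E j :=
  homMk (fun V ↦ LinearMap.proj j) fun _ _ ↦ rfl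

/-- The universal morphism into a product of functors. -/
def piLift {J : Type} (E : J → C ⥤ ModuleCat.{s} k) {F : C ⥤ ModuleCat.{s} k} (φ : ∀ j, F ⟶ E j) :
    F ⟶ piFun E :=
  homMk (fun V ↦ LinearMap.pi fun j ↦ ((φ j).app V).hom) fun g x ↦ funext fun j ↦ nat_apply (φ j) g x

instance {J : Type} (E : J → C ⥤ ModuleCat.{s} k) [∀ j, Injective (E j)] : Injective (piFun E) where
  factors g f _ := by
    refine ⟨piLift E fun j ↦ Injective.factorThru (g ≫ piProj E j) f,
      hom_ext_apply fun V x ↦ funext fun j ↦ ?_⟩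
    change (f ≫ Injective.factorThru (g ≫ piProj E j) f).app V x = _
    rw [Injective.comp_factorThru]
    rfl

/-- The product of the functors `Map(- ⟶ W j, F (W j))`, together with the embedding of `F`. -/
def effObj {J : Type} (W : J → C) (F : C ⥤ ModuleCat.{max v' s} k) :
    C ⥤ ModuleCat.{max v' s} k :=
  piFun fun j ↦ coRep.{u, v', u', s} (W j) (F.obj (W j))

/-- The embedding of `F` into `effObj W F`. -/
def effHom {J : Type} (W : J → C) (F : C ⥤ ModuleCat.{max v' s} k) :
    F ⟶ effObj.{u, v', u', s} W F :=
  piLift _ fun j ↦ toCoRep (W j) (F.obj (W j)) LinearMap.id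

instance {J : Type} (W : J → C) (F : C ⥤ ModuleCat.{max v' s} k) :
    Injective (effObj.{u, v', u', s} W F) := by
  unfold effObj; infer_instance

lemma mono_effHom {J : Type} (W : J → C) (hW : ∀ V, ∃ j, Nonempty (V ≅ W j))
    (F : C ⥤ ModuleCat.{max v' s} k) : Mono (effHom.{u, v', u', s} W F) := by
  rw [mono_iff_injective]
  intro V x y hxy
  obtain ⟨j, ⟨e⟩⟩ := hW V
  have : F.map e.hom x = F.map e.hom y := congrFun (congrFun hxy j) e.hom
  rw [← map_id_apply F x, ← e.hom_inv_id, map_comp_apply, this, ← map_comp_apply, e.hom_inv_id,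
    map_id_apply]

lemma enoughInjectives {J : Type} (W : J → C) (hW : ∀ V, ∃ j, Nonempty (V ≅ W j)) :
    EnoughInjectives (C ⥤ ModuleCat.{max v' s} k) where
  presentation F := ⟨{ J := effObj.{u, v', u', s} W F, f := effHom W F, mono := mono_effHom W hW F }⟩

end Injectives

section MatrixCategory

universe r

/-- The category of finite free modules over `R`: objects are finite types, morphisms are
matrices acting on row vectors. -/
structure Mt (R : Type r) where
  /-- The index type. -/
  ι : Type
  [fintype : Fintype ι]
  [decEq : DecidableEq ι]

attribute [instance] Mt.fintype Mt.decEq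

variable {R : Type r} [CommRing R]

/-- Morphisms of `Mt R` are matrices. -/
@[ext]
structure Mt.Hom (V W : Mt R) where
  /-- The matrix of a morphism. -/
  mat : Matrix V.ι W.ι R

instance : Category (Mt R) where
  Hom V W := Mt.Hom V W
  id V := ⟨1⟩
  comp f g := ⟨f.mat * g.mat⟩
  id_comp f := Mt.Hom.ext (Matrix.one_mul f.mat)
  comp_id f := Mt.Hom.ext (Matrix.mul_one f.mat)
  assoc f g h := Mt.Hom.ext (Matrix.mul_assoc f.mat g.mat h.mat)

/-- The matrix of a morphism. -/
def Mt.mat {V W : Mt R} (f : V ⟶ W) : Matrix V.ι W.ι R := Mt.Hom.mat f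

/-- The morphism given by a matrix. -/
def Mt.ofMat {V W : Mt R} (M : Matrix V.ι W.ι R) : V ⟶ W := Mt.Hom.mk M

namespace Mt

/-- Morphisms are the same as matrices. -/
def homEquiv (V W : Mt R) : (V ⟶ W) ≃ Matrix V.ι W.ι R := ⟨mat, ofMat, fun _ ↦ rfl, fun _ ↦ rfl⟩

@[simp] lemma mat_ofMat {V W : Mt R} (M : Matrix V.ι W.ι R) :
    mat (ofMat M : V ⟶ W) = M := rfl

@[simp] lemma ofMat_mat {V W : Mt R} (f : V ⟶ W) : ofMat (mat f) = f := rfl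

@[simp] lemma mat_comp {U V W : Mt R} (f : U ⟶ V) (g : V ⟶ W) : mat (f ≫ g) = mat f * mat g := rfl

@[simp] lemma mat_id (V : Mt R) : mat (𝟙 V) = 1 := rfl

lemma hom_ext {V W : Mt R} {f g : V ⟶ W} (h : mat f = mat g) : f = g := Mt.Hom.ext h

instance (V W : Mt R) : AddCommGroup (V ⟶ W) := (homEquiv V W).addCommGroup

@[simp] lemma mat_add {V W : Mt R} (f g : V ⟶ W) : mat (f + g) = mat f + mat g := rfl

@[simp] lemma mat_zero (V W : Mt R) : mat (0 : V ⟶ W) = 0 := rfl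

instance : Preadditive (Mt R) where
  add_comp _ _ _ f f' g := hom_ext (by simp [Matrix.add_mul])
  comp_add _ _ _ f g g' := hom_ext (by simp [Matrix.mul_add])

/-- The direct sum of two objects. -/
def biprodData (V W : Mt R) : Limits.BinaryBicone V W where
  pt := ⟨V.ι ⊕ W.ι⟩
  fst := ofMat (Matrix.fromRows 1 0)
  snd := ofMat (Matrix.fromRows 0 1)
  inl := ofMat (Matrix.fromCols 1 0)
  inr := ofMat (Matrix.fromCols 0 1)
  inl_fst := hom_ext (by simp [Matrix.fromCols_mul_fromRows])
  inl_snd := hom_ext (by simp [Matrix.fromCols_mul_fromRows])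
  inr_fst := hom_ext (by simp [Matrix.fromCols_mul_fromRows])
  inr_snd := hom_ext (by simp [Matrix.fromCols_mul_fromRows])

instance : Limits.HasBinaryBiproducts (Mt R) where
  has_binary_biproduct V W := Limits.hasBinaryBiproduct_of_total (biprodData V W)
    (hom_ext (by
      rw [mat_add, mat_comp, mat_comp]
      change Matrix.fromRows (1 : Matrix V.ι V.ι R) 0 * Matrix.fromCols (1 : Matrix V.ι V.ι R) 0 +
        Matrix.fromRows 0 (1 : Matrix W.ι W.ι R) * Matrix.fromCols 0 (1 : Matrix W.ι W.ι R)
        = (1 : Matrix (V.ι ⊕ W.ι) (V.ι ⊕ W.ι) R)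
      simp only [Matrix.fromRows_mul_fromCols, ← Matrix.fromBlocks_one,
        Matrix.mul_one, Matrix.mul_zero, Matrix.zero_mul]
      exact (Matrix.fromBlocks_add _ _ _ _ _ _ _ _).trans (by simp)))

lemma exists_iso_fin (V : Mt R) : ∃ n : ℕ, Nonempty (V ≅ ⟨Fin n⟩) := by
  obtain ⟨n, ⟨e⟩⟩ := Finite.exists_equiv_fin V.ι
  refine ⟨n, ⟨⟨ofMat ((1 : Matrix V.ι V.ι R).submatrix id e.symm),
    ofMat ((1 : Matrix V.ι V.ι R).submatrix e.symm id), hom_ext ?_, hom_ext ?_⟩⟩⟩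
  · rw [mat_comp, mat_ofMat, mat_ofMat, Matrix.submatrix_mul_equiv, Matrix.one_mul]
    rfl
  · rw [mat_comp, mat_ofMat, mat_ofMat]
    ext i j
    simp [Matrix.mul_apply, Matrix.one_apply]

end Mt

instance {k : Type u} [Field k] : EnoughInjectives (Mt R ⥤ ModuleCat.{max r u} k) :=
  enoughInjectives.{u, r, 1, u} (fun n : ℕ ↦ (⟨Fin n⟩ : Mt R)) Mt.exists_iso_fin

end MatrixCategory

section Additivity

universe v v' u' s

open CategoryTheory.Limits (biprod)
variable {C : Type u'} [Category.{v'} C] [Preadditive C] [Limits.HasBinaryBiproducts C]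

/-- The doubling functor `V ↦ V ⊞ V`. -/
noncomputable def dbl : C ⥤ C where
  obj V := V ⊞ V
  map f := biprod.map f f

/-- The natural transformation `V ⟶ V ⊞ V` given by the first inclusion. -/
noncomputable def dblInl : 𝟭 C ⟶ dbl where
  app V := biprod.inl
  naturality V W f := by simp [dbl]

/-- The natural transformation `V ⟶ V ⊞ V` given by the second inclusion. -/
noncomputable def dblInr : 𝟭 C ⟶ dbl where
  app V := biprod.inr
  naturality V W f := by simp [dbl]

/-- The diagonal. -/
noncomputable def dblDiag : 𝟭 C ⟶ dbl := dblInl + dblInr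

variable {k : Type u} [Field k]

/-- The natural transformation `F V ⟶ F (V ⊞ V)` obtained by applying `F`. -/
noncomputable def along (a : 𝟭 C ⟶ dbl) (F : C ⥤ ModuleCat.{s} k) : F ⟶ dbl ⋙ F where
  app V := F.map (a.app V)
  naturality V W f := by
    have := a.naturality f
    dsimp at this ⊢
    rw [← F.map_comp, ← F.map_comp, this]

variable [EnoughInjectives (C ⥤ ModuleCat.{s} k)] [HasExt.{w} (C ⥤ ModuleCat.{s} k)]
  (X : C ⥤ ModuleCat.{s} k) [X.Additive]

omit [EnoughInjectives (C ⥤ ModuleCat.{s} k)] [X.Additive] in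
lemma push_along_conn (c : 𝟭 C ⟶ dbl) {S : ShortComplex (C ⥤ ModuleCat.{s} k)} (hS : S.ShortExact)
    (t : ℕ) (y : Ext X S.X₃ t) : push k X (along c S.X₁) (t + 1) (conn k X hS t y) =
      conn k X (shortExact_precomp dbl hS) t (push k X (along c S.X₃) t y) :=
  conn_naturality k hS (shortExact_precomp dbl hS)
    { τ₁ := along c _
      τ₂ := along c _
      τ₃ := along c _
      comm₁₂ := hom_ext_apply fun V x ↦ (nat_apply S.f (c.app V) x)
      comm₂₃ := hom_ext_apply fun V x ↦ (nat_apply S.g (c.app V) x) } t y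

lemma push_along_add (a b : 𝟭 C ⟶ dbl) (F : C ⥤ ModuleCat.{s} k) (t : ℕ) (x : Ext X F t) :
    push k X (along (a + b) F) t x = push k X (along a F) t x + push k X (along b F) t x := by
  induction t generalizing F with
  | zero =>
    obtain ⟨f, rfl⟩ := (Ext.mk₀_bijective _ _).surjective x
    rw [push_mk₀, push_mk₀, push_mk₀, ← Ext.mk₀_add]
    congr 1
    refine hom_ext_apply fun V y ↦ ?_
    have (c : 𝟭 C ⟶ dbl) : (f ≫ along c F).app V y = f.app _ (X.map (c.app V) y) :=
      (nat_apply f (c.app V) y).symm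
    rw [add_app_apply, this, this, this, NatTrans.app_add, X.map_add, ← map_add]
    rfl
  | succ t ih =>
    have hS := shortExact_cokernel (Injective.ι F)
    have := subsingleton_ext_of_injective (X := X) (Injective.under F) t
    obtain ⟨y, rfl⟩ := exists_conn k hS t x (Subsingleton.elim _ _)
    have key (c : 𝟭 C ⟶ dbl) : push k X (along c F) (t + 1) (conn k X hS t y) =
        conn k X (shortExact_precomp dbl hS) t (push k X (along c _) t y) :=
      push_along_conn X c hS t y
    rw [key, key, key, ih]
    exact map_add (conn k X (shortExact_precomp dbl hS) t) _ _

/-- A functor `F` with a suitable retraction of `F V ⟶ F (V ⊞ V)` has no extensions by an additive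
functor. -/
lemma subsingleton_of_retraction {F : C ⥤ ModuleCat.{s} k} (r : dbl ⋙ F ⟶ F) (c : k) (hc : c ≠ 0)
    (h : along dblDiag F ≫ r = c • 𝟙 F) (t : ℕ)
    (hl : ∀ x, push k X (along dblInl F ≫ r) t x = 0)
    (hr : ∀ x, push k X (along dblInr F ≫ r) t x = 0) : Subsingleton (Ext X F t) := by
  refine subsingleton_of_forall_eq 0 fun x ↦ ?_
  have : push k X (c • 𝟙 F) t x = 0 := by
    rw [← h, push_comp, dblDiag, push_along_add, map_add, ← push_comp, ← push_comp, hl, hr, add_zero]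
  rw [push_smul, push_id] at this
  exact (smul_eq_zero.1 this).resolve_left hc

end Additivity

section Rbar

universe u'

open CategoryTheory.Limits (biprod)

variable {C : Type u'} [Category.{0} C] [Preadditive C]
  {k : Type u} [Field k] (W : C)

/-- Functors vanishing on zero maps. -/
def Reduced (N : C ⥤ ModuleCat.{u} k) : Prop := ∀ (V V' : C) (x : N.obj V), N.map (0 : V ⟶ V') x = 0

/-- The module of functions `(V ⟶ W) → N V` vanishing at `0`. -/
def RbarMod (N : C ⥤ ModuleCat.{u} k) (V : C) : Submodule k ((V ⟶ W) → N.obj V) :=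
  LinearMap.ker (LinearMap.proj (0 : V ⟶ W))

variable {W} in
lemma RbarMod.map_zero {N : C ⥤ ModuleCat.{u} k} {V : C} (g : RbarMod W N V) : g.1 0 = 0 := g.2

/-- The functor `V ↦ {g : (V ⟶ W) → N V | g 0 = 0}`. -/
def Rbar (N : C ⥤ ModuleCat.{u} k) : C ⥤ ModuleCat.{u} k :=
  funMk (fun V ↦ RbarMod W N V)
    (fun f ↦ { toFun := fun g ↦ ⟨fun a ↦ N.map f (g.1 (f ≫ a)), by
                change N.map f (g.1 (f ≫ 0)) = 0
                rw [Limits.comp_zero, RbarMod.map_zero g, map_zero]⟩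
               map_add' := fun x y ↦ Subtype.ext (funext fun a ↦ _root_.map_add (N.map f).hom _ _)
               map_smul' := fun c x ↦ Subtype.ext (funext fun a ↦ _root_.map_smul (N.map f).hom _ _) })
    (fun V x ↦ Subtype.ext (funext fun a ↦ by simp))
    (fun f g x ↦ Subtype.ext (funext fun a ↦ by simp))

/-- The value of an element of `Rbar W N`. -/
def rval {N : C ⥤ ModuleCat.{u} k} {V : C} (g : (Rbar W N).obj V) (a : V ⟶ W) : N.obj V :=
  Subtype.val (p := (· ∈ RbarMod W N V)) g a

variable {W} {N M : C ⥤ ModuleCat.{u} k}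

lemma rbar_ext {V : C} {g h : (Rbar W N).obj V} (H : ∀ a, rval W g a = rval W h a) : g = h :=
  Subtype.ext (funext H)

/-- Construct an element of `Rbar W N`. -/
def rmk {V : C} (g : (V ⟶ W) → N.obj V) (h : g 0 = 0) : (Rbar W N).obj V :=
  (⟨g, h⟩ : RbarMod W N V)

@[simp] lemma rval_rmk {V : C} (g : (V ⟶ W) → N.obj V) (h : g 0 = 0) (a : V ⟶ W) :
    rval W (rmk g h) a = g a := rfl

@[simp] lemma rval_zero {V : C} (g : (Rbar W N).obj V) : rval W g 0 = 0 := RbarMod.map_zero g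

@[simp] lemma rval_map {V V' : C} (f : V ⟶ V') (g : (Rbar W N).obj V) (a : V' ⟶ W) :
    rval W ((Rbar W N).map f g) a = N.map f (rval W g (f ≫ a)) := rfl

@[simp] lemma rval_add {V : C} (g h : (Rbar W N).obj V) (a : V ⟶ W) :
    rval W (g + h) a = rval W g a + rval W h a := rfl

@[simp] lemma rval_smul {V : C} (c : k) (g : (Rbar W N).obj V) (a : V ⟶ W) :
    rval W (c • g) a = c • rval W g a := rfl

lemma reduced_Rbar : Reduced (Rbar W N) := fun V V' x ↦ rbar_ext fun a ↦ by
  rw [rval_map, Limits.zero_comp, rval_zero, map_zero]; rfl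

/-- Functoriality of `Rbar`. -/
def rbarMap (W : C) (φ : N ⟶ M) : Rbar W N ⟶ Rbar W M :=
  homMk (fun V ↦ { toFun := fun g ↦ rmk (fun a ↦ φ.app V (rval W g a)) (by simp)
                   map_add' := fun _ _ ↦ rbar_ext fun a ↦ by simp
                   map_smul' := fun _ _ ↦ rbar_ext fun a ↦ by simp })
    fun g x ↦ rbar_ext fun a ↦ nat_apply φ g _

@[simp] lemma rval_rbarMap (φ : N ⟶ M) {V : C} (g : (Rbar W N).obj V) (a : V ⟶ W) :
    rval W ((rbarMap W φ).app V g) a = φ.app V (rval W g a) := rfl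

variable [Limits.HasBinaryBiproducts C]
  [EnoughInjectives (C ⥤ ModuleCat.{u} k)] [HasExt.{w} (C ⥤ ModuleCat.{u} k)]
  (X : C ⥤ ModuleCat.{u} k) [X.Additive]

/-- The retraction showing acyclicity of `Rbar W N`. -/
noncomputable def rbarRetraction (W : C) (N : C ⥤ ModuleCat.{u} k) : dbl ⋙ Rbar W N ⟶ Rbar W N :=
  homMk (fun V ↦ { toFun := fun g ↦ rmk (fun a ↦ N.map biprod.snd (rval W (V := V ⊞ V) g (biprod.fst ≫ a)))
                    
                      ((congrArg (N.map biprod.snd) ((congrArg (rval W (N := N) (V := V ⊞ V) g)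
                        Limits.comp_zero).trans (rval_zero _))).trans (map_zero (N.map biprod.snd).hom))
                   map_add' := fun x y ↦ rbar_ext fun a ↦ map_add (N.map biprod.snd).hom _ _
                   map_smul' := fun c x ↦ rbar_ext fun a ↦ map_smul (N.map biprod.snd).hom _ _ })
    fun {V V'} f x ↦ rbar_ext fun a ↦ by
      change N.map biprod.snd (N.map (biprod.map f f) (rval W (V := V ⊞ V) x (biprod.map f f ≫ biprod.fst ≫ a)))
        = N.map f (N.map biprod.snd (rval W (V := V ⊞ V) x (biprod.fst ≫ f ≫ a)))
      rw [← map_comp_apply, ← map_comp_apply]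
      simp

lemma rval_along_rbarRetraction (a : 𝟭 C ⟶ dbl) {V : C} (c : V ⟶ V ⊞ V) (hc : c = a.app V)
    (g : (Rbar W N).obj V) (l : V ⟶ W) :
    rval W ((along a _ ≫ rbarRetraction W N).app V g) l =
      N.map (c ≫ biprod.snd) (rval W g (c ≫ biprod.fst ≫ l)) := by
  subst hc
  exact (map_comp_apply _ _ _ _).symm

lemma subsingleton_ext_rbar' (W : C) (N : C ⥤ ModuleCat.{u} k) (t : ℕ)
    (h : ∀ x, push k X (along dblInl (Rbar W N) ≫ rbarRetraction W N) t x = 0) :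
    Subsingleton (Ext X (Rbar W N) t) := by
  refine subsingleton_of_retraction X (rbarRetraction W N) 1 one_ne_zero ?_ t h fun x ↦ ?_
  · refine hom_ext_apply fun V g ↦ rbar_ext fun a ↦ ?_
    obtain ⟨c, hc⟩ : ∃ c : V ⟶ V ⊞ V, c = biprod.inl + biprod.inr := ⟨_, rfl⟩
    rw [rval_along_rbarRetraction dblDiag c hc, hc, Preadditive.add_comp,
      Preadditive.add_comp, biprod.inl_snd, biprod.inr_snd, biprod.inl_fst_assoc, biprod.inr_fst_assoc,
      zero_add, Limits.zero_comp, add_zero, map_id_apply, one_smul]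
    rfl
  · have : along dblInr (Rbar W N) ≫ rbarRetraction W N = 0 :=
      hom_ext_apply fun V g ↦ rbar_ext fun a ↦ by
        rw [rval_along_rbarRetraction dblInr biprod.inr rfl]
        simp
        rfl
    rw [this, push_zero]

lemma subsingleton_ext_rbar_of_reduced (W : C) (hN : Reduced N) (t : ℕ) :
    Subsingleton (Ext X (Rbar W N) t) := by
  refine subsingleton_ext_rbar' X W N t fun x ↦ ?_
  have : along dblInl (Rbar W N) ≫ rbarRetraction W N = 0 :=
    hom_ext_apply fun V g ↦ rbar_ext fun a ↦ by
      rw [rval_along_rbarRetraction dblInl biprod.inl rfl, biprod.inl_snd, hN]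
      rfl
  rw [this, push_zero]

lemma subsingleton_ext_rbar (W : C) (N : C ⥤ ModuleCat.{u} k) (t : ℕ) :
    Subsingleton (Ext X (Rbar W N) (t + 1)) := by
  refine subsingleton_ext_rbar' X W N _ fun x ↦ ?_
  have := subsingleton_ext_of_injective (X := X) (coRep.{u, 0, u', u} W (N.obj W)) t
  let f : Rbar W N ⟶ coRep.{u, 0, u', u} W (N.obj W) :=
    homMk (fun V ↦ { toFun := fun g a ↦ N.map (0 : V ⟶ W) (rval W g a)
                     map_add' := fun _ _ ↦ funext fun a ↦ map_add (N.map (0 : V ⟶ W)).hom _ _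
                     map_smul' := fun _ _ ↦ funext fun a ↦ map_smul (N.map (0 : V ⟶ W)).hom _ _ })
      fun {V V'} f x ↦ funext fun a ↦ by
        change N.map 0 (N.map f (rval W x (f ≫ a))) = N.map 0 (rval W x (f ≫ a))
        rw [← map_comp_apply, Limits.comp_zero]
  let g : coRep.{u, 0, u', u} W (N.obj W) ⟶ Rbar W N :=
    homMk (fun V ↦ { toFun := fun h ↦ rmk (fun a ↦ N.map (0 : W ⟶ V)
                        ((h : (V ⟶ W) → N.obj W) a - (h : (V ⟶ W) → N.obj W) 0)) (by simp)
                     map_add' := fun x y ↦ rbar_ext fun a ↦ by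
                      rw [rval_add]
                      simp only [rval_rmk]
                      rw [← map_add]
                      congr 1
                      exact add_sub_add_comm _ _ _ _
                     map_smul' := fun c x ↦ rbar_ext fun a ↦ by
                      rw [RingHom.id_apply, rval_smul]
                      simp only [rval_rmk]
                      rw [← map_smul]
                      congr 1
                      exact (smul_sub c (_ : N.obj W) _).symm })
      fun {V V'} f x ↦ rbar_ext fun a ↦ by
        change N.map 0 ((x : (V ⟶ W) → N.obj W) (f ≫ a) - (x : (V ⟶ W) → N.obj W) (f ≫ 0)) =
          N.map f (N.map 0 ((x : (V ⟶ W) → N.obj W) (f ≫ a) - (x : (V ⟶ W) → N.obj W) 0))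
        rw [← map_comp_apply, Limits.zero_comp, Limits.comp_zero]
  have : along dblInl (Rbar W N) ≫ rbarRetraction W N = f ≫ g :=
    hom_ext_apply fun V h ↦ rbar_ext fun a ↦ by
      rw [rval_along_rbarRetraction dblInl biprod.inl rfl]
      change _ =
        N.map (0 : W ⟶ V) (N.map (0 : V ⟶ W) (rval W h a) - N.map (0 : V ⟶ W) (rval W h 0))
      rw [rval_zero, map_zero, sub_zero, ← map_comp_apply]
      simp
  rw [this, push_eq_zero_of_factor]

/-- The functor `V ↦ M (V ⊞ W)`. -/
noncomputable def shiftFun (W : C) (M : C ⥤ ModuleCat.{u} k) : C ⥤ ModuleCat.{u} k :=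
  ({ obj := fun V ↦ V ⊞ W, map := fun f ↦ biprod.map f (𝟙 W) } : C ⥤ C) ⋙ M

/-- The difference morphism `m ↦ (a ↦ M (1, a) m - M (1, 0) m)`. -/
noncomputable def diffHom (W : C) (M : C ⥤ ModuleCat.{u} k) : M ⟶ Rbar W (shiftFun W M) :=
  homMk (fun V ↦ { toFun := fun m ↦ rmk (N := shiftFun W M)
                    (fun a ↦ M.map (biprod.lift (𝟙 V) a) m - M.map (biprod.lift (𝟙 V) 0) m) (sub_self _)
                   map_add' := fun x y ↦ rbar_ext fun a ↦ by
                    simp only [rval_rmk, rval_add, map_add]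
                    exact add_sub_add_comm _ _ _ _
                   map_smul' := fun c x ↦ rbar_ext fun a ↦ by
                    simp only [rval_rmk, RingHom.id_apply, rval_smul, map_smul]
                    exact (smul_sub _ _ _).symm })
    fun {V V'} f x ↦ rbar_ext fun a ↦ by
      change M.map (biprod.lift (𝟙 V') a) (M.map f x) - M.map (biprod.lift (𝟙 V') 0) (M.map f x) =
        M.map (biprod.map f (𝟙 W)) (M.map (biprod.lift (𝟙 V) (f ≫ a)) x
          - M.map (biprod.lift (𝟙 V) 0) x)
      rw [map_sub, ← map_comp_apply, ← map_comp_apply, ← map_comp_apply, ← map_comp_apply]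
      congr 3 <;> · congr 1; ext <;> simp

lemma diffHom_injective (hM : Reduced M) (V : C)
    (hV : 𝟙 V ∈ AddSubgroup.closure {f : V ⟶ V | ∃ (a : V ⟶ W) (b : W ⟶ V), f = a ≫ b}) :
    Function.Injective ((diffHom W M).app V) := by
  refine (injective_iff_map_eq_zero ((diffHom W M).app V).hom).2 fun m hm ↦ ?_
  have key (f : V ⟶ V) (a : V ⟶ W) (b : W ⟶ V) : M.map (f + a ≫ b) m = M.map f m := by
    have : rval W ((diffHom W M).app V m) a = 0 := congrArg (fun z ↦ rval W z a) hm
    replace this : M.map (biprod.lift (𝟙 V) a) m = M.map (biprod.lift (𝟙 V) 0) m := sub_eq_zero.1 this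
    have h := congrArg (M.map (biprod.desc f b)) this
    rw [← map_comp_apply, ← map_comp_apply] at h
    simpa using h
  have (g : V ⟶ V) (hg : g ∈ AddSubgroup.closure
      {f : V ⟶ V | ∃ (a : V ⟶ W) (b : W ⟶ V), f = a ≫ b}) (f : V ⟶ V) :
      M.map (f + g) m = M.map f m := by
    induction hg using AddSubgroup.closure_induction generalizing f with
    | mem x hx => obtain ⟨a, b, rfl⟩ := hx; exact key f a b
    | zero => rw [add_zero]
    | add x y _ _ hx hy => rw [← add_assoc, hy, hx]
    | neg x _ hx => rw [← hx (f + -x), neg_add_cancel_right]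
  have := this _ hV 0
  rwa [zero_add, hM, map_id_apply] at this

lemma Subfun.reduced_quot {F : C ⥤ ModuleCat.{u} k} (S : Subfun F) (hF : Reduced F) :
    Reduced S.quot := by
  intro V V' x
  obtain ⟨x, rfl⟩ := Subfun.π_surjective _ V x
  rw [← nat_apply, hF, map_zero]

/-- Extensions of a finitely generated additive functor by a functor `M` which is annihilated
pointwise by a sequence of maps are annihilated by some map of the sequence. -/
lemma exists_push_eq_zero (hW : ∀ V : C, 𝟙 V ∈ AddSubgroup.closure
      {f : V ⟶ V | ∃ (a : V ⟶ W) (b : W ⟶ V), f = a ≫ b}) [∀ V : C, Finite (V ⟶ W)]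
    (V₀ : C) (x₀ : X.obj V₀)
    (hX : ∀ (F : C ⥤ ModuleCat.{u} k) (f : X ⟶ F), f.app V₀ x₀ = 0 → f = 0)
    (t : ℕ) (M : C ⥤ ModuleCat.{u} k) (hM : Reduced M) (M' : ℕ → C ⥤ ModuleCat.{u} k)
    (hM' : ∀ n, Reduced (M' n)) (g : ∀ n, M ⟶ M' n)
    (hg : ∀ V x, ∃ n₀, ∀ n, n₀ ≤ n → (g n).app V x = 0) (y : Ext X M t) :
    ∃ n, push k X (g n) t y = 0 := by
  induction t generalizing M M' with
  | zero =>
    obtain ⟨f, rfl⟩ := (Ext.mk₀_bijective _ _).surjective y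
    obtain ⟨n, hn⟩ := hg V₀ (f.app V₀ x₀)
    refine ⟨n, ?_⟩
    rw [push_mk₀, hX _ (f ≫ g n) (hn n le_rfl), Ext.mk₀_zero]
  | succ t ih =>
    have hS := shortExact_image (diffHom W M) fun V ↦ diffHom_injective hM V (hW V)
    have hS' n := shortExact_image (diffHom W (M' n)) fun V ↦ diffHom_injective (hM' n) V (hW V)
    have := subsingleton_ext_rbar X W (shiftFun W M) t
    obtain ⟨z, rfl⟩ := exists_conn k hS t y (Subsingleton.elim _ _)
    let G n : Rbar W (shiftFun W M) ⟶ Rbar W (shiftFun W (M' n)) :=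
      rbarMap W ((Functor.whiskeringLeft _ _ _).obj _ |>.map (g n))
    have hG n : g n ≫ diffHom W (M' n) = diffHom W M ≫ G n :=
      hom_ext_apply fun V x ↦ rbar_ext fun a ↦ by
        change (M' n).map (biprod.lift (𝟙 V) a) ((g n).app V x) -
          (M' n).map (biprod.lift (𝟙 V) 0) ((g n).app V x) =
          (g n).app (V ⊞ W) (M.map (biprod.lift (𝟙 V) a) x - M.map (biprod.lift (𝟙 V) 0) x)
        rw [map_sub, nat_apply, nat_apply]
    let q n : (imageSubfun (diffHom W M)).quot ⟶ (imageSubfun (diffHom W (M' n))).quot :=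
      Subfun.quotMap _ _ (G n) (by
        rintro V _ ⟨x, rfl⟩
        exact ⟨(g n).app V x, congrArg (fun z ↦ z.app V x) (hG n)⟩)
    have hq V x : ∃ n₀, ∀ n, n₀ ≤ n → (q n).app V x = 0 := by
      obtain ⟨x, rfl⟩ := Subfun.π_surjective _ V x
      choose n₀ hn₀ using fun a : V ⟶ W ↦ hg (V ⊞ W) (rval W (N := shiftFun W M) x a)
      obtain ⟨N, hN⟩ := (Set.finite_range n₀).bddAbove
      refine ⟨N, fun n hn ↦ ?_⟩
      have : (G n).app V x = 0 := rbar_ext fun a ↦ hn₀ a n ((hN ⟨a, rfl⟩).trans hn)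
      change (imageSubfun (diffHom W (M' n))).π.app V ((G n).app V x) = 0
      rw [this, map_zero]
    obtain ⟨n, hn⟩ := ih _ (Subfun.reduced_quot _ reduced_Rbar) _
      (fun n ↦ Subfun.reduced_quot _ reduced_Rbar) q hq z
    refine ⟨n, ?_⟩
    rw [conn_naturality k hS (hS' n)
      { τ₁ := g n, τ₂ := G n, τ₃ := q n, comm₁₂ := hG n, comm₂₃ := rfl }]
    change conn k X (hS' n) t (push k X (q n) t z) = 0
    rw [hn, map_zero]

end Rbar

section WeightedSubstitution

open MvPolynomial

variable {k σ τ N N' : Type*} [CommRing k] [AddCommMonoid N] [AddCommMonoid N']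

/-- A substitution homogeneous on the variables is homogeneous. -/
lemma isWeightedHomogeneous_algHom {w : σ → N} {w' : τ → N'} (α : N →+ N')
    (φ : MvPolynomial σ k →ₐ[k] MvPolynomial τ k)
    (h : ∀ i, IsWeightedHomogeneous w' (φ (X i)) (α (w i))) {f : MvPolynomial σ k} {m : N}
    (hf : IsWeightedHomogeneous w f m) : IsWeightedHomogeneous w' (φ f) (α m) := by
  classical
  rw [f.as_sum, map_sum]
  refine IsWeightedHomogeneous.sum _ _ _ fun d hd ↦ ?_
  rw [← hf (mem_support_iff.1 hd), monomial_eq, map_mul, algHom_C, ← C_eq_algebraMap, Finsupp.prod, map_prod,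
    Finsupp.weight_apply, Finsupp.sum, map_sum]
  refine IsWeightedHomogeneous.C_mul (IsWeightedHomogeneous.prod _ _ _ fun i _ ↦ ?_) _
  rw [map_pow, map_nsmul]
  exact (h i).pow _

/-- A substitution preserving weights commutes with taking weighted homogeneous components. -/
lemma weightedHomogeneousComponent_algHom {w : σ → N} {w' : τ → N}
    (φ : MvPolynomial σ k →ₐ[k] MvPolynomial τ k)
    (h : ∀ i, IsWeightedHomogeneous w' (φ (X i)) (w i)) (f : MvPolynomial σ k) (m : N) :
    weightedHomogeneousComponent w' m (φ f) = φ (weightedHomogeneousComponent w m f) := by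
  classical
  induction f using MvPolynomial.induction_on' with
  | add f g hf hg => simp only [map_add, hf, hg]
  | monomial d c =>
    have hd : IsWeightedHomogeneous w (monomial d c) (Finsupp.weight w d) :=
      isWeightedHomogeneous_monomial _ _ _ rfl
    have := isWeightedHomogeneous_algHom (AddMonoidHom.id N) φ h hd
    rw [weightedHomogeneousComponent_of_mem (n := Finsupp.weight w d) this,
      weightedHomogeneousComponent_of_mem (n := Finsupp.weight w d) hd]
    split_ifs <;> simp

end WeightedSubstitution

section Polynomials

open MvPolynomial

variable (k : Type u) [Field k] (p : ℕ) [Algebra (ZMod p) k]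

/-- The substitution induced by a matrix. -/
noncomputable def polySubst (T : Type) {V W : Mt (ZMod p)} (f : V ⟶ W) :
    MvPolynomial (V.ι × T) k →ₐ[k] MvPolynomial (W.ι × T) k :=
  aeval fun v ↦ ∑ w, Mt.mat f v.1 w • X (w, v.2)

variable {k p}

@[simp] lemma polySubst_X {T : Type} {V W : Mt (ZMod p)} (f : V ⟶ W) (v : V.ι × T) :
    polySubst k p T f (X v) = ∑ w, Mt.mat f v.1 w • X (w, v.2) := aeval_X _ _

lemma map_zmod_smul {A B : Type*} [CommRing A] [CommRing B] [Algebra (ZMod p) A]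
    [Algebra (ZMod p) B] (φ : A →+* B) (c : ZMod p) (a : A) : φ (c • a) = c • φ a := by
  rw [Algebra.smul_def, Algebra.smul_def, map_mul]
  congr 1
  exact RingHom.congr_fun (Subsingleton.elim (φ.comp (algebraMap (ZMod p) A)) (algebraMap (ZMod p) B)) c

lemma polySubst_id {T : Type} (V : Mt (ZMod p)) (x : MvPolynomial (V.ι × T) k) :
    polySubst k p T (𝟙 V) x = x := by
  have : polySubst k p T (𝟙 V) = AlgHom.id k _ := algHom_ext fun v ↦ by
    simp [Matrix.one_apply]
  rw [this, AlgHom.id_apply]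

lemma polySubst_comp {T : Type} {U V W : Mt (ZMod p)} (f : U ⟶ V) (g : V ⟶ W)
    (x : MvPolynomial (U.ι × T) k) :
    polySubst k p T (f ≫ g) x = polySubst k p T g (polySubst k p T f x) := by
  have : polySubst k p T (f ≫ g) = (polySubst k p T g).comp (polySubst k p T f) := algHom_ext fun v ↦ by
    rw [AlgHom.comp_apply, polySubst_X, polySubst_X, map_sum]
    simp only [Mt.mat_comp, Matrix.mul_apply, Finset.sum_smul]
    rw [Finset.sum_comm]
    refine Finset.sum_congr rfl fun w _ ↦ ?_
    refine Eq.trans ?_ (map_zmod_smul (polySubst k p T g).toRingHom (Mt.mat f v.1 w) (X (w, v.2))).symm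
    change _ = Mt.mat f v.1 w • polySubst k p T g (X (w, v.2))
    rw [polySubst_X, Finset.smul_sum]
    exact Finset.sum_congr rfl fun w' _ ↦ mul_smul _ _ _
  rw [this, AlgHom.comp_apply]

lemma isWeightedHomogeneous_zmod_smul {N σ : Type*} [AddCommMonoid N] {wt : σ → N} {m : N}
    {f : MvPolynomial σ k} (hf : IsWeightedHomogeneous wt f m) (c : ZMod p) :
    IsWeightedHomogeneous wt (c • f) m := by
  rw [Algebra.smul_def, IsScalarTower.algebraMap_apply (ZMod p) k, ← C_eq_algebraMap]
  exact hf.C_mul _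

lemma isWeightedHomogeneous_polySubst_X {T : Type} {N : Type*} [AddCommMonoid N] (wt : T → N)
    {V W : Mt (ZMod p)} (f : V ⟶ W) (v : V.ι × T) :
    IsWeightedHomogeneous (fun v : W.ι × T ↦ wt v.2) (polySubst k p T f (X v)) (wt v.2) := by
  rw [polySubst_X]
  refine IsWeightedHomogeneous.sum _ _ _ fun w _ ↦ ?_
  exact isWeightedHomogeneous_zmod_smul (isWeightedHomogeneous_X _ (fun v : W.ι × T ↦ wt v.2) _) _

variable (k p)

/-- The functor sending `V` to polynomials in variables indexed by `V × T`. -/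
noncomputable def polyFun (T : Type) : Mt (ZMod p) ⥤ ModuleCat.{u} k :=
  funMk (fun V ↦ MvPolynomial (V.ι × T) k) (fun f ↦ (polySubst k p T f).toLinearMap)
    (fun V x ↦ polySubst_id V x) (fun f g x ↦ polySubst_comp f g x)

variable {T N : Type} [AddCommMonoid N] (wt : T → N) (m : N)

/-- The subfunctor of weighted homogeneous polynomials. -/
noncomputable def homSub : Subfun (polyFun k p T) where
  carrier V := weightedHomogeneousSubmodule k (fun v : V.ι × T ↦ wt v.2) m
  map_mem f x hx := isWeightedHomogeneous_algHom (AddMonoidHom.id N) (polySubst k p T f)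
    (isWeightedHomogeneous_polySubst_X wt f) hx

/-- The functor of weighted homogeneous polynomials. -/
noncomputable def homFun : Mt (ZMod p) ⥤ ModuleCat.{u} k := (homSub k p wt m).toFunctor

/-- The inclusion of weighted homogeneous polynomials into all polynomials. -/
noncomputable def homIncl : homFun k p wt m ⟶ polyFun k p T := (homSub k p wt m).ι

/-- Taking weighted homogeneous components. -/
noncomputable def homComp : polyFun k p T ⟶ homFun k p wt m :=
  homMk (fun V ↦ (weightedHomogeneousComponent (fun v : V.ι × T ↦ wt v.2) m).codRestrict _
      (weightedHomogeneousComponent_mem _ · _))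
    fun f x ↦ Subtype.ext (weightedHomogeneousComponent_algHom (polySubst k p T f)
      (isWeightedHomogeneous_polySubst_X wt f) x m)

variable {k p wt m}

/-- The polynomial underlying a weighted homogeneous polynomial. -/
noncomputable def hval {V : Mt (ZMod p)} (x : (homFun k p wt m).obj V) : MvPolynomial (V.ι × T) k :=
  Subtype.val (p := (· ∈ (homSub k p wt m).carrier V)) x

lemma hval_mem {V : Mt (ZMod p)} (x : (homFun k p wt m).obj V) :
    IsWeightedHomogeneous (fun v : V.ι × T ↦ wt v.2) (hval x) m :=
  Subtype.property (p := (· ∈ (homSub k p wt m).carrier V)) x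

lemma hval_injective {V : Mt (ZMod p)} {x y : (homFun k p wt m).obj V} (h : hval x = hval y) : x = y :=
  Subtype.ext h

/-- The element of `homFun` given by a weighted homogeneous polynomial. -/
noncomputable def hmk {V : Mt (ZMod p)} (f : MvPolynomial (V.ι × T) k)
    (h : IsWeightedHomogeneous (fun v : V.ι × T ↦ wt v.2) f m) : (homFun k p wt m).obj V :=
  (⟨f, h⟩ : (homSub k p wt m).carrier V)

@[simp] lemma hval_hmk {V : Mt (ZMod p)} (f : MvPolynomial (V.ι × T) k)
    (h : IsWeightedHomogeneous (fun v : V.ι × T ↦ wt v.2) f m) : hval (hmk f h) = f := rfl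

@[simp] lemma hval_add {V : Mt (ZMod p)} (x y : (homFun k p wt m).obj V) :
    hval (x + y) = hval x + hval y := rfl

@[simp] lemma hval_zero {V : Mt (ZMod p)} : hval (0 : (homFun k p wt m).obj V) = 0 := rfl

@[simp] lemma hval_smul {V : Mt (ZMod p)} (c : k) (x : (homFun k p wt m).obj V) :
    hval (c • x) = c • hval x := rfl

@[simp] lemma hval_map {V W : Mt (ZMod p)} (f : V ⟶ W) (x : (homFun k p wt m).obj V) :
    hval ((homFun k p wt m).map f x) = polySubst k p T f (hval x) := rfl

@[simp] lemma homIncl_app {V : Mt (ZMod p)} (x : (homFun k p wt m).obj V) :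
    (homIncl k p wt m).app V x = hval x := rfl

@[simp] lemma hval_homComp {V : Mt (ZMod p)} (x : MvPolynomial (V.ι × T) k) :
    hval ((homComp k p wt m).app V x) = weightedHomogeneousComponent (fun v : V.ι × T ↦ wt v.2) m x :=
  rfl

lemma homIncl_homComp : homIncl k p wt m ≫ homComp k p wt m = 𝟙 _ :=
  hom_ext_apply fun V x ↦ hval_injective (weightedHomogeneousComponent_eq_self (hval_mem x))

/-- A natural family of algebra homomorphisms. -/
noncomputable def algNat {T T' : Type} (φ : ∀ V : Mt (ZMod p),
      MvPolynomial (V.ι × T) k →ₐ[k] MvPolynomial (V.ι × T') k)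
    (h : ∀ {V W : Mt (ZMod p)} (f : V ⟶ W) (v : V.ι × T),
      φ W (polySubst k p T f (X v)) = polySubst k p T' f (φ V (X v))) :
    polyFun k p T ⟶ polyFun k p T' :=
  homMk (fun V ↦ (φ V).toLinearMap) fun {V W} f x ↦
    AlgHom.congr_fun (φ₁ := (φ W).comp (polySubst k p T f)) (φ₂ := (polySubst k p T' f).comp (φ V))
      (algHom_ext fun v ↦ h f v) x

lemma algNat_app {T T' : Type} (φ : ∀ V : Mt (ZMod p),
      MvPolynomial (V.ι × T) k →ₐ[k] MvPolynomial (V.ι × T') k) (h) (V : Mt (ZMod p))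
      (x : MvPolynomial (V.ι × T) k) : (algNat φ h).app V x = φ V x := rfl

/-- Natural transformations between functors of homogeneous polynomials, from natural
transformations between functors of polynomials. -/
noncomputable def homMap {T' N' : Type} [AddCommMonoid N'] {wt' : T' → N'} {m' : N'}
    (φ : polyFun k p T ⟶ polyFun k p T')
    (h : ∀ (V : Mt (ZMod p)) (x : MvPolynomial (V.ι × T) k),
      IsWeightedHomogeneous (fun v : V.ι × T ↦ wt v.2) x m →
        IsWeightedHomogeneous (R := k) (fun v : V.ι × T' ↦ wt' v.2) (φ.app V x) m') :
    homFun k p wt m ⟶ homFun k p wt' m' :=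
  (homSub k p wt' m').lift (homIncl k p wt m ≫ φ) fun V x ↦ h V (hval x) (hval_mem x)

@[simp] lemma hval_homMap {T' N' : Type} [AddCommMonoid N'] {wt' : T' → N'} {m' : N'}
    (φ : polyFun k p T ⟶ polyFun k p T') (h) {V : Mt (ZMod p)} (x : (homFun k p wt m).obj V) :
    hval ((homMap (wt := wt) (m := m) (wt' := wt') (m' := m') φ h).app V x) = φ.app V (hval x) := rfl

end Polynomials

section CrossEffects

open MvPolynomial
open CategoryTheory.Limits (biprod)

lemma algHom_eq_mul_of_isWeightedHomogeneous {k σ N P : Type*} [CommRing k] [AddCommMonoid N]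
    [CommRing P] [Algebra k P] {wt : σ → N} (φ ψ : MvPolynomial σ k →ₐ[k] P)
    (χ : Multiplicative N →* P)
    (h : ∀ i, φ (X i) = ψ (X i) * χ (Multiplicative.ofAdd (wt i))) {f : MvPolynomial σ k} {m : N}
    (hf : IsWeightedHomogeneous wt f m) : φ f = ψ f * χ (Multiplicative.ofAdd m) := by
  classical
  rw [f.as_sum, map_sum, map_sum, Finset.sum_mul]
  refine Finset.sum_congr rfl fun d hd ↦ ?_
  rw [← hf (mem_support_iff.1 hd), monomial_eq, map_mul, map_mul, algHom_C, algHom_C, mul_assoc]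
  congr 1
  rw [Finsupp.prod, map_prod, map_prod, Finsupp.weight_apply, Finsupp.sum, ofAdd_sum, map_prod,
    ← Finset.prod_mul_distrib]
  refine Finset.prod_congr rfl fun i _ ↦ ?_
  rw [map_pow, map_pow, h, mul_pow, ofAdd_nsmul, map_pow]

variable {k : Type u} [Field k] {p : ℕ} [Algebra (ZMod p) k] {T : Type}
  (a b : T → Polynomial k)

/-- The substitution of `a x + b y` on polynomials in two sets of variables. -/
noncomputable def splitHom (V : Mt (ZMod p)) :
    MvPolynomial ((V ⊞ V).ι × T) k →ₐ[k] Polynomial (MvPolynomial (V.ι × T) k) :=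
  aeval fun v ↦ Polynomial.C (polySubst k p T biprod.fst (X v)) * (a v.2).map C +
    Polynomial.C (polySubst k p T biprod.snd (X v)) * (b v.2).map C

lemma splitHom_X (V : Mt (ZMod p)) (v) : splitHom a b V (X v) =
    Polynomial.C (polySubst k p T biprod.fst (X v)) * (a v.2).map C +
    Polynomial.C (polySubst k p T biprod.snd (X v)) * (b v.2).map C := aeval_X _ _

lemma splitHom_polySubst_X {U V : Mt (ZMod p)} (c : U ⟶ V ⊞ V) (u : U.ι × T) :
    splitHom a b V (polySubst k p T c (X u)) =
      Polynomial.C (polySubst k p T (c ≫ biprod.fst) (X u)) * (a u.2).map C +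
      Polynomial.C (polySubst k p T (c ≫ biprod.snd) (X u)) * (b u.2).map C := by
  rw [polySubst_comp, polySubst_comp, polySubst_X, map_sum, map_sum, map_sum, map_sum, map_sum,
    Finset.sum_mul, Finset.sum_mul, ← Finset.sum_add_distrib]
  refine Finset.sum_congr rfl fun w _ ↦ ?_
  have h₁ : splitHom a b V (Mt.mat c u.1 w • X (w, u.2)) = Mt.mat c u.1 w • splitHom a b V (X (w, u.2)) :=
    map_zmod_smul (splitHom a b V).toRingHom _ _
  have h₂ (d : V ⊞ V ⟶ V) : Polynomial.C (polySubst k p T d (Mt.mat c u.1 w • X (w, u.2))) =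
      Mt.mat c u.1 w • Polynomial.C (polySubst k p T d (X (w, u.2))) :=
    (map_zmod_smul (Polynomial.C.comp (polySubst k p T d).toRingHom) _ _)
  rw [h₁, h₂, h₂, splitHom_X, smul_add, smul_mul_assoc, smul_mul_assoc]

/-- A coefficient of the substitution `splitHom`. -/
noncomputable def splitCoeff (n : ℕ) : dbl ⋙ polyFun k p T ⟶ polyFun k p T :=
  homMk (fun V ↦ ((Polynomial.lcoeff (MvPolynomial (V.ι × T) k) n).restrictScalars k).comp
      (splitHom a b V).toLinearMap)
    fun {V W} f x ↦ by
      have : (splitHom a b W).comp (polySubst k p T (biprod.map f f)) =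
          (Polynomial.mapAlgHom (polySubst k p T f)).comp (splitHom a b V) := algHom_ext fun v ↦ by
        rw [AlgHom.comp_apply, AlgHom.comp_apply, splitHom_polySubst_X, splitHom_X]
        simp only [map_add, map_mul, Polynomial.coe_mapAlgHom, Polynomial.map_C, Polynomial.map_map]
        rw [biprod.map_fst, biprod.map_snd, polySubst_comp, polySubst_comp]
        have : ((polySubst k p T f : MvPolynomial (V.ι × T) k →+* MvPolynomial (W.ι × T) k).comp C) =
            (C : k →+* MvPolynomial (W.ι × T) k) :=
          RingHom.ext fun c ↦ algHom_C (polySubst k p T f) c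
        rw [this]
        rfl
      have := congrArg (fun q ↦ Polynomial.coeff q n) (AlgHom.congr_fun this x)
      refine this.trans ?_
      exact Polynomial.coeff_map _ _

lemma splitCoeff_app (n : ℕ) (V : Mt (ZMod p)) (x : MvPolynomial ((V ⊞ V).ι × T) k) :
    (splitCoeff a b n).app V x = (splitHom a b V x).coeff n := rfl

variable {N : Type} [AddCommMonoid N] (wt : T → N) (m : N)

lemma along_splitCoeff (c : 𝟭 (Mt (ZMod p)) ⟶ dbl) (e : ∀ V : Mt (ZMod p), V ⟶ V ⊞ V)
    (he : ∀ V, e V = c.app V) (χ : Multiplicative N →* Polynomial k)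
    (hχ : ∀ (V : Mt (ZMod p)) (v : V.ι × T),
      Polynomial.C (polySubst k p T (e V ≫ biprod.fst) (X v)) * (a v.2).map C +
      Polynomial.C (polySubst k p T (e V ≫ biprod.snd) (X v)) * (b v.2).map C =
      Polynomial.C (X v) * (χ (Multiplicative.ofAdd (wt v.2))).map C) (n : ℕ) :
    along c (homFun k p wt m) ≫ Functor.whiskerLeft dbl (homIncl k p wt m) ≫ splitCoeff a b n ≫
      homComp k p wt m = (χ (Multiplicative.ofAdd m)).coeff n • 𝟙 _ := by
  refine hom_ext_apply fun V x ↦ hval_injective ?_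
  have h₁ : splitHom a b V (polySubst k p T (e V) (hval x)) = Polynomial.C (hval x) *
      (χ (Multiplicative.ofAdd m)).map C := by
    refine algHom_eq_mul_of_isWeightedHomogeneous ((splitHom a b V).comp (polySubst k p T (e V)))
      (IsScalarTower.toAlgHom k (MvPolynomial (V.ι × T) k) _)
      ((Polynomial.mapRingHom C).toMonoidHom.comp χ) (fun v ↦ ?_) (hval_mem x)
    rw [AlgHom.comp_apply, splitHom_polySubst_X]
    exact hχ V v
  rw [he] at h₁
  refine (congrArg (fun q ↦ weightedHomogeneousComponent _ m (Polynomial.coeff q n)) h₁).trans ?_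
  change weightedHomogeneousComponent (fun v : V.ι × T ↦ wt v.2) m _ = _
  rw [Polynomial.coeff_C_mul, Polynomial.coeff_map, mul_comm, ← smul_eq_C_mul, map_smul,
    weightedHomogeneousComponent_eq_self (hval_mem x)]
  rfl

variable [HasExt.{w} (Mt (ZMod p) ⥤ ModuleCat.{u} k)]
  (Y : Mt (ZMod p) ⥤ ModuleCat.{u} k) [Y.Additive]

/-- Criterion for the vanishing of extensions between an additive functor and a functor of
homogeneous polynomials. -/
lemma subsingleton_ext_homFun (χ χl χr : Multiplicative N →* Polynomial k)
    (hχ : ∀ i, χ (Multiplicative.ofAdd (wt i)) = a i + b i)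
    (hl : ∀ i, χl (Multiplicative.ofAdd (wt i)) = a i)
    (hr : ∀ i, χr (Multiplicative.ofAdd (wt i)) = b i) (n : ℕ)
    (h : (χ (Multiplicative.ofAdd m)).coeff n ≠ 0)
    (h₁ : (χl (Multiplicative.ofAdd m)).coeff n = 0)
    (h₂ : (χr (Multiplicative.ofAdd m)).coeff n = 0) (t : ℕ) :
    Subsingleton (Ext Y (homFun k p wt m) t) := by
  have key (V : Mt (ZMod p)) (v : V.ι × T) : polySubst k p T (0 : V ⟶ V) (X v) = 0 := by
    rw [polySubst_X]
    exact Finset.sum_eq_zero fun w _ ↦ zero_smul _ _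
  obtain ⟨e, he⟩ : ∃ e : ∀ V : Mt (ZMod p), V ⟶ V ⊞ V, ∀ V, e V = biprod.inl + biprod.inr :=
    ⟨_, fun V ↦ rfl⟩
  have H := along_splitCoeff (k := k) (p := p) a b wt m
  refine subsingleton_of_retraction Y _ _ h
    (H dblDiag e he χ (fun V v ↦ ?_) n) t
    (fun x ↦ ?_) fun x ↦ ?_
  · simp only [he, Preadditive.add_comp, biprod.inl_fst, biprod.inr_fst, biprod.inl_snd,
      biprod.inr_snd, add_zero, zero_add, polySubst_id]
    rw [hχ, Polynomial.map_add, mul_add]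
  · rw [H dblInl (fun V ↦ biprod.inl) (fun V ↦ rfl) χl (fun V v ↦ ?_) n, h₁, zero_smul, push_zero]
    rw [biprod.inl_fst, biprod.inl_snd, key, polySubst_id, map_zero, zero_mul, add_zero, hl]
  · rw [H dblInr (fun V ↦ biprod.inr) (fun V ↦ rfl) χr (fun V v ↦ ?_) n, h₂, zero_smul, push_zero]
    rw [biprod.inr_fst, biprod.inr_snd, key, polySubst_id, map_zero, zero_mul, zero_add, hr]

end CrossEffects

section Actions

universe u'

variable {C : Type u'} [Category.{0} C] [Preadditive C] {k : Type u} [Field k] {W : C}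

/-- An action of the groups `V ⟶ W` on a functor. -/
structure Act (W : C) (M : C ⥤ ModuleCat.{u} k) where
  /-- The action. -/
  ρ : ∀ {V : C}, (V ⟶ W) → M.obj V →ₗ[k] M.obj V
  ρ_zero : ∀ {V : C} (m : M.obj V), ρ 0 m = m
  ρ_add : ∀ {V : C} (a b : V ⟶ W) (m : M.obj V), ρ (a + b) m = ρ a (ρ b m)
  map_ρ : ∀ {V V' : C} (f : V ⟶ V') (a : V' ⟶ W) (m : M.obj V),
    M.map f (ρ (f ≫ a) m) = ρ a (M.map f m)

/-- An action is weakly induced if the identity is a trace. -/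
def Act.WeaklyInduced [∀ V : C, Fintype (V ⟶ W)] {M : C ⥤ ModuleCat.{u} k} (A : Act W M) : Prop :=
  ∀ V : C, ∃ τ : M.obj V →ₗ[k] M.obj V, ∀ m, ∑ a : V ⟶ W, A.ρ a (τ (A.ρ (-a) m)) = m

namespace Act

variable {M : C ⥤ ModuleCat.{u} k} (A : Act W M)

lemma ρ_neg_ρ {V : C} (a : V ⟶ W) (m : M.obj V) : A.ρ (-a) (A.ρ a m) = m := by
  rw [← A.ρ_add, neg_add_cancel, A.ρ_zero]

/-- The functor of `1`-cocycles. -/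
def cocycles : Subfun (Rbar W M) where
  carrier V :=
    { carrier := {g | ∀ a b, rval W g (a + b) = A.ρ a (rval W g b) + rval W g a}
      zero_mem' := fun a b ↦ by
        change (0 : M.obj V) = A.ρ a 0 + 0
        rw [map_zero, add_zero]
      add_mem' := fun {g h} hg hh a b ↦ by
        rw [rval_add, rval_add, rval_add, hg, hh, map_add]
        abel
      smul_mem' := fun c g hg a b ↦ by
        rw [rval_smul, rval_smul, rval_smul, hg, map_smul, smul_add] }
  map_mem {V V'} f g hg a b := by
    rw [rval_map, rval_map, rval_map, Preadditive.comp_add, hg, map_add, A.map_ρ]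

/-- The coboundary. -/
def coboundary : M ⟶ A.cocycles.toFunctor :=
  A.cocycles.lift (homMk (fun V ↦
      { toFun := fun m ↦ rmk (fun a ↦ A.ρ a m - m) (by rw [A.ρ_zero, sub_self])
        map_add' := fun x y ↦ rbar_ext fun a ↦ by
          simp only [rval_rmk, rval_add, map_add]
          abel
        map_smul' := fun c x ↦ rbar_ext fun a ↦ by
          simp only [rval_rmk, rval_smul, map_smul, RingHom.id_apply, smul_sub] })
      fun {V V'} f x ↦ rbar_ext fun a ↦ by
        change A.ρ a (M.map f x) - M.map f x = M.map f (A.ρ (f ≫ a) x - x)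
        rw [map_sub, A.map_ρ])
    fun V x a b ↦ by
      change A.ρ (a + b) x - x = A.ρ a (A.ρ b x - x) + (A.ρ a x - x)
      rw [map_sub, A.ρ_add]
      abel

lemma rval_coboundary {V : C} (m : M.obj V) (a : V ⟶ W) :
    rval W (A.cocycles.ι.app V (A.coboundary.app V m)) a = A.ρ a m - m := rfl

lemma coboundary_eq_zero_iff {V : C} (m : M.obj V) :
    A.coboundary.app V m = 0 ↔ ∀ a, A.ρ a m = m := by
  refine ⟨fun h a ↦ ?_, fun h ↦ A.cocycles.ι_injective V (rbar_ext fun a ↦ ?_)⟩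
  · have := A.rval_coboundary m a
    rw [h, map_zero] at this
    exact (sub_eq_zero.1 this.symm)
  · rw [rval_coboundary, h, sub_self, map_zero]
    rfl

lemma coboundary_surjective [∀ V : C, Fintype (V ⟶ W)] (hA : A.WeaklyInduced) (V : C) :
    Function.Surjective (A.coboundary.app V) := by
  intro z
  obtain ⟨τ, hτ⟩ := hA V
  obtain ⟨g, hg⟩ : ∃ g, g = A.cocycles.ι.app V z := ⟨_, rfl⟩
  have hz : ∀ a b, rval W g (a + b) = A.ρ a (rval W g b) + rval W g a := hg ▸ A.cocycles.ι_mem V z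
  refine ⟨-∑ a : V ⟶ W, A.ρ a (τ (A.ρ (-a) (rval W g a))), A.cocycles.ι_injective V ?_⟩
  refine rbar_ext fun b ↦ ?_
  rw [← hg, rval_coboundary, map_neg, map_sum, ← Equiv.sum_comp (Equiv.addLeft (-b))]
  have (a : V ⟶ W) : A.ρ b (A.ρ (-b + a) (τ (A.ρ (-(-b + a)) (rval W g (-b + a))))) =
      A.ρ a (τ (A.ρ (-a) (rval W g a))) - A.ρ a (τ (A.ρ (-a) (rval W g b))) := by
    have h := hz b (-b + a)
    rw [add_neg_cancel_left] at h
    rw [← A.ρ_add, add_neg_cancel_left, neg_add_rev, neg_neg, A.ρ_add, eq_sub_of_add_eq h.symm,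
      map_sub, map_sub, map_sub]
  simp only [Equiv.coe_addLeft, this, Finset.sum_sub_distrib, hτ]
  abel

/-- The action on `Rbar W M`, whose invariants are the cocycles. -/
def rbarAct : Act W (Rbar W M) where
  ρ {V} c :=
    { toFun := fun g ↦ rmk (fun a ↦ rval W g (a + c) - A.ρ a (rval W g c)) (by
        rw [zero_add, A.ρ_zero, sub_self])
      map_add' := fun x y ↦ rbar_ext fun a ↦ by
        simp only [rval_rmk, rval_add, map_add]
        abel
      map_smul' := fun c x ↦ rbar_ext fun a ↦ by
        simp only [rval_rmk, rval_smul, map_smul, RingHom.id_apply, smul_sub] }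
  ρ_zero g := rbar_ext fun a ↦ by
    change rval W g (a + 0) - A.ρ a (rval W g 0) = rval W g a
    rw [rval_zero, map_zero, sub_zero, add_zero]
  ρ_add b c g := rbar_ext fun a ↦ by
    change rval W g (a + (b + c)) - A.ρ a (rval W g (b + c)) =
      rval W g (a + b + c) - A.ρ (a + b) (rval W g c) -
        A.ρ a (rval W g (b + c) - A.ρ b (rval W g c))
    rw [map_sub, A.ρ_add, add_assoc]
    abel
  map_ρ f b g := rbar_ext fun a ↦ by
    change M.map f (rval W g (f ≫ a + f ≫ b) - A.ρ (f ≫ a) (rval W g (f ≫ b))) =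
      M.map f (rval W g (f ≫ (a + b))) - A.ρ a (M.map f (rval W g (f ≫ b)))
    rw [map_sub, A.map_ρ, Preadditive.comp_add]

lemma rval_rbarAct {V : C} (c : V ⟶ W) (g : (Rbar W M).obj V) (a : V ⟶ W) :
    rval W (A.rbarAct.ρ c g) a = rval W g (a + c) - A.ρ a (rval W g c) := rfl

lemma rbarAct_invariant_iff {V : C} (g : (Rbar W M).obj V) :
    (∀ c, A.rbarAct.ρ c g = g) ↔ g ∈ A.cocycles.carrier V := by
  refine ⟨fun h a b ↦ ?_, fun h c ↦ rbar_ext fun a ↦ ?_⟩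
  · have := A.rval_rbarAct b g a
    rw [h] at this
    rw [this, add_sub_cancel]
  · rw [rval_rbarAct, h a c, add_sub_cancel_left]

lemma rval_sum {ι : Type*} {V : C} (s : Finset ι) (g : ι → (Rbar W M).obj V) (a : V ⟶ W) :
    rval W (∑ i ∈ s, g i) a = ∑ i ∈ s, rval W (g i) a :=
  map_sum ({ toFun := fun g ↦ rval W g a, map_zero' := rfl, map_add' := fun _ _ ↦ rfl } :
    (Rbar W M).obj V →+ M.obj V) g s

variable [∀ V : C, Fintype (V ⟶ W)] {A}

lemma WeaklyInduced.rbarAct (hA : A.WeaklyInduced) : A.rbarAct.WeaklyInduced := by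
  intro V
  obtain ⟨τ, hτ⟩ := hA V
  let τ' : (Rbar W M).obj V →ₗ[k] (Rbar W M).obj V :=
    { toFun := fun g ↦ rmk (fun a ↦ A.ρ a (τ (A.ρ (-a) (rval W g a)))) (by simp)
      map_add' := fun x y ↦ rbar_ext fun a ↦ by simp
      map_smul' := fun c x ↦ rbar_ext fun a ↦ by simp }
  have hτ' (g : (Rbar W M).obj V) (a : V ⟶ W) :
    rval W (τ' g) a = A.ρ a (τ (A.ρ (-a) (rval W g a))) := rfl
  refine ⟨τ', fun g ↦ rbar_ext fun x ↦ ?_⟩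
  rw [rval_sum, ← hτ (rval W g x)]
  refine Eq.trans ?_ (Equiv.sum_comp (Equiv.addLeft x)
    (fun a ↦ A.ρ a (τ (A.ρ (-a) (rval W g x)))))
  refine Finset.sum_congr rfl fun a _ ↦ ?_
  rw [rval_rbarAct, hτ', hτ', rval_rbarAct, rval_rbarAct, add_neg_cancel_right, add_neg_cancel,
    rval_zero, zero_sub, map_sub, map_neg, ρ_neg_ρ, ρ_neg_ρ, map_sub, map_sub, map_neg, map_neg,
    map_neg, ← A.ρ_add, Equiv.coe_addLeft]
  abel

variable [Limits.HasBinaryBiproducts C]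
  [EnoughInjectives (C ⥤ ModuleCat.{u} k)] [HasExt.{w} (C ⥤ ModuleCat.{u} k)]
  (X : C ⥤ ModuleCat.{u} k) [X.Additive]

omit [Limits.HasBinaryBiproducts C] [EnoughInjectives (C ⥤ ModuleCat.{u} k)]
  [HasExt.{w} (C ⥤ ModuleCat.{u} k)] in
lemma WeaklyInduced.shortExact_cocycles (hA : A.WeaklyInduced) :
    (ShortComplex.mk A.cocycles.ι A.rbarAct.coboundary (hom_ext_apply fun V x ↦
      (A.rbarAct.coboundary_eq_zero_iff _).2
        ((A.rbarAct_invariant_iff _).2 (A.cocycles.ι_mem V x)))).ShortExact :=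
  shortExact_mk _ _ A.cocycles.ι_injective (A.rbarAct.coboundary_surjective hA.rbarAct)
    (fun V x ↦ (A.rbarAct.coboundary_eq_zero_iff _).2
        ((A.rbarAct_invariant_iff _).2 (A.cocycles.ι_mem V x)))
    fun V x hx ↦ ⟨⟨x, (A.rbarAct_invariant_iff _).1 ((A.rbarAct.coboundary_eq_zero_iff _).1 hx)⟩, rfl⟩

lemma WeaklyInduced.subsingleton_ext_cocycles_of_reduced (hA : A.WeaklyInduced) (hM : Reduced M)
    (t : ℕ) : Subsingleton (Ext X A.cocycles.toFunctor t) := by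
  induction t generalizing M with
  | zero =>
    have := subsingleton_ext_rbar_of_reduced X W hM 0
    exact subsingleton_ext₁_zero (X := X) hA.shortExact_cocycles
  | succ t ih =>
    have := subsingleton_ext_rbar_of_reduced X W hM (t + 1)
    have := ih hA.rbarAct reduced_Rbar
    exact subsingleton_ext₁_succ (X := X) hA.shortExact_cocycles t

lemma WeaklyInduced.subsingleton_ext_cocycles (hA : A.WeaklyInduced) (t : ℕ) :
    Subsingleton (Ext X A.cocycles.toFunctor (t + 1)) := by
  have := subsingleton_ext_rbar X W M t
  have := hA.rbarAct.subsingleton_ext_cocycles_of_reduced X reduced_Rbar t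
  exact subsingleton_ext₁_succ (X := X) hA.shortExact_cocycles t

/-- If `φ` is an isomorphism onto the invariants of a weakly induced action, it induces surjections
on extension groups of positive degree. -/
lemma WeaklyInduced.push_surjective (hA : A.WeaklyInduced) {F : C ⥤ ModuleCat.{u} k} (φ : F ⟶ M)
    (hφ : ∀ V, Function.Injective (φ.app V))
    (h : ∀ V (m : M.obj V), (∀ a, A.ρ a m = m) ↔ ∃ x, φ.app V x = m) (t : ℕ) :
    Function.Surjective (push k X φ (t + 1)) := by
  have := hA.subsingleton_ext_cocycles X t
  exact push_f_surjective k (shortExact_mk φ A.coboundary hφ (A.coboundary_surjective hA)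
    (fun V x ↦ (A.coboundary_eq_zero_iff _).2 ((h V _).2 ⟨x, rfl⟩))
    fun V x hx ↦ (h V x).1 ((A.coboundary_eq_zero_iff x).1 hx)) (t + 1)

end Act

end Actions

section LinearFunctors

universe r

variable {R : Type r} [CommRing R] {k : Type u} [Field k] {M : Type u} [AddCommGroup M] [Module k M]
  (act : R →+* Module.End k M)

/-- The additive functor with value `M` on the object of rank one. -/
def linFun : Mt R ⥤ ModuleCat.{u} k :=
  funMk (fun V ↦ V.ι → M)
    (fun f ↦ LinearMap.pi fun w ↦ ∑ v, act (Mt.mat f v w) ∘ₗ LinearMap.proj v)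
    (fun V x ↦ funext fun w ↦ by
      simp only [LinearMap.pi_apply, LinearMap.sum_apply, Mt.mat_id, Matrix.one_apply,
        LinearMap.comp_apply, LinearMap.proj_apply]
      rw [Finset.sum_eq_single w (fun v _ h ↦ by rw [if_neg h, map_zero]; rfl) (by simp), if_pos rfl,
        map_one, Module.End.one_apply])
    (fun f g x ↦ funext fun w ↦ by
      simp only [LinearMap.pi_apply, LinearMap.sum_apply, Mt.mat_comp, Matrix.mul_apply, map_sum,
        LinearMap.comp_apply, LinearMap.proj_apply]
      rw [Finset.sum_comm]
      refine Finset.sum_congr rfl fun v _ ↦ Finset.sum_congr rfl fun u _ ↦ ?_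
      rw [mul_comm, map_mul, Module.End.mul_apply])

lemma linFun_map_apply {V W : Mt R} (f : V ⟶ W) (x : (linFun act).obj V) (w : W.ι) :
    (linFun act).map f x w = ∑ v, act (Mt.mat f v w) (x v) := by
  change (∑ v, act (Mt.mat f v w) ∘ₗ LinearMap.proj (R := k) (φ := fun _ : V.ι ↦ M) v) x = _
  exact LinearMap.sum_apply _ _ _

instance : (linFun act).Additive where
  map_add {V W f g} := by
    ext x
    refine funext fun w ↦ (linFun_map_apply act _ _ _).trans ?_
    refine Eq.trans ?_ (congrArg₂ (· + ·) (linFun_map_apply act f x w) (linFun_map_apply act g x w)).symm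
    simp only [Mt.mat_add, Matrix.add_apply, map_add, LinearMap.add_apply, Finset.sum_add_distrib]

/-- The object of rank one. -/
abbrev Mt.pt (R : Type r) : Mt R := ⟨Unit⟩

/-- A vector, as a morphism from the object of rank one. -/
def Mt.ofVec {V : Mt R} (a : V.ι → R) : Mt.pt R ⟶ V := Mt.ofMat fun _ v ↦ a v

lemma Mt.id_mem_closure (V : Mt R) : 𝟙 V ∈ AddSubgroup.closure
    {f : V ⟶ V | ∃ (a : V ⟶ Mt.pt R) (b : Mt.pt R ⟶ V), f = a ≫ b} := by
  have : 𝟙 V = ∑ v, (Mt.ofMat fun w _ ↦ (1 : Matrix V.ι V.ι R) w v) ≫ Mt.ofVec ((1 : Matrix V.ι V.ι R) v) := by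
    have H (s : Finset V.ι) (f : V.ι → (V ⟶ V)) : Mt.mat (∑ v ∈ s, f v) = ∑ v ∈ s, Mt.mat (f v) :=
      map_sum ({ toFun := Mt.mat, map_zero' := rfl, map_add' := fun _ _ ↦ rfl } :
        (V ⟶ V) →+ Matrix V.ι V.ι R) f s
    refine Mt.hom_ext ?_
    rw [H]
    ext i j
    rw [Matrix.sum_apply]
    have (c : V.ι) : (Mt.mat ((Mt.ofMat fun w _ ↦ (1 : Matrix V.ι V.ι R) w c) ≫
        Mt.ofVec ((1 : Matrix V.ι V.ι R) c)) : Matrix V.ι V.ι R) i j =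
        (1 : Matrix V.ι V.ι R) i c * (1 : Matrix V.ι V.ι R) c j := by
      rw [Mt.mat_comp, Matrix.mul_apply]
      exact Fintype.sum_unique (ι := Unit) _
    simp only [this]
    rw [← Matrix.mul_apply, Matrix.one_mul, Mt.mat_id]
  rw [this]
  exact sum_mem fun v _ ↦ AddSubgroup.subset_closure ⟨_, _, rfl⟩

noncomputable instance {R : Type r} [CommRing R] [Fintype R] (V W : Mt R) : Fintype (V ⟶ W) :=
  Fintype.ofEquiv _ (Mt.homEquiv V W).symm

/-- The element of `linFun` on the object of rank one given by an element of `M`. -/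
def linPt (m : M) : (linFun act).obj (Mt.pt R) := fun _ : Unit ↦ m

lemma linFun_map_ofVec {V : Mt R} (a : V.ι → R) (m : M) (w : V.ι) :
    (linFun act).map (Mt.ofVec a) (linPt act m) w = act (a w) m :=
  (linFun_map_apply act _ _ w).trans (Fintype.sum_unique (ι := Unit) _)

/-- Elements of `linFun` are sums of images of elements of `M`. -/
lemma linFun_eq_sum {V : Mt R} (x : (linFun act).obj V) :
    x = ∑ v : V.ι, (linFun act).map (Mt.ofVec (V := V) (Pi.single v 1)) (linPt act (x v)) := by
  refine funext fun w ↦ ?_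
  refine Eq.trans ?_ (Finset.sum_apply (M := fun _ : V.ι ↦ M) w _ _).symm
  refine Eq.trans ?_ (Finset.sum_congr rfl fun v _ ↦ (linFun_map_ofVec act _ _ w).symm)
  rw [Finset.sum_eq_single w (fun v _ h ↦ by rw [Pi.single_eq_of_ne h.symm, map_zero]; rfl) (by simp),
    Pi.single_eq_same, map_one]
  rfl

end LinearFunctors

section TracePolynomials

open MvPolynomial

variable {p : ℕ} [hp : Fact p.Prime] {R : Type*} [CommRing R] [Algebra (ZMod p) R]

lemma sum_zmod_pow_of_lt {j : ℕ} (hj : j < p - 1) : ∑ c : ZMod p, c ^ j = 0 :=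
  FiniteField.sum_pow_lt_card_sub_one _ _ (by rwa [ZMod.card])

lemma sum_zmod_pow_sub_one : ∑ c : ZMod p, c ^ (p - 1) = -1 := by
  have h (c : ZMod p) : c ^ (p - 1) = 1 - if c = 0 then 1 else 0 := by
    split_ifs with hc
    · rw [hc, zero_pow (Nat.sub_ne_zero_of_lt hp.out.one_lt), sub_self]
    · rw [ZMod.pow_card_sub_one_eq_one hc, sub_zero]
  simp only [h, Finset.sum_sub_distrib]
  simp

lemma sum_add_pow (x : R) (j : ℕ) : ∑ c : ZMod p, (x + algebraMap _ R c) ^ j =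
    ∑ i ∈ Finset.range (j + 1), x ^ i * (j.choose i) * algebraMap _ R (∑ c : ZMod p, c ^ (j - i)) := by
  simp only [add_pow]
  rw [Finset.sum_comm]
  refine Finset.sum_congr rfl fun i _ ↦ ?_
  rw [map_sum, Finset.mul_sum]
  refine Finset.sum_congr rfl fun c _ ↦ ?_
  rw [map_pow]
  ring

lemma sum_add_pow_of_lt (x : R) {j : ℕ} (hj : j < p - 1) :
    ∑ c : ZMod p, (x + algebraMap _ R c) ^ j = 0 := by
  rw [sum_add_pow]
  refine Finset.sum_eq_zero fun i _ ↦ ?_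
  rw [sum_zmod_pow_of_lt (by omega), map_zero, mul_zero]

lemma sum_add_pow_sub_one (x : R) : ∑ c : ZMod p, (x + algebraMap _ R c) ^ (p - 1) = -1 := by
  have := hp.out.one_lt
  rw [sum_add_pow, Finset.sum_eq_single 0]
  · simp [sum_zmod_pow_sub_one]
  · intro i _ hi
    rw [sum_zmod_pow_of_lt (by omega), map_zero, mul_zero]
  · simp

/-- Power sums of the translates of `x` are polynomials in `x ^ p - x`. -/
lemma sum_add_pow_mem (S : Subring R) (x : R) (hx : x ^ p - x ∈ S) (j : ℕ) :
    ∑ c : ZMod p, (x + algebraMap _ R c) ^ j ∈ S := by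
  have hp1 := hp.out.one_lt
  have : CharP R p ∨ Subsingleton R := by
    rcases subsingleton_or_nontrivial R with h | h
    · exact Or.inr h
    · exact Or.inl (charP_of_injective_algebraMap (algebraMap (ZMod p) R).injective p)
  rcases this with hR | hR
  swap
  · rw [Subsingleton.elim (∑ c : ZMod p, (x + algebraMap _ R c) ^ j) 0]
    exact S.zero_mem
  induction j using Nat.strong_induction_on with
  | _ j ih =>
    rcases lt_or_ge j p with h | h
    · rcases Nat.lt_or_eq_of_le (Nat.le_sub_one_of_lt h) with h | rfl
      · rw [sum_add_pow_of_lt x h]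
        exact S.zero_mem
      · rw [sum_add_pow_sub_one]
        exact S.neg_mem S.one_mem
    · obtain ⟨i, rfl⟩ := Nat.exists_eq_add_of_le' h
      have : ∑ c : ZMod p, (x + algebraMap _ R c) ^ (i + p) =
          (x ^ p - x) * ∑ c : ZMod p, (x + algebraMap _ R c) ^ i +
            ∑ c : ZMod p, (x + algebraMap _ R c) ^ (i + 1) := by
        rw [Finset.mul_sum, ← Finset.sum_add_distrib]
        refine Finset.sum_congr rfl fun c _ ↦ ?_
        rw [pow_add, add_pow_char _ _ p, ← map_pow, ZMod.pow_card]
        ring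
      rw [this]
      exact S.add_mem (S.mul_mem hx (ih i (by omega))) (ih (i + 1) (by omega))

end TracePolynomials

section ArtinSchreier

open MvPolynomial

variable {k : Type u} [Field k] {p : ℕ} [hp : Fact p.Prime] [Algebra (ZMod p) k]

/-- Translation of the variables. -/
noncomputable def translate {V : Mt (ZMod p)} (a : V ⟶ Mt.pt (ZMod p)) :
    MvPolynomial (V.ι × Unit) k →ₐ[k] MvPolynomial (V.ι × Unit) k :=
  aeval fun v ↦ X v + algebraMap _ _ (Mt.mat a v.1 v.2)

lemma translate_X {V : Mt (ZMod p)} (a : V ⟶ Mt.pt (ZMod p)) (v : V.ι × Unit) :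
    translate (k := k) a (X v) = X v + algebraMap _ _ (Mt.mat a v.1 v.2) := aeval_X _ _

lemma algHom_algebraMap_zmod {A B : Type*} [CommRing A] [CommRing B] [Algebra (ZMod p) A]
    [Algebra (ZMod p) B] (φ : A →+* B) (c : ZMod p) : φ (algebraMap _ _ c) = algebraMap _ _ c := by
  rw [Algebra.algebraMap_eq_smul_one, map_zmod_smul, map_one, Algebra.algebraMap_eq_smul_one]

lemma translate_algebraMap {V : Mt (ZMod p)} (a : V ⟶ Mt.pt (ZMod p)) (c : ZMod p) :
    translate (k := k) a (algebraMap _ _ c) = algebraMap _ _ c :=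
  algHom_algebraMap_zmod (translate (k := k) a).toRingHom c

variable (k p) in
/-- The action by translations. -/
noncomputable def translateAct : Act (Mt.pt (ZMod p)) (polyFun k p Unit) where
  ρ a := (translate a).toLinearMap
  ρ_zero {V} m := by
    have : translate (k := k) (0 : V ⟶ Mt.pt (ZMod p)) = AlgHom.id k _ := algHom_ext fun v ↦ by
      rw [translate_X, Mt.mat_zero, Matrix.zero_apply, map_zero, add_zero, AlgHom.id_apply]
    exact AlgHom.congr_fun this m
  ρ_add {V} a b m := by
    have : translate (k := k) (a + b) = (translate a).comp (translate b) := algHom_ext fun v ↦ by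
      rw [AlgHom.comp_apply, translate_X, translate_X, map_add, translate_X, translate_algebraMap,
        Mt.mat_add, Matrix.add_apply, map_add, add_assoc]
    exact AlgHom.congr_fun this m
  map_ρ {V V'} f a m := by
    have : (polySubst k p Unit f).comp (translate (f ≫ a)) =
        (translate a).comp (polySubst k p Unit f) := algHom_ext fun v ↦ by
      have h₁ : polySubst k p Unit f (algebraMap _ _ (Mt.mat (f ≫ a) v.1 v.2)) = algebraMap _ _ _ :=
        algHom_algebraMap_zmod (polySubst k p Unit f).toRingHom _
      rw [AlgHom.comp_apply, AlgHom.comp_apply, translate_X, map_add, h₁, polySubst_X, map_sum,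
        Mt.mat_comp, Matrix.mul_apply, map_sum, ← Finset.sum_add_distrib]
      refine Finset.sum_congr rfl fun w _ ↦ ?_
      have : translate a (Mt.mat f v.1 w • X (w, v.2)) = Mt.mat f v.1 w • translate (k := k) a (X (w, v.2)) :=
        map_zmod_smul (translate a).toRingHom _ _
      rw [this, translate_X, smul_add, map_mul, ← Algebra.smul_def]
    exact AlgHom.congr_fun this m

/-- Morphisms to the object of rank one are vectors. -/
def homPtEquiv (V : Mt (ZMod p)) : (V ⟶ Mt.pt (ZMod p)) ≃ (V.ι × Unit → ZMod p) :=
  (Mt.homEquiv _ _).trans (Equiv.curry _ _ _).symm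

lemma sum_prod_translate {V : Mt (ZMod p)} (f : V.ι × Unit → MvPolynomial (V.ι × Unit) k → MvPolynomial (V.ι × Unit) k) :
    ∑ a : V ⟶ Mt.pt (ZMod p), ∏ v, f v (translate a (X v)) =
      ∏ v, ∑ c : ZMod p, f v (X v + algebraMap _ _ c) := by
  rw [Finset.prod_univ_sum, Fintype.piFinset_univ, ← Equiv.sum_comp (homPtEquiv V)]
  refine Finset.sum_congr rfl fun a _ ↦ Finset.prod_congr rfl fun v _ ↦ ?_
  rw [translate_X]
  rfl

/-- An element of trace one. -/
noncomputable def traceOne (V : Mt (ZMod p)) : MvPolynomial (V.ι × Unit) k := ∏ v, -(X v) ^ (p - 1)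

lemma sum_translate_traceOne (V : Mt (ZMod p)) :
    ∑ a : V ⟶ Mt.pt (ZMod p), translate (k := k) a (traceOne V) = 1 := by
  simp only [traceOne, map_prod, map_neg, map_pow]
  rw [sum_prod_translate (fun _ x ↦ -x ^ (p - 1))]
  refine Finset.prod_eq_one fun v _ ↦ ?_
  rw [Finset.sum_neg_distrib, sum_add_pow_sub_one, neg_neg]

lemma sum_translate_traceOne_mul {V : Mt (ZMod p)} (m : MvPolynomial (V.ι × Unit) k) :
    ∑ a : V ⟶ Mt.pt (ZMod p), translate a (traceOne V * translate (-a) m) = m := by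
  have (a : V ⟶ Mt.pt (ZMod p)) : translate a (translate (-a) m) = m := by
    have := (translateAct k p).ρ_add a (-a) m
    rw [add_neg_cancel] at this
    exact this.symm.trans ((translateAct k p).ρ_zero (V := V) m)
  simp only [map_mul, this]
  rw [← Finset.sum_mul, sum_translate_traceOne, one_mul]

lemma translateAct_weaklyInduced : (translateAct k p).WeaklyInduced := fun V ↦ by
  obtain ⟨τ, hτ⟩ : ∃ τ : MvPolynomial (V.ι × Unit) k →ₗ[k] MvPolynomial (V.ι × Unit) k,
    ∀ m, τ m = traceOne V * m := ⟨LinearMap.mulLeft k (traceOne V), fun _ ↦ rfl⟩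
  refine ⟨τ, fun m ↦ ?_⟩
  refine Eq.trans (Finset.sum_congr rfl fun a _ ↦ ?_) (sum_translate_traceOne_mul m)
  exact congrArg (translate a) (hτ _)

/-- The substitution `x ↦ x ^ p - x`. -/
noncomputable def artinSchreier (V : Mt (ZMod p)) :
    MvPolynomial (V.ι × Unit) k →ₐ[k] MvPolynomial (V.ι × Unit) k :=
  aeval fun v ↦ X v ^ p - X v

lemma artinSchreier_X (V : Mt (ZMod p)) (v : V.ι × Unit) :
    artinSchreier (k := k) V (X v) = X v ^ p - X v := aeval_X _ _

lemma sum_translate_mem_range {V : Mt (ZMod p)} (m : MvPolynomial (V.ι × Unit) k) :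
    ∑ a : V ⟶ Mt.pt (ZMod p), translate a m ∈ (artinSchreier V).range := by
  induction m using MvPolynomial.induction_on' with
  | add f g hf hg =>
    simp only [map_add, Finset.sum_add_distrib]
    exact add_mem hf hg
  | monomial d c =>
    have (a : V ⟶ Mt.pt (ZMod p)) : translate (k := k) a (monomial d c) =
        algebraMap _ _ c * ∏ v, translate a (X v) ^ d v := by
      rw [monomial_eq, map_mul, algHom_C, Finsupp.prod_fintype _ _ (by simp), map_prod]
      simp only [map_pow]
    simp only [this]
    rw [← Finset.mul_sum, sum_prod_translate (fun v x ↦ x ^ d v)]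
    refine mul_mem (algebraMap_mem _ c) (prod_mem fun v _ ↦ ?_)
    exact sum_add_pow_mem (artinSchreier (k := k) V).range.toSubring (X v) ⟨X v, artinSchreier_X V v⟩ _

lemma translate_invariant_iff {V : Mt (ZMod p)} (m : MvPolynomial (V.ι × Unit) k) :
    (∀ a, translate a m = m) ↔ ∃ x, artinSchreier V x = m := by
  constructor
  · intro h
    have := sum_translate_mem_range (traceOne V * m)
    have h' := sum_translate_traceOne_mul m
    simp only [h] at h'
    rwa [h'] at this
  · rintro ⟨x, rfl⟩ a
    have : CharP (MvPolynomial (V.ι × Unit) k) p :=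
      charP_of_injective_algebraMap (algebraMap (ZMod p) (MvPolynomial (V.ι × Unit) k)).injective p
    have : (translate a).comp (artinSchreier V) = artinSchreier (k := k) V := algHom_ext fun v ↦ by
      rw [AlgHom.comp_apply, artinSchreier_X, map_sub, map_pow, translate_X, add_pow_char _ _ p,
        ← map_pow, ZMod.pow_card]
      ring
    exact AlgHom.congr_fun this x

variable (k p) in
/-- The substitution `x ↦ x ^ p - x`, as a natural transformation. -/
noncomputable def asNat : polyFun k p Unit ⟶ polyFun k p Unit :=
  algNat artinSchreier fun {V W} f v ↦ by
    have : CharP (MvPolynomial (W.ι × Unit) k) p :=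
      charP_of_injective_algebraMap (algebraMap (ZMod p) (MvPolynomial (W.ι × Unit) k)).injective p
    rw [artinSchreier_X, map_sub, map_pow, polySubst_X, map_sum, sum_pow_char, ← Finset.sum_sub_distrib]
    refine Finset.sum_congr rfl fun w _ ↦ ?_
    have : artinSchreier W (Mt.mat f v.1 w • X (w, v.2)) =
      Mt.mat f v.1 w • artinSchreier (k := k) W (X (w, v.2)) := map_zmod_smul (artinSchreier W).toRingHom _ _
    rw [this, artinSchreier_X, smul_sub, Algebra.smul_def, Algebra.smul_def, mul_pow, ← map_pow,
      ZMod.pow_card]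

lemma asNat_app (V : Mt (ZMod p)) (x : MvPolynomial (V.ι × Unit) k) :
    (asNat k p).app V x = artinSchreier V x := rfl

/-- The substitution `x ↦ T ^ p * x ^ p - T * x`. -/
noncomputable def asGraded (V : Mt (ZMod p)) :
    MvPolynomial (V.ι × Unit) k →ₐ[k] Polynomial (MvPolynomial (V.ι × Unit) k) :=
  aeval fun v ↦ Polynomial.C (X v ^ p) * Polynomial.X ^ p - Polynomial.C (X v) * Polynomial.X

lemma asGraded_X (V : Mt (ZMod p)) (v : V.ι × Unit) : asGraded (k := k) V (X v) =
    Polynomial.C (X v ^ p) * Polynomial.X ^ p - Polynomial.C (X v) * Polynomial.X := aeval_X _ _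

/-- The grading, as a coaction. -/
noncomputable def coaction (σ k : Type*) [CommRing k] :
    MvPolynomial σ k →ₐ[k] Polynomial (MvPolynomial σ k) :=
  aeval fun v ↦ Polynomial.C (X v) * Polynomial.X

lemma coaction_of_homogeneous {σ k : Type*} [CommRing k] {f : MvPolynomial σ k} {n : ℕ}
    (hf : IsWeightedHomogeneous (fun _ : σ ↦ 1) f n) :
    coaction σ k f = Polynomial.C f * Polynomial.X ^ n :=
  algHom_eq_mul_of_isWeightedHomogeneous (coaction σ k)
    (IsScalarTower.toAlgHom k (MvPolynomial σ k) _) (powersHom _ Polynomial.X)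
    (fun i ↦ by
      rw [coaction, aeval_X]
      simp [powersHom_apply]) hf

lemma coeff_coaction {σ k : Type*} [CommRing k] (f : MvPolynomial σ k) (n : ℕ) :
    (coaction σ k f).coeff n = weightedHomogeneousComponent (fun _ : σ ↦ 1) n f := by
  have hf := sum_homogeneousComponent f
  conv_lhs => rw [← hf]
  conv_rhs => rw [← hf]
  rw [map_sum, map_sum, Polynomial.finsetSum_coeff]
  refine Finset.sum_congr rfl fun i _ ↦ ?_
  have h : IsWeightedHomogeneous (fun _ : σ ↦ 1) (homogeneousComponent i f) i :=
    weightedHomogeneousComponent_mem _ _ _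
  rw [coaction_of_homogeneous h, Polynomial.coeff_C_mul, Polynomial.coeff_X_pow,
    weightedHomogeneousComponent_of_mem (n := i) h]
  split_ifs <;> simp

lemma coeff_asGraded (V : Mt (ZMod p)) (f : MvPolynomial (V.ι × Unit) k) (n : ℕ) :
    (asGraded V f).coeff n =
      weightedHomogeneousComponent (fun _ : V.ι × Unit ↦ 1) n (artinSchreier V f) := by
  have : asGraded V = (coaction _ k).comp (artinSchreier V) := algHom_ext fun v ↦ by
    rw [AlgHom.comp_apply, artinSchreier_X, asGraded_X, coaction]
    simp only [map_sub, map_pow, aeval_X, mul_pow]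
  rw [← coeff_coaction, this, AlgHom.comp_apply]

lemma component_artinSchreier_of_lt {V : Mt (ZMod p)} {f : MvPolynomial (V.ι × Unit) k} {n m : ℕ}
    (hf : IsWeightedHomogeneous (fun _ : V.ι × Unit ↦ 1) f n) :
    (m < n → weightedHomogeneousComponent (fun _ : V.ι × Unit ↦ 1) m (artinSchreier V f) = 0) ∧
    weightedHomogeneousComponent (fun _ : V.ι × Unit ↦ 1) n (artinSchreier V f) = (-1) ^ n * f := by
  have hp1 := hp.out.one_lt
  let ψ : MvPolynomial (V.ι × Unit) k →ₐ[k] Polynomial (MvPolynomial (V.ι × Unit) k) :=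
    aeval fun v ↦ Polynomial.C (X v ^ p) * Polynomial.X ^ (p - 1) - Polynomial.C (X v)
  have h := algHom_eq_mul_of_isWeightedHomogeneous (asGraded V) ψ (powersHom _ Polynomial.X)
    (fun i ↦ by
      rw [asGraded_X, powersHom_apply, toAdd_ofAdd, pow_one, aeval_X, sub_mul, mul_assoc,
        ← pow_succ, Nat.sub_add_cancel hp1.le]) hf
  rw [powersHom_apply, toAdd_ofAdd] at h
  refine ⟨fun hm ↦ ?_, ?_⟩
  · rw [← coeff_asGraded, h, Polynomial.coeff_mul_X_pow', if_neg (by omega)]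
  · rw [← coeff_asGraded, h, Polynomial.coeff_mul_X_pow', if_pos le_rfl, Nat.sub_self,
      Polynomial.coeff_zero_eq_aeval_zero]
    refine (algHom_eq_mul_of_isWeightedHomogeneous
      ((((Polynomial.aeval 0 : Polynomial (MvPolynomial (V.ι × Unit) k) →ₐ[_] _)).restrictScalars k).comp ψ)
      (AlgHom.id k _) (powersHom _ (-1)) (fun i ↦ ?_) hf).trans ?_
    · rw [AlgHom.comp_apply, aeval_X]
      simp [Nat.sub_ne_zero_of_lt hp1]
    · simp [mul_comm]

lemma natDegree_asGraded_monomial (V : Mt (ZMod p)) (d : V.ι × Unit →₀ ℕ) :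
    (asGraded V (monomial d (1 : k))).natDegree ≤ p * d.degree ∧
    (asGraded V (monomial d (1 : k))).coeff (p * d.degree) = expand p (monomial d 1) := by
  have hp1 := hp.out.one_lt
  induction d using Finsupp.induction_linear with
  | zero =>
    simp
  | add d e hd he =>
    have : monomial (d + e) (1 : k) = monomial d 1 * monomial e 1 := by rw [monomial_mul, one_mul]
    rw [this, map_mul, map_mul, map_add, mul_add, ← hd.2, ← he.2]
    exact ⟨Polynomial.natDegree_mul_le_of_le hd.1 he.1,
      Polynomial.coeff_mul_add_eq_of_natDegree_le hd.1 he.1⟩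
  | single i n =>
    have h₁ : (asGraded (k := k) V (X i)).natDegree ≤ p := by
      rw [asGraded_X]
      refine (Polynomial.natDegree_sub_le_of_le (Polynomial.natDegree_C_mul_X_pow_le _ _)
        (Polynomial.natDegree_mul_le_of_le (Polynomial.natDegree_C _).le
          Polynomial.natDegree_X_le)).trans (by simp [hp1.le])
    have h₂ : (asGraded (k := k) V (X i)).coeff p = X i ^ p := by
      rw [asGraded_X, Polynomial.coeff_sub, Polynomial.coeff_C_mul_X_pow, Polynomial.coeff_C_mul_X,
        if_pos rfl, if_neg (by omega), sub_zero]
    have h₃ : monomial (Finsupp.single i n) (1 : k) = X i ^ n := by rw [X_pow_eq_monomial]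
    rw [h₃, map_pow, map_pow, expand_X, Finsupp.degree_single, mul_comm]
    exact ⟨Polynomial.natDegree_pow_le_of_le n h₁, by
      rw [Polynomial.coeff_pow_of_natDegree_le h₁, h₂]⟩

lemma component_artinSchreier_of_gt {V : Mt (ZMod p)} {f : MvPolynomial (V.ι × Unit) k} {n m : ℕ}
    (hf : IsWeightedHomogeneous (fun _ : V.ι × Unit ↦ 1) f n) :
    (p * n < m → weightedHomogeneousComponent (fun _ : V.ι × Unit ↦ 1) m (artinSchreier V f) = 0) ∧
    weightedHomogeneousComponent (fun _ : V.ι × Unit ↦ 1) (p * n) (artinSchreier V f) = expand p f := by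
  have key (d) (hd : d ∈ f.support) : d.degree = n := by
    rw [← hf (mem_support_iff.1 hd), Finsupp.weight_apply, Finsupp.sum, Finsupp.degree_apply]
    simp
  have h₁ (d : V.ι × Unit →₀ ℕ) : monomial d (f.coeff d) = f.coeff d • monomial d 1 := by
    rw [smul_monomial, smul_eq_mul, mul_one]
  have h₂ (d : V.ι × Unit →₀ ℕ) (c : k) : asGraded V (monomial d c) =
      Polynomial.C (C c) * asGraded V (monomial d 1) := by
    rw [← mul_one c, ← smul_eq_mul, ← smul_monomial, map_smul, Algebra.smul_def, smul_eq_mul, mul_one]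
    rfl
  simp only [← coeff_asGraded]
  rw [f.as_sum, map_sum, map_sum, Polynomial.finsetSum_coeff, Polynomial.finsetSum_coeff]
  refine ⟨fun hm ↦ Finset.sum_eq_zero fun d hd ↦ ?_, Finset.sum_congr rfl fun d hd ↦ ?_⟩
  · rw [h₂, Polynomial.coeff_C_mul, Polynomial.coeff_eq_zero_of_natDegree_lt, mul_zero]
    exact (natDegree_asGraded_monomial V d).1.trans_lt (by rwa [key d hd])
  · rw [h₂, Polynomial.coeff_C_mul, ← key d hd, (natDegree_asGraded_monomial V d).2, h₁ d, map_smul,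
      smul_eq_C_mul]

end ArtinSchreier

section ReducedPart

universe u' s

variable {C : Type u'} [Category.{0} C] [Preadditive C] {k : Type s} [Field k] (F : C ⥤ ModuleCat.{s} k)

/-- The reduced part of a functor. -/
def redSub : Subfun F where
  carrier V := LinearMap.ker (F.map (0 : V ⟶ V)).hom
  map_mem {V W} f x hx := by
    rw [LinearMap.mem_ker] at hx ⊢
    change F.map (0 : W ⟶ W) (F.map f x) = 0
    rw [← map_comp_apply, Limits.comp_zero, ← Limits.zero_comp (X := V) (f := f), map_comp_apply]
    exact (congrArg _ hx).trans (map_zero _)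

lemma redSub_map_zero {V W : C} (x : F.obj V) (hx : F.map (0 : V ⟶ V) x = 0) :
    F.map (0 : V ⟶ W) x = 0 := by
  rw [← Limits.zero_comp (X := V) (f := (0 : V ⟶ W)), map_comp_apply, hx, map_zero]

lemma reduced_redSub : Reduced (redSub F).toFunctor := fun V V' x ↦
  Subtype.ext (redSub_map_zero F x.1 x.2)

/-- The projection to the reduced part. -/
def toRed : F ⟶ (redSub F).toFunctor :=
  (redSub F).lift (homMk (fun V ↦ LinearMap.id - (F.map (0 : V ⟶ V)).hom) fun {V W} f x ↦ by
      change F.map f x - F.map (0 : W ⟶ W) (F.map f x) = F.map f (x - F.map (0 : V ⟶ V) x)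
      rw [map_sub, ← map_comp_apply, ← map_comp_apply, Limits.comp_zero, Limits.zero_comp])
    fun V x ↦ by
      change F.map (0 : V ⟶ V) (x - F.map (0 : V ⟶ V) x) = 0
      rw [map_sub, ← map_comp_apply, Limits.comp_zero, sub_self]

lemma toRed_ι_assoc {F} {G : C ⥤ ModuleCat.{s} k} (hG : Reduced G) (f : F ⟶ G) :
    toRed F ≫ (redSub F).ι ≫ f = f := hom_ext_apply fun V x ↦ by
  change f.app V (x - F.map (0 : V ⟶ V) x) = f.app V x
  rw [map_sub, nat_apply, hG, sub_zero]

end ReducedPart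

section SymmetricPowers

open MvPolynomial

variable (k : Type u) [Field k] (p : ℕ) [hp : Fact p.Prime] [Algebra (ZMod p) k]

/-- The functor of homogeneous polynomials of degree `n`. -/
noncomputable abbrev symFun (n : ℕ) : Mt (ZMod p) ⥤ ModuleCat.{u} k :=
  homFun k p (fun _ : Unit ↦ (1 : ℕ)) n

/-- The inclusion of homogeneous polynomials. -/
noncomputable abbrev symIncl (n : ℕ) : symFun k p n ⟶ polyFun k p Unit :=
  homIncl k p (fun _ : Unit ↦ (1 : ℕ)) n

/-- The homogeneous component. -/
noncomputable abbrev symComp (n : ℕ) : polyFun k p Unit ⟶ symFun k p n :=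
  homComp k p (fun _ : Unit ↦ (1 : ℕ)) n

variable {k p} in
lemma isWeightedHomogeneous_expand {σ N : Type*} [AddCommMonoid N] {wt : σ → N}
    {f : MvPolynomial σ k} {n : N} (hf : IsWeightedHomogeneous wt f n) :
    IsWeightedHomogeneous wt (expand p f) (p • n) :=
  isWeightedHomogeneous_algHom (nsmulAddMonoidHom p) (expand p)
    (fun i ↦ by
      rw [expand_X]
      exact (isWeightedHomogeneous_X _ _ _).pow p) hf

/-- The substitution `x ↦ x ^ p`. -/
noncomputable def expandNat (T : Type) : polyFun k p T ⟶ polyFun k p T :=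
  algNat (fun _ ↦ expand p) fun {V W} f v ↦ by
    have : CharP (MvPolynomial (W.ι × T) k) p :=
      charP_of_injective_algebraMap (algebraMap (ZMod p) (MvPolynomial (W.ι × T) k)).injective p
    rw [expand_X, map_pow, polySubst_X, map_sum, sum_pow_char]
    refine Finset.sum_congr rfl fun w _ ↦ ?_
    have : expand p (Mt.mat f v.1 w • X (w, v.2)) =
      Mt.mat f v.1 w • expand p (X (R := k) (w, v.2)) := 
        map_zmod_smul (expand (σ := W.ι × T) (R := k) p).toRingHom _ _
    rw [this, expand_X, Algebra.smul_def, Algebra.smul_def, mul_pow, ← map_pow, ZMod.pow_card]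

variable {p}

/-- The Frobenius morphism. -/
noncomputable def frob {n m : ℕ} (h : m = p * n) : symFun k p n ⟶ symFun k p m :=
  homMap (expandNat k p Unit) fun V f hf ↦ h ▸ isWeightedHomogeneous_expand hf

variable (p) {k}

lemma symIncl_asNat_of_lt {n m : ℕ} (h : m < n ∨ p * n < m) :
    symIncl k p n ≫ asNat k p ≫ symComp k p m = 0 :=
  hom_ext_apply fun V x ↦ hval_injective (h.elim
    (fun h ↦ (component_artinSchreier_of_lt (m := m) (hval_mem x)).1 h)
    (fun h ↦ (component_artinSchreier_of_gt (m := m) (hval_mem x)).1 h))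

lemma symIncl_asNat_self (n : ℕ) :
    symIncl k p n ≫ asNat k p ≫ symComp k p n = (-1 : k) ^ n • 𝟙 _ :=
  hom_ext_apply fun V x ↦ hval_injective (by
    refine (component_artinSchreier_of_lt (m := n) (hval_mem x)).2.trans ?_
    rw [smul_app_apply, hval_smul, smul_eq_C_mul, map_pow, map_neg, map_one]
    rfl)

lemma symIncl_asNat_frob {n m : ℕ} (h : m = p * n) :
    symIncl k p n ≫ asNat k p ≫ symComp k p m = frob k h := by
  subst h
  exact hom_ext_apply fun V x ↦ hval_injective
    (component_artinSchreier_of_gt (m := 0) (hval_mem x)).2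

lemma symIncl_symComp_of_ne {n m : ℕ} (h : m ≠ n) : symIncl k p n ≫ symComp k p m = 0 :=
  hom_ext_apply fun V x ↦ hval_injective (by
    refine (weightedHomogeneousComponent_of_mem (n := n) (hval_mem x)).trans ?_
    rw [if_neg h]
    rfl)

lemma sum_component {σ : Type*} (f : MvPolynomial σ k) {N : ℕ} (hN : f.totalDegree < N) :
    ∑ i ∈ Finset.range N, weightedHomogeneousComponent (fun _ : σ ↦ 1) i f = f := by
  conv_rhs => rw [← sum_homogeneousComponent f]
  refine (Finset.sum_subset (Finset.range_subset_range.2 hN) fun i _ hi ↦ ?_).symm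
  exact homogeneousComponent_eq_zero _ _ (by simpa using hi)

lemma component_artinSchreier (V : Mt (ZMod p)) (f : MvPolynomial (V.ι × Unit) k) (m : ℕ) :
    weightedHomogeneousComponent (fun _ : V.ι × Unit ↦ 1) m (artinSchreier V f) =
    ∑ n ∈ Finset.range (m + 1), weightedHomogeneousComponent (fun _ : V.ι × Unit ↦ 1) m
      (artinSchreier V (weightedHomogeneousComponent (fun _ : V.ι × Unit ↦ 1) n f)) := by
  conv_lhs => rw [← sum_component f (N := max (f.totalDegree + 1) (m + 1)) (by simp)]
  rw [map_sum, map_sum]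
  refine (Finset.sum_subset (Finset.range_subset_range.2 (le_max_right _ _)) fun i _ hi ↦ ?_).symm
  exact (component_artinSchreier_of_lt (weightedHomogeneousComponent_mem _ _ _)).1 (by simpa using hi)

lemma asNat_symComp (m : ℕ) : asNat k p ≫ symComp k p m =
    ∑ n ∈ Finset.range (m + 1), symComp k p n ≫ symIncl k p n ≫ asNat k p ≫ symComp k p m := by
  refine hom_ext_apply fun V x ↦ hval_injective ?_
  refine (component_artinSchreier p V x m).trans ?_
  have h (s : Finset ℕ) (g : ℕ → (polyFun k p Unit ⟶ symFun k p m)) :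
      hval ((∑ i ∈ s, g i).app V x) = ∑ i ∈ s, hval ((g i).app V x) :=
    map_sum (AddMonoidHom.mk' (fun g : polyFun k p Unit ⟶ symFun k p m ↦ hval (g.app V x))
      fun _ _ ↦ rfl) g s
  rw [h]
  rfl

lemma artinSchreier_injective (V : Mt (ZMod p)) : Function.Injective (artinSchreier (k := k) V) := by
  rw [injective_iff_map_eq_zero]
  intro f hf
  rw [← sum_component f (Nat.lt_succ_self _)]
  refine Finset.sum_eq_zero fun n hn ↦ ?_
  clear hn
  induction n using Nat.strong_induction_on with
  | _ n ih =>
    have h := component_artinSchreier p V f n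
    rw [hf, map_zero, Finset.sum_range_succ, Finset.sum_eq_zero (fun i hi ↦ by
      rw [ih i (by simpa using hi), map_zero, map_zero]), zero_add,
      (component_artinSchreier_of_lt (m := 0) (weightedHomogeneousComponent_mem _ _ _)).2] at h
    exact (mul_eq_zero.1 h.symm).resolve_left (pow_ne_zero _ (neg_ne_zero.2 one_ne_zero))

lemma reduced_symFun {n : ℕ} (hn : n ≠ 0) : Reduced (symFun k p n) := fun V V' x ↦
  hval_injective (by
    have h := algHom_eq_mul_of_isWeightedHomogeneous (polySubst k p Unit (0 : V ⟶ V'))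
      (polySubst k p Unit (0 : V ⟶ V')) (powersHom (MvPolynomial (V'.ι × Unit) k) 0)
      (fun i ↦ by
        have : polySubst k p Unit (0 : V ⟶ V') (X i) = 0 := by
          rw [polySubst_X]
          exact Finset.sum_eq_zero fun w _ ↦ zero_smul _ _
        rw [this, zero_mul]) (hval_mem x)
    rw [powersHom_apply, toAdd_ofAdd, zero_pow hn, mul_zero] at h
    exact h)

variable [HasExt.{w} (Mt (ZMod p) ⥤ ModuleCat.{u} k)] (Y : Mt (ZMod p) ⥤ ModuleCat.{u} k) [Y.Additive]

lemma subsingleton_ext_symFun {n : ℕ} (hn : n ≠ 0) (h : ∀ e, n ≠ p ^ e) (t : ℕ) :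
    Subsingleton (Ext Y (symFun k p n) t) := by
  have : CharP k p := charP_of_injective_algebraMap (algebraMap (ZMod p) k).injective p
  have hp1 := hp.out.one_lt
  obtain ⟨e, m, hm, rfl⟩ := Nat.exists_eq_pow_mul_and_not_dvd hn p hp1.ne'
  have hm1 : m ≠ 1 := fun h' ↦ h e (by rw [h', mul_one])
  have hq : p ^ e ≠ 0 := pow_ne_zero _ hp.out.ne_zero
  refine subsingleton_ext_homFun (fun _ ↦ Polynomial.X) (fun _ ↦ 1) (fun _ : Unit ↦ (1 : ℕ)) _ Y
    (powersHom _ (Polynomial.X + 1)) (powersHom _ Polynomial.X) (powersHom _ 1)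
    (fun i ↦ by simp [powersHom_apply]) (fun i ↦ by simp [powersHom_apply])
    (fun i ↦ by simp [powersHom_apply]) (p ^ e) ?_ ?_ ?_ t
  · rw [powersHom_apply, toAdd_ofAdd, pow_mul, add_pow_char_pow, one_pow]
    have : (Polynomial.X ^ p ^ e + 1 : Polynomial k) ^ m =
        Polynomial.expand k (p ^ e) ((Polynomial.X + 1) ^ m) := by simp
    have h₁ := Polynomial.coeff_expand_mul (Nat.pos_of_ne_zero hq) ((Polynomial.X + 1 : Polynomial k) ^ m) 1
    rw [one_mul] at h₁
    rw [this, h₁, Polynomial.coeff_X_add_one_pow, Nat.choose_one_right]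
    rwa [Ne, CharP.cast_eq_zero_iff k p]
  · rw [powersHom_apply, toAdd_ofAdd, Polynomial.coeff_X_pow, if_neg]
    intro h'
    exact hm1 (Nat.eq_of_mul_eq_mul_left (Nat.pos_of_ne_zero hq) (by rw [mul_one]; exact h'.symm))
  · rw [powersHom_apply, one_pow, Polynomial.coeff_one, if_neg hq]

variable {Y}

lemma push_sum {A : Type*} [Category A] [Abelian A] [Linear k A] [HasExt.{w} A] {X F G : A}
    {ι : Type*} (s : Finset ι) (f : ι → (F ⟶ G)) (t : ℕ) (x : Ext X F t) :
    push k X (∑ i ∈ s, f i) t x = ∑ i ∈ s, push k X (f i) t x := by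
  classical
  induction s using Finset.induction_on with
  | empty => simp [push_zero]
  | insert i s hi ih => rw [Finset.sum_insert hi, Finset.sum_insert hi, push_add, ih]

variable {t : ℕ} (y : Ext Y (polyFun k p Unit) t)

lemma push_asNat (m : ℕ) : push k Y (symComp k p m) t (push k Y (asNat k p) t y) =
    ∑ n ∈ Finset.range (m + 1), push k Y (symIncl k p n ≫ asNat k p ≫ symComp k p m) t
      (push k Y (symComp k p n) t y) := by
  rw [← push_comp]
  conv_lhs => rw [asNat_symComp, push_sum]
  refine Finset.sum_congr rfl fun n _ ↦ ?_
  rw [push_comp]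

lemma push_asNat_one {m : ℕ} (hm : m = 1) :
    push k Y (symComp k p m) t (push k Y (asNat k p) t y) = -push k Y (symComp k p m) t y := by
  subst hm
  rw [push_asNat, Finset.sum_range_succ, Finset.sum_range_one, symIncl_asNat_of_lt p (by simp),
    push_zero, zero_add, symIncl_asNat_self, push_smul, push_id, pow_one, neg_smul, one_smul]

lemma push_asNat_succ (h : ℕ) :
    push k Y (symComp k p (p ^ (h + 1))) t (push k Y (asNat k p) t y) =
      push k Y (frob k (pow_succ' p h)) t (push k Y (symComp k p (p ^ h)) t y) +
        (-1 : k) ^ (p ^ (h + 1)) • push k Y (symComp k p (p ^ (h + 1))) t y := by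
  have hp1 := hp.out.one_lt
  have hlt : p ^ h < p ^ (h + 1) := Nat.pow_lt_pow_right hp1 h.lt_succ_self
  rw [push_asNat, Finset.sum_range_succ, symIncl_asNat_self, push_smul, push_id,
    Finset.sum_eq_single (p ^ h), symIncl_asNat_frob]
  · intro n hn hne
    rw [Finset.mem_range] at hn
    by_cases hn' : n < p ^ h
    · rw [symIncl_asNat_of_lt p (Or.inr _), push_zero]
      rw [pow_succ']
      exact Nat.mul_lt_mul_of_pos_left hn' hp.out.pos
    · have : Subsingleton (Ext Y (symFun k p n) t) := by
        refine subsingleton_ext_symFun p Y (by rintro rfl; exact hn' (pow_pos hp.out.pos _))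
          (fun e he ↦ ?_) t
        subst he
        have h₁ := (Nat.pow_lt_pow_iff_right hp1).1 hn
        have h₂ : h ≤ e := not_lt.1 fun h₃ ↦ hn' (Nat.pow_lt_pow_right hp1 h₃)
        exact hne (by rw [show e = h by omega])
      rw [Subsingleton.elim (push k Y (symComp k p n) t y) 0, map_zero]
  · intro h'
    exact absurd (Finset.mem_range.2 hlt) h'

/-- If the Frobenius maps are injective, the groups vanish. -/
lemma subsingleton_ext_of_frob_injective (V₀ : Mt (ZMod p)) (x₀ : Y.obj V₀)
    (hY : ∀ (F : Mt (ZMod p) ⥤ ModuleCat.{u} k) (f : Y ⟶ F), f.app V₀ x₀ = 0 → f = 0) (t h₀ : ℕ)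
    (hinj : ∀ h, h₀ ≤ h → Function.Injective (push k Y (frob k (pow_succ' p h)) (t + 1))) :
    Subsingleton (Ext Y (symFun k p (p ^ h₀)) (t + 1)) := by
  have hp1 := hp.out.one_lt
  refine subsingleton_of_forall_eq 0 fun x ↦ ?_
  obtain ⟨y, hy⟩ := translateAct_weaklyInduced.push_surjective Y (asNat k p)
    (artinSchreier_injective p) (fun V ↦ translate_invariant_iff) t (push k Y (symIncl k p (p ^ h₀)) _ x)
  have hcomp (m : ℕ) (hm : m ≠ p ^ h₀) :
      push k Y (symComp k p m) (t + 1) (push k Y (asNat k p) (t + 1) y) = 0 := by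
    rw [hy, ← push_comp, symIncl_symComp_of_ne p hm, push_zero]
  have hself : push k Y (symComp k p (p ^ h₀)) (t + 1) (push k Y (asNat k p) (t + 1) y) = x := by
    rw [hy, ← push_comp, homIncl_homComp, push_id]
  have hpow {a b : ℕ} (hab : a ≠ b) : p ^ a ≠ p ^ b := fun h ↦ hab (Nat.pow_right_injective hp1 h)
  have hunit (n : ℕ) : (-1 : k) ^ n ≠ 0 := pow_ne_zero _ (neg_ne_zero.2 one_ne_zero)
  have hlow (h : ℕ) (hh : h < h₀) : push k Y (symComp k p (p ^ h)) (t + 1) y = 0 := by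
    induction h with
    | zero =>
      have := push_asNat_one p y (pow_zero p)
      rw [hcomp _ (hpow hh.ne)] at this
      exact neg_eq_zero.1 this.symm
    | succ h ih =>
      have := push_asNat_succ p y h
      rw [hcomp _ (hpow hh.ne), ih (by omega), map_zero, zero_add] at this
      exact (smul_eq_zero.1 this.symm).resolve_left (hunit _)
  have hup (n : ℕ) (hn : push k Y (symComp k p (p ^ (h₀ + n))) (t + 1) y = 0) :
      push k Y (symComp k p (p ^ h₀)) (t + 1) y = 0 := by
    induction n with
    | zero => exact hn
    | succ n ih =>
      have := push_asNat_succ p y (h₀ + n)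
      have hn' : push k Y (symComp k p (p ^ (h₀ + n + 1))) (t + 1) y = 0 := hn
      rw [hcomp _ (hpow (by omega)), hn', smul_zero, add_zero] at this
      refine ih (hinj _ (by omega) ?_)
      rw [map_zero]
      exact this.symm
  have hzero : push k Y (symComp k p (p ^ h₀)) (t + 1) y = 0 := by
    let M := redSub (polyFun k p Unit)
    obtain ⟨n, hn⟩ := exists_push_eq_zero Y (W := Mt.pt (ZMod p)) Mt.id_mem_closure V₀ x₀ hY (t + 1)
      M.toFunctor (reduced_redSub _) (fun n ↦ symFun k p (p ^ (h₀ + n)))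
      (fun n ↦ reduced_symFun p (pow_ne_zero _ hp.out.ne_zero)) (fun n ↦ M.ι ≫ symComp k p _)
      (fun V x ↦ by
        obtain ⟨f, hf⟩ : ∃ f : MvPolynomial (V.ι × Unit) k, f = M.ι.app V x := ⟨_, rfl⟩
        refine ⟨f.totalDegree, fun n hn ↦ hval_injective ?_⟩
        refine (congrArg _ hf.symm).trans (homogeneousComponent_eq_zero (p ^ (h₀ + n)) f ?_)
        exact hn.trans_lt (((Nat.lt_pow_self hp1).trans_le
          (Nat.pow_le_pow_right hp.out.pos (Nat.le_add_left _ _)))))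
      (push k Y (toRed _) (t + 1) y)
    refine hup n (Eq.trans ?_ hn)
    rw [← push_comp, toRed_ι_assoc (reduced_symFun p (pow_ne_zero _ hp.out.ne_zero))]
  rcases h₀ with _ | h
  · have := push_asNat_one p y (pow_zero p)
    rw [hself, hzero, neg_zero] at this
    exact this
  · have := push_asNat_succ p y h
    rw [hself, hzero, hlow h h.lt_succ_self, map_zero, smul_zero, add_zero] at this
    exact this

end SymmetricPowers

section RankZero

universe v

variable (k : Type*) [Field k] {A : Type u} [Category.{v} A] [Abelian A] [Linear k A] [HasExt.{w} A]

lemma rank_ext_zero_eq_one {X F : A} (f₀ : X ⟶ F) (hf₀ : f₀ ≠ 0) (h : ∀ f : X ⟶ F, ∃ c : k, f = c • f₀) :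
    Module.rank k (Ext X F 0) = 1 := by
  let φ : k →ₗ[k] Ext X F 0 := LinearMap.toSpanSingleton k _ (Ext.mk₀ f₀)
  have hφ : Function.Bijective φ := by
    refine ⟨(injective_iff_map_eq_zero φ).2 fun c hc ↦ ?_, fun x ↦ ?_⟩
    · refine (smul_eq_zero.1 hc).resolve_right fun h ↦ hf₀ ?_
      exact (Ext.mk₀_bijective _ _).1 (h.trans (Ext.mk₀_zero _ _).symm)
    · obtain ⟨f, rfl⟩ := (Ext.mk₀_bijective X F).2 x
      obtain ⟨c, rfl⟩ := h f
      exact ⟨c, (Ext.mk₀_smul c f₀).symm⟩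
  have := (LinearEquiv.ofBijective φ hφ).lift_rank_eq
  simpa using this.symm

end RankZero

section IdentityFunctor

open MvPolynomial

variable (k : Type u) [Field k] (p : ℕ) [hp : Fact p.Prime] [Algebra (ZMod p) k]

/-- The extension of scalars functor, on `𝔽_p`-vector spaces. -/
noncomputable abbrev scalarFun : Mt (ZMod p) ⥤ ModuleCat.{u} k :=
  linFun (Module.toModuleEnd k (S := ZMod p) k)

/-- The generator of the extension of scalars functor. -/
noncomputable abbrev scalarPt : (scalarFun k p).obj (Mt.pt (ZMod p)) :=
  linPt (Module.toModuleEnd k (S := ZMod p) k) 1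

variable {k p}

lemma scalarFun_hom_ext (F : Mt (ZMod p) ⥤ ModuleCat.{u} k) (f : scalarFun k p ⟶ F)
    (h : f.app _ (scalarPt k p) = 0) : f = 0 := by
  refine hom_ext_apply fun V x ↦ ?_
  rw [linFun_eq_sum _ x, map_sum]
  refine (Finset.sum_eq_zero fun v _ ↦ ?_).trans rfl
  have : linPt (Module.toModuleEnd k (S := ZMod p) k) (x v) = (x v : k) • scalarPt k p :=
    funext fun _ ↦ (mul_one (x v : k)).symm
  rw [nat_apply, this, map_smul, h, smul_zero, map_zero]

/-- The map sending a vector to the corresponding sum of `p ^ h`-th powers. -/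
noncomputable def powMap (h : ℕ) (ι : Type) [Fintype ι] : (ι → k) →ₗ[k] MvPolynomial (ι × Unit) k :=
  Fintype.linearCombination k fun v : ι ↦ (X (v, ()) ^ p ^ h : MvPolynomial (ι × Unit) k)

lemma powMap_apply (h : ℕ) {ι : Type} [Fintype ι] (x : ι → k) :
    powMap (p := p) h ι x = ∑ v, x v • X (v, ()) ^ p ^ h := Fintype.linearCombination_apply k _ _

lemma polySubst_powMap (h : ℕ) {V W : Mt (ZMod p)} (f : V ⟶ W) (x : V.ι → k) :
    polySubst k p Unit f (powMap (p := p) h V.ι x) =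
      powMap (p := p) h W.ι fun w ↦ ∑ v, Mt.mat f v w • x v := by
  have : CharP (MvPolynomial (W.ι × Unit) k) p :=
    charP_of_injective_algebraMap (algebraMap (ZMod p) (MvPolynomial (W.ι × Unit) k)).injective p
  have e (v : V.ι) : polySubst k p Unit f (X (v, ()) ^ p ^ h) =
      ∑ w, Mt.mat f v w • X (w, ()) ^ p ^ h := by
    rw [map_pow, polySubst_X, sum_pow_char_pow]
    refine Finset.sum_congr rfl fun w _ ↦ ?_
    rw [Algebra.smul_def, Algebra.smul_def, mul_pow, ← map_pow, ZMod.pow_card_pow]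
  simp only [powMap_apply, map_sum, map_smul, e, Finset.smul_sum, Finset.sum_smul]
  rw [Finset.sum_comm]
  exact Finset.sum_congr rfl fun w _ ↦ Finset.sum_congr rfl fun v _ ↦
    (smul_comm _ _ _).trans (smul_assoc _ _ _).symm

lemma isWeightedHomogeneous_powMap (h : ℕ) {ι : Type} [Fintype ι] (x : ι → k) :
    IsWeightedHomogeneous (fun _ : ι × Unit ↦ 1) (powMap (p := p) h ι x) (p ^ h) := by
  rw [powMap_apply]
  refine IsWeightedHomogeneous.sum _ _ _ fun v _ ↦ ?_
  have := (isWeightedHomogeneous_X k (fun _ : ι × Unit ↦ 1) (v, ())).pow (p ^ h)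
  rw [smul_eq_mul, mul_one] at this
  rw [smul_eq_C_mul]
  exact this.C_mul _

/-- The transformation sending a vector to the corresponding sum of `p ^ h`-th powers. -/
noncomputable def powNat (h : ℕ) : scalarFun k p ⟶ symFun k p (p ^ h) :=
  (homSub k p (fun _ : Unit ↦ (1 : ℕ)) (p ^ h)).lift
    (homMk (fun V ↦ powMap (p := p) h V.ι) fun f x ↦
      (congrArg _ (funext fun w ↦ linFun_map_apply _ f x w)).trans (polySubst_powMap h f x).symm)
    fun V x ↦ isWeightedHomogeneous_powMap h x

lemma hval_powNat (h : ℕ) {V : Mt (ZMod p)} (x : V.ι → k) :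
    hval ((powNat h).app V x) = powMap (p := p) h V.ι x := rfl

lemma hval_powNat_scalarPt (h : ℕ) :
    hval ((powNat h).app _ (scalarPt k p)) = X ((), ()) ^ p ^ h :=
  (powMap_apply h (fun _ : Unit ↦ (1 : k))).trans
    ((Fintype.sum_unique (ι := Unit) _).trans (one_smul _ _))

variable [HasExt.{w} (Mt (ZMod p) ⥤ ModuleCat.{u} k)]

lemma rank_ext_symFun_zero (h : ℕ) :
    Module.rank k (Ext (scalarFun k p) (symFun k p (p ^ h)) 0) = 1 := by
  refine rank_ext_zero_eq_one k (powNat h) (fun h₀ ↦ ?_) fun f ↦ ?_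
  · have := hval_powNat_scalarPt (k := k) (p := p) h
    rw [h₀] at this
    exact pow_ne_zero _ (X_ne_zero (R := k) ((), ())) this.symm
  · have hf := hval_mem (f.app _ (scalarPt k p))
    refine ⟨coeff (Finsupp.single ((), ()) (p ^ h)) (hval (f.app _ (scalarPt k p))), ?_⟩
    rw [← sub_eq_zero]
    refine scalarFun_hom_ext _ _ ?_
    rw [sub_app_apply, smul_app_apply, sub_eq_zero]
    refine hval_injective ?_
    rw [hval_smul, hval_powNat_scalarPt]
    refine MvPolynomial.ext _ _ fun d ↦ ?_
    have hd : d = Finsupp.single ((), ()) (d ((), ())) := Finsupp.ext fun i ↦ by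
      rw [Subsingleton.elim i ((), ()), Finsupp.single_eq_same]
    rw [coeff_smul, coeff_X_pow]
    split_ifs with h'
    · rw [h', smul_eq_mul, mul_one]
    · rw [smul_zero]
      refine hf.coeff_eq_zero _ fun h₁ ↦ h' ?_
      rw [hd] at h₁ ⊢
      rw [← h₁]
      simp [Finsupp.weight_apply]

end IdentityFunctor

section NilpotentEndomorphisms

variable {k M : Type*} [CommRing k] [AddCommGroup M] [Module k M] (δ : Module.End k M)
  (B K K' : Submodule k M)

/-- For an endomorphism with vanishing `p`-th power (modulo `B`), if cycles are `(p - 1)`-fold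
boundaries, then elements killed by the `j`-th power are `(p - j)`-fold boundaries. -/
lemma exists_sub_pow_mem {p : ℕ} (hB : ∀ x ∈ B, δ x ∈ B) (hK : K ≤ K') (hδ : ∀ x ∈ K', δ x ∈ K)
    (h : ∀ u ∈ K, δ u ∈ B → ∃ w ∈ K', u - (δ ^ (p - 1)) w ∈ B) (j : ℕ) (hj : j < p) (u : M)
    (hu : u ∈ K) (huj : (δ ^ j) u ∈ B) : ∃ w ∈ K', u - (δ ^ (p - j)) w ∈ B := by
  have hpow (m : ℕ) (x : M) (hx : x ∈ K) : (δ ^ m) x ∈ K := by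
    induction m with
    | zero => exact hx
    | succ m ih =>
      rw [pow_succ', Module.End.mul_apply]
      exact hδ _ (hK ih)
  have hpowB (m : ℕ) (x : M) (hx : x ∈ B) : (δ ^ m) x ∈ B := by
    induction m with
    | zero => exact hx
    | succ m ih =>
      rw [pow_succ', Module.End.mul_apply]
      exact hB _ ih
  induction j generalizing u with
  | zero => exact ⟨0, zero_mem _, by simpa using huj⟩
  | succ j ih =>
    rw [pow_succ', Module.End.mul_apply] at huj
    obtain ⟨w, hw, hw'⟩ := h _ (hpow j u hu) huj
    obtain ⟨m, hm⟩ : ∃ m, p = j + 1 + (m + 1) := ⟨p - (j + 2), by omega⟩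
    have e₁ : p - 1 = j + (m + 1) := by omega
    have e₂ : p - j = m + 1 + 1 := by omega
    have e₃ : p - (j + 1) = m + 1 := by omega
    rw [e₁, pow_add, Module.End.mul_apply, ← map_sub] at hw'
    obtain ⟨w', hw₁, hw₂⟩ := ih (by omega) (u - (δ ^ (m + 1)) w) (sub_mem hu (by
      rw [pow_succ, Module.End.mul_apply]
      exact hpow _ _ (hδ _ hw))) hw'
    refine ⟨w + δ w', add_mem hw (hK (hδ _ hw₁)), ?_⟩
    rw [e₂, pow_succ (n := m + 1), Module.End.mul_apply] at hw₂
    rw [e₃, map_add, ← sub_sub]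
    exact hw₂

end NilpotentEndomorphisms

section DerivationPowers

open MvPolynomial

variable {k : Type*} [CommRing k]

lemma derivation_pow_mul {A : Type*} [CommRing A] [Algebra k A] (D : Derivation k A A) (n : ℕ) (a b : A) :
    (D.toLinearMap ^ n : Module.End k A) (a * b) = ∑ ij ∈ Finset.HasAntidiagonal.antidiagonal n,
      n.choose ij.1 • ((D.toLinearMap ^ ij.1 : Module.End k A) a * (D.toLinearMap ^ ij.2 : Module.End k A) b) := by
  induction n with
  | zero => simp
  | succ n ih =>
    rw [Finset.sum_antidiagonal_choose_succ_nsmul (M := A) (fun i j ↦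
      (D.toLinearMap ^ i : Module.End k A) a * (D.toLinearMap ^ j : Module.End k A) b) n]
    simp only [pow_succ', Module.End.mul_apply, ih, map_sum, map_nsmul, Derivation.coeFn_coe, Derivation.leibniz, smul_eq_mul, smul_add, Finset.sum_add_distrib]
    congr 1
    refine Finset.sum_congr rfl fun ij hij ↦ ?_
    rw [mul_comm, Nat.choose_symm_of_eq_add (Finset.HasAntidiagonal.mem_antidiagonal.1 hij).symm]

lemma derivation_pow_char_mul {A : Type*} [CommRing A] [Algebra k A] (D : Derivation k A A) (p : ℕ)
    [hp : Fact p.Prime] [CharP A p] (a b : A) : (D.toLinearMap ^ p : Module.End k A) (a * b) =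
      a * (D.toLinearMap ^ p : Module.End k A) b + (D.toLinearMap ^ p : Module.End k A) a * b := by
  rw [derivation_pow_mul, Finset.Nat.sum_antidiagonal_eq_sum_range_succ_mk, Finset.sum_range_succ,
    Finset.range_eq_Ico, Finset.sum_eq_sum_Ico_succ_bot hp.out.pos, Finset.sum_eq_zero]
  · simp
  · intro i hi
    rw [Finset.mem_Ico] at hi
    rw [← Nat.cast_smul_eq_nsmul A,
      (CharP.cast_eq_zero_iff A p _).2 (hp.out.dvd_choose_self (by omega) hi.2), zero_smul]

variable {σ N : Type*} [AddCommMonoid N] {wt : σ → N} {e : N}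
  (D : Derivation k (MvPolynomial σ k) (MvPolynomial σ k))

lemma isWeightedHomogeneous_derivation (h : ∀ i, IsWeightedHomogeneous wt (D (X i)) (wt i + e))
    {f : MvPolynomial σ k} {n : N} (hf : IsWeightedHomogeneous wt f n) :
    IsWeightedHomogeneous wt (D f) (n + e) := by
  classical
  have hmon (d : σ →₀ ℕ) : IsWeightedHomogeneous wt (D (monomial d 1)) (Finsupp.weight wt d + e) := by
    induction d using Finsupp.induction_linear with
    | zero => 
      rw [show (monomial 0 (1 : k) : MvPolynomial σ k) = 1 from rfl, D.map_one_eq_zero]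
      exact isWeightedHomogeneous_zero _ _ _
    | add d₁ d₂ h₁ h₂ =>
      have : (monomial (d₁ + d₂) (1 : k)) = monomial d₁ 1 * monomial d₂ 1 := by
        rw [monomial_mul, one_mul]
      rw [this, D.leibniz, map_add, smul_eq_mul, smul_eq_mul]
      have m₁ : IsWeightedHomogeneous wt (monomial d₁ (1 : k)) _ :=
        isWeightedHomogeneous_monomial _ _ _ rfl
      have m₂ : IsWeightedHomogeneous wt (monomial d₂ (1 : k)) _ :=
        isWeightedHomogeneous_monomial _ _ _ rfl
      refine IsWeightedHomogeneous.add ?_ ?_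
      · rw [add_assoc]
        exact m₁.mul h₂
      · rw [add_comm (Finsupp.weight wt d₁), add_assoc]
        exact m₂.mul h₁
    | single i m =>
      induction m with
      | zero =>
        rw [Finsupp.single_zero, show (monomial 0 (1 : k) : MvPolynomial σ k) = 1 from rfl,
          D.map_one_eq_zero]
        exact isWeightedHomogeneous_zero _ _ _
      | succ m ih =>
        have : (monomial (Finsupp.single i (m + 1)) (1 : k)) = monomial (Finsupp.single i m) 1 * X i := by
          rw [X, monomial_mul, one_mul, Finsupp.single_add]
        rw [this, D.leibniz, Finsupp.single_add, map_add, smul_eq_mul, smul_eq_mul]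
        have m₁ : IsWeightedHomogeneous wt (monomial (Finsupp.single i m) (1 : k)) _ :=
          isWeightedHomogeneous_monomial _ _ _ rfl
        have e₁ : Finsupp.weight wt (Finsupp.single i 1) = wt i := by simp [Finsupp.weight_apply]
        rw [e₁]
        refine IsWeightedHomogeneous.add ?_ ?_
        · rw [add_assoc]
          exact m₁.mul (h i)
        · rw [add_comm (Finsupp.weight wt _), add_assoc]
          exact (isWeightedHomogeneous_X _ _ _).mul ih
  rw [f.as_sum, map_sum]
  refine IsWeightedHomogeneous.sum _ _ _ fun d hd ↦ ?_
  have : monomial d (coeff d f) = coeff d f • monomial d (1 : k) := by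
    rw [smul_monomial, smul_eq_mul, mul_one]
  rw [this, D.map_smul, ← hf (mem_support_iff.1 hd), smul_eq_C_mul]
  exact (hmon d).C_mul _

lemma weightedHomogeneousComponent_derivation [IsRightCancelAdd N]
    (h : ∀ i, IsWeightedHomogeneous wt (D (X i)) (wt i + e)) (f : MvPolynomial σ k) (m : N) :
    weightedHomogeneousComponent wt (m + e) (D f) = D (weightedHomogeneousComponent wt m f) := by
  classical
  induction f using MvPolynomial.induction_on' with
  | add f g hf hg => simp only [map_add, hf, hg]
  | monomial d c =>
    have hd : IsWeightedHomogeneous wt (monomial d c) (Finsupp.weight wt d) :=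
      isWeightedHomogeneous_monomial _ _ _ rfl
    rw [weightedHomogeneousComponent_of_mem (isWeightedHomogeneous_derivation D h hd),
      weightedHomogeneousComponent_of_mem (n := Finsupp.weight wt d) hd]
    simp only [add_left_inj]
    split_ifs <;> simp

end DerivationPowers

section KillVars

open MvPolynomial

variable {k σ : Type*} [Field k] (S : Set σ)

open Classical in
/-- The evaluation at zero of a set of variables. -/
noncomputable def killVars : MvPolynomial σ k →ₐ[k] MvPolynomial σ k :=
  aeval fun i ↦ if i ∈ S then 0 else X i

variable {S}

lemma killVars_X_of_mem {i : σ} (hi : i ∈ S) : killVars S (X i : MvPolynomial σ k) = 0 := by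
  rw [killVars, aeval_X, if_pos hi]

lemma killVars_X_of_notMem {i : σ} (hi : i ∉ S) : killVars S (X i : MvPolynomial σ k) = X i := by
  rw [killVars, aeval_X, if_neg hi]

lemma killVars_killVars {S' : Set σ} (h : S ⊆ S') (f : MvPolynomial σ k) :
    killVars S' (killVars S f) = killVars S' f := by
  refine DFunLike.congr_fun (algHom_ext (f := (killVars S').comp (killVars S)) (g := killVars S')
    fun i ↦ ?_) f
  rw [AlgHom.comp_apply]
  by_cases hi : i ∈ S
  · rw [killVars_X_of_mem hi, killVars_X_of_mem (h hi), map_zero]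
  · rw [killVars_X_of_notMem hi]

lemma killVars_empty (f : MvPolynomial σ k) : killVars ∅ f = f :=
  DFunLike.congr_fun (algHom_ext (f := killVars ∅) (g := AlgHom.id k _)
    fun i ↦ killVars_X_of_notMem (Set.notMem_empty i)) f

open Classical in
lemma killVars_monomial (d : σ →₀ ℕ) (a : k) :
    killVars S (monomial d a) = if ∀ i ∈ S, d i = 0 then monomial d a else 0 := by
  rw [killVars, aeval_monomial]
  split_ifs with h
  · rw [monomial_eq]
    congr 1
    refine Finsupp.prod_congr fun i hi ↦ ?_
    rw [if_neg fun hi' ↦ Finsupp.mem_support_iff.1 hi (h i hi')]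
  · push Not at h
    obtain ⟨i, hi, hd⟩ := h
    rw [Finsupp.prod, Finset.prod_eq_zero (Finsupp.mem_support_iff.2 hd), mul_zero]
    rw [if_pos hi, zero_pow hd]

open Classical in
lemma coeff_killVars (d : σ →₀ ℕ) (f : MvPolynomial σ k) :
    coeff d (killVars S f) = if ∀ i ∈ S, d i = 0 then coeff d f else 0 := by
  induction f using MvPolynomial.induction_on' with
  | monomial e a =>
    rw [killVars_monomial]
    by_cases hde : e = d
    · subst hde
      split_ifs <;> simp
    · split_ifs <;> simp [coeff_monomial, hde]
  | add f g hf hg =>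
    rw [map_add, coeff_add, hf, hg]
    split_ifs <;> simp

lemma isWeightedHomogeneous_killVars {N : Type*} [AddCommMonoid N] {wt : σ → N} {n : N}
    {f : MvPolynomial σ k} (hf : IsWeightedHomogeneous wt f n) :
    IsWeightedHomogeneous wt (killVars S f) n := fun d hd ↦ hf (by
  rw [coeff_killVars] at hd
  split_ifs at hd
  · exact hd
  · exact absurd rfl hd)

/-- Extensionality for derivations relative to an algebra morphism. -/
lemma eq_of_leibniz {τ : Type*} (φ : MvPolynomial σ k →ₐ[k] MvPolynomial τ k)
    (A B : MvPolynomial σ k →ₗ[k] MvPolynomial τ k)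
    (hA : ∀ f g, A (f * g) = A f * φ g + φ f * A g) (hB : ∀ f g, B (f * g) = B f * φ g + φ f * B g)
    (h : ∀ i, A (X i) = B (X i)) (f : MvPolynomial σ k) : A f = B f := by
  have h₁ (A : MvPolynomial σ k →ₗ[k] MvPolynomial τ k)
      (hA : ∀ f g, A (f * g) = A f * φ g + φ f * A g) : A 1 = 0 := by
    have := hA 1 1
    rw [mul_one, map_one φ, mul_one, one_mul] at this
    exact left_eq_add.1 this
  induction f using MvPolynomial.induction_on with
  | C a =>
    rw [← mul_one (C a), ← smul_eq_C_mul, map_smul, map_smul, h₁ A hA, h₁ B hB]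
  | add f g hf hg => rw [map_add, map_add, hf, hg]
  | mul_X f i hf => rw [hA, hB, hf, h]

variable (D : Derivation k (MvPolynomial σ k) (MvPolynomial σ k))

lemma killVars_derivation_killVars (hD : ∀ i ∈ S, killVars S (D (X i)) = 0)
    (f : MvPolynomial σ k) : killVars S (D (killVars S f)) = killVars S (D f) := by
  refine eq_of_leibniz (killVars S) ((killVars S).toLinearMap ∘ₗ D.toLinearMap ∘ₗ (killVars S).toLinearMap)
    ((killVars S).toLinearMap ∘ₗ D.toLinearMap) (fun f g ↦ ?_) (fun f g ↦ ?_) (fun i ↦ ?_) f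
  · change killVars S (D (killVars S (f * g))) = killVars S (D (killVars S f)) * killVars S g +
      killVars S f * killVars S (D (killVars S g))
    rw [map_mul, D.leibniz, map_add, smul_eq_mul, smul_eq_mul, map_mul, map_mul,
      killVars_killVars subset_rfl, killVars_killVars subset_rfl]
    ring
  · change killVars S (D (f * g)) = killVars S (D f) * killVars S g + killVars S f * killVars S (D g)
    rw [D.leibniz, map_add, smul_eq_mul, smul_eq_mul, map_mul, map_mul]
    ring
  · change killVars S (D (killVars S (X i))) = killVars S (D (X i))
    by_cases hi : i ∈ S
    · rw [killVars_X_of_mem hi, hD i hi, map_zero, map_zero]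
    · rw [killVars_X_of_notMem hi]

variable {D}

lemma killVars_derivation_eq_zero (hD : ∀ i ∈ S, killVars S (D (X i)) = 0)
    {f : MvPolynomial σ k} (hf : killVars S f = 0) : killVars S (D f) = 0 := by
  rw [← killVars_derivation_killVars D hD, hf, map_zero, map_zero]

lemma killVars_derivation_pow_eq_zero (hD : ∀ i ∈ S, killVars S (D (X i)) = 0)
    {f : MvPolynomial σ k} (hf : killVars S f = 0) (j : ℕ) :
    killVars S ((D.toLinearMap ^ j : Module.End k _) f) = 0 := by
  induction j with
  | zero => exact hf
  | succ j ih =>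
    rw [pow_succ', Module.End.mul_apply]
    exact killVars_derivation_eq_zero hD ih

lemma killVars_derivation_pow_X_mul (hD : ∀ i ∈ S, killVars S (D (X i)) = 0) {i : σ} (hi : i ∉ S)
    (hDi : killVars S (D (X i)) = 0) (f : MvPolynomial σ k) (j : ℕ) :
    killVars S ((D.toLinearMap ^ j : Module.End k _) (X i * f)) =
      X i * killVars S ((D.toLinearMap ^ j : Module.End k _) f) := by
  induction j generalizing f with
  | zero => exact (map_mul _ _ _).trans (by rw [killVars_X_of_notMem hi]; rfl)
  | succ j ih =>
    rw [pow_succ, Module.End.mul_apply, Module.End.mul_apply]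
    change killVars S ((D.toLinearMap ^ j : Module.End k _) (D (X i * f))) = _
    rw [D.leibniz, map_add, map_add, smul_eq_mul, smul_eq_mul, ih,
      killVars_derivation_pow_eq_zero hD (f := f * D (X i)), add_zero]
    · rfl
    · rw [map_mul, hDi, mul_zero]

lemma exists_killVars_eq_X_mul {N : Type*} [AddCancelCommMonoid N] {wt : σ → N} {n : N} {i : σ}
    {f : MvPolynomial σ k} (hf : IsWeightedHomogeneous wt f (n + wt i))
    (h : killVars (insert i S) f = 0) :
    ∃ g, IsWeightedHomogeneous wt g n ∧ killVars S f = X i * g := by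
  have hx : X i ∣ killVars S f := by
    rw [X_dvd_iff_modMonomial_eq_zero]
    ext d
    by_cases hd : Finsupp.single i 1 ≤ d
    · rw [coeff_modMonomial_of_le _ hd, coeff_zero]
    · rw [coeff_modMonomial_of_not_le _ hd, coeff_zero]
      have hd' : d i = 0 := by
        by_contra h0
        exact hd (Finsupp.single_le_iff.2 (Nat.one_le_iff_ne_zero.2 h0))
      have := congrArg (coeff d) h
      rw [coeff_killVars, coeff_zero] at this
      rw [coeff_killVars]
      split_ifs with hS
      · rwa [if_pos] at this
        rintro j (rfl | hj)
        exacts [hd', hS j hj]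
      · rfl
  obtain ⟨g, hg⟩ := hx
  refine ⟨g, fun d hd ↦ ?_, hg⟩
  have h₁ := isWeightedHomogeneous_killVars (S := S) hf (d := Finsupp.single i 1 + d) (by
    rwa [hg, coeff_X_mul])
  rw [map_add, Finsupp.weight_single, one_smul, add_comm] at h₁
  exact add_right_cancel h₁

end KillVars

lemma pow_apply_pow_apply_of_commutator {k M : Type*} [CommRing k] [AddCommGroup M] [Module k M]
    (δ s : Module.End k M) (c : k) (u : M) (hu : δ u = 0)
    (h : ∀ m : ℕ, δ (s ((s ^ m) u)) - s (δ ((s ^ m) u)) = c • (s ^ m) u) (m : ℕ) :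
    (δ ^ m) ((s ^ m) u) = ((m.factorial : k) * c ^ m) • u := by
  have key (m : ℕ) : δ ((s ^ (m + 1)) u) = (((m + 1 : ℕ) : k) * c) • (s ^ m) u := by
    induction m with
    | zero =>
      have := h 0
      rw [pow_zero, Module.End.one_apply, hu, map_zero, sub_zero] at this
      rw [zero_add, pow_one, this, pow_zero, Nat.cast_one, one_mul, Module.End.one_apply]
    | succ m ih =>
      have := h (m + 1)
      rw [ih, map_smul, ← Module.End.mul_apply s, ← Module.End.mul_apply s, ← pow_succ', ← pow_succ',
        sub_eq_iff_eq_add, ← add_smul] at this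
      rw [this]
      congr 1
      push_cast
      ring
  induction m with
  | zero => simp
  | succ m ih =>
    rw [pow_succ δ, Module.End.mul_apply, key, map_smul, ih, smul_smul, Nat.factorial_succ]
    congr 1
    push_cast
    ring

section Troesch

open MvPolynomial

variable (k : Type*) [Field k] {p : ℕ} {ι : Type*}

/-- The variables, extended by zero. -/
noncomputable def extVar (v : ι) (n : ℕ) : MvPolynomial (ι × Fin p) k :=
  if h : n < p then X (v, ⟨n, h⟩) else 0

lemma extVar_of_lt (v : ι) {n : ℕ} (h : n < p) : extVar (p := p) k v n = X (v, ⟨n, h⟩) := dif_pos h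

lemma extVar_of_le (v : ι) {n : ℕ} (h : p ≤ n) : extVar (p := p) k v n = 0 := dif_neg h.not_gt

lemma X_eq_extVar (s : ι × Fin p) : (X s : MvPolynomial (ι × Fin p) k) = extVar k s.1 s.2 :=
  (extVar_of_lt k s.1 s.2.2).symm

variable (p ι) in
/-- The derivation shifting the variables. -/
noncomputable def shiftDer : Derivation k (MvPolynomial (ι × Fin p) k) (MvPolynomial (ι × Fin p) k) :=
  mkDerivation k fun s ↦ extVar k s.1 (s.2 + 1)

lemma shiftDer_X (s : ι × Fin p) : shiftDer k p ι (X s) = extVar k s.1 (s.2 + 1) :=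
  mkDerivation_X _ _ _

lemma shiftDer_extVar (v : ι) (n : ℕ) : shiftDer k p ι (extVar k v n) = extVar k v (n + 1) := by
  rcases lt_or_ge n p with h | h
  · rw [extVar_of_lt k v h, shiftDer_X]
  · rw [extVar_of_le k v h, map_zero, extVar_of_le k v (h.trans (Nat.le_succ n))]

/-- The shift of variables, as an endomorphism. -/
noncomputable abbrev shiftEnd (p : ℕ) (ι : Type*) : Module.End k (MvPolynomial (ι × Fin p) k) :=
  (shiftDer k p ι).toLinearMap

lemma shiftEnd_pow_extVar (v : ι) (n j : ℕ) :
    (shiftEnd k p ι ^ j) (extVar k v n) = extVar k v (n + j) := by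
  induction j generalizing n with
  | zero => rfl
  | succ j ih =>
    rw [pow_succ, Module.End.mul_apply]
    refine (congrArg _ (shiftDer_extVar k v n)).trans ?_
    rw [ih, add_right_comm, add_assoc]

/-- The variables attached to `v` of index at least `r`. -/
def tailVars (p : ℕ) {ι : Type*} (v : ι) (r : ℕ) : Set (ι × Fin p) := {s | s.1 = v ∧ r ≤ s.2}

lemma insert_tailVars (v : ι) {r : ℕ} (hr : r < p) :
    insert (v, ⟨r, hr⟩) (tailVars p v (r + 1)) = tailVars p v r := by
  ext ⟨w, i⟩
  simp only [tailVars, Set.mem_insert_iff, Prod.mk.injEq, Set.mem_ofPred_eq, Fin.ext_iff]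
  grind

lemma tailVars_self (v : ι) : tailVars p v p = ∅ :=
  Set.eq_empty_of_forall_notMem fun s hs ↦ hs.2.not_gt s.2.2

lemma killVars_extVar (v : ι) {r n : ℕ} (h : r ≤ n) :
    killVars (tailVars p v r) (extVar k v n) = 0 := by
  rcases lt_or_ge n p with hn | hn
  · rw [extVar_of_lt k v hn, killVars_X_of_mem]
    exact ⟨rfl, h⟩
  · rw [extVar_of_le k v hn, map_zero]

lemma killVars_shiftDer_X (v : ι) (r : ℕ) (s : ι × Fin p) (hs : s ∈ tailVars p v r) :
    killVars (tailVars p v r) (shiftDer k p ι (X s)) = 0 := by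
  rw [shiftDer_X, hs.1]
  exact killVars_extVar k v (hs.2.trans (Nat.le_succ _))

variable [DecidableEq ι] (v : ι)

/-- The degree in the variables attached to `v`. -/
def pointDeg (p : ℕ) {ι : Type*} [DecidableEq ι] (v : ι) (s : ι × Fin p) : ℕ := if s.1 = v then 1 else 0

omit [DecidableEq ι] in
lemma isWeightedHomogeneous_extVar {N : Type*} [AddCommMonoid N] {wt : ι × Fin p → N} {v : ι} {n : N}
    {i : ℕ} (h : ∀ hi : i < p, wt (v, ⟨i, hi⟩) = n) : IsWeightedHomogeneous wt (extVar k v i) n := by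
  rcases lt_or_ge i p with hi | hi
  · rw [extVar_of_lt k v hi, ← h hi]
    exact isWeightedHomogeneous_X _ _ _
  · rw [extVar_of_le k v hi]
    exact isWeightedHomogeneous_zero _ _ _

lemma isWeightedHomogeneous_shiftDer {n : ℕ} {f : MvPolynomial (ι × Fin p) k}
    (hf : IsWeightedHomogeneous (pointDeg p v) f n) :
    IsWeightedHomogeneous (pointDeg p v) (shiftDer k p ι f) n :=
  isWeightedHomogeneous_derivation (e := 0) _ (fun s ↦ by
    rw [shiftDer_X]
    exact isWeightedHomogeneous_extVar k fun _ ↦ rfl) hf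

lemma isWeightedHomogeneous_shiftEnd_pow {n : ℕ} {f : MvPolynomial (ι × Fin p) k}
    (hf : IsWeightedHomogeneous (pointDeg p v) f n) (j : ℕ) :
    IsWeightedHomogeneous (pointDeg p v) ((shiftEnd k p ι ^ j) f) n := by
  induction j with
  | zero => exact hf
  | succ j ih =>
    rw [pow_succ', Module.End.mul_apply]
    exact isWeightedHomogeneous_shiftDer k v ih

/-- The backward shift of the variables attached to `v`. -/
noncomputable def backDer : Derivation k (MvPolynomial (ι × Fin p) k) (MvPolynomial (ι × Fin p) k) :=
  mkDerivation k fun s ↦ if s.1 = v then -(s.2 : k) • extVar k v (s.2 - 1) else 0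

/-- The Euler derivation for the variables attached to `v`. -/
noncomputable def eulerDer : Derivation k (MvPolynomial (ι × Fin p) k) (MvPolynomial (ι × Fin p) k) :=
  mkDerivation k fun s ↦ pointDeg p v s • X s

lemma eulerDer_of_isWeightedHomogeneous [Fintype ι] {n : ℕ} {f : MvPolynomial (ι × Fin p) k}
    (hf : IsWeightedHomogeneous (pointDeg p v) f n) : eulerDer k v f = (n : k) • f := by
  have h : eulerDer (p := p) k v = ∑ s : ι × Fin p, (pointDeg p v s • X (R := k) s) • pderiv (R := k) s :=
    derivation_ext fun s ↦ by
      rw [eulerDer, mkDerivation_X, ← Derivation.coeFnAddMonoidHom_apply, map_sum, Finset.sum_apply,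
        Finset.sum_eq_single s]
      · simp
      · intro t _ hts
        simp [pderiv_X_of_ne hts.symm]
      · simp
  have h₂ := hf.sum_weight_X_mul_pderiv
  rw [h, ← Derivation.coeFnAddMonoidHom_apply, map_sum, Finset.sum_apply, Nat.cast_smul_eq_nsmul, ← h₂]
  refine Finset.sum_congr rfl fun s _ ↦ ?_
  exact smul_mul_assoc _ _ _

variable [hp : Fact p.Prime] [CharP k p]

lemma shiftEnd_pow_char (f : MvPolynomial (ι × Fin p) k) : (shiftEnd k p ι ^ p) f = 0 :=
  eq_of_leibniz (AlgHom.id k _) (shiftEnd k p ι ^ p) 0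
    (fun f g ↦ (derivation_pow_char_mul _ p f g).trans (add_comm _ _)) (fun f g ↦ by simp) (fun s ↦ by
      rw [X_eq_extVar, shiftEnd_pow_extVar, extVar_of_le k _ (Nat.le_add_left _ _)]
      rfl) f

lemma shiftDer_shiftEnd_pow (f : MvPolynomial (ι × Fin p) k) :
    shiftDer k p ι ((shiftEnd k p ι ^ (p - 1)) f) = 0 := by
  have := shiftEnd_pow_char k f
  rwa [show shiftEnd k p ι ^ p = shiftEnd k p ι ^ (p - 1 + 1) from
    congrArg _ (Nat.sub_add_cancel hp.out.one_le).symm, pow_succ', Module.End.mul_apply] at this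

lemma shiftEnd_pow_shiftDer (f : MvPolynomial (ι × Fin p) k) :
    (shiftEnd k p ι ^ (p - 1)) (shiftDer k p ι f) = 0 := by
  have := shiftEnd_pow_char k f
  rwa [show shiftEnd k p ι ^ p = shiftEnd k p ι ^ (p - 1 + 1) from
    congrArg _ (Nat.sub_add_cancel hp.out.one_le).symm, pow_succ, Module.End.mul_apply] at this

lemma commutator_backDer : ⁅shiftDer k p ι, backDer (p := p) k v⁆ = eulerDer k v := by
  refine derivation_ext fun s ↦ ?_
  obtain ⟨w, i, hi⟩ := s
  rw [Derivation.commutator_apply, shiftDer_X, backDer, mkDerivation_X, eulerDer, mkDerivation_X]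
  change shiftDer k p ι (if w = v then _ else 0) - _ = pointDeg p v (w, ⟨i, hi⟩) • X _
  rw [pointDeg]
  have h₁ : mkDerivation k (fun s : ι × Fin p ↦ if s.1 = v then -(s.2 : k) • extVar k v (s.2 - 1) else 0)
      (extVar k w (i + 1)) = if w = v then -((i : k) + 1) • X (w, ⟨i, hi⟩) else 0 := by
    rcases lt_or_ge (i + 1) p with h | h
    · rw [extVar_of_lt k w h, mkDerivation_X]
      change (if w = v then _ else _) = _
      split_ifs with hw
      · subst hw
        rw [Nat.add_sub_cancel, extVar_of_lt k w hi]
        push_cast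
        rfl
      · rfl
    · rw [extVar_of_le k w h, map_zero]
      have : ((i : k) + 1) = 0 := by
        rw [show i = p - 1 by omega, ← Nat.cast_add_one, Nat.sub_add_cancel hp.out.one_le,
          CharP.cast_eq_zero]
      rw [this, neg_zero, zero_smul, ite_self]
  refine (congrArg _ h₁).trans ?_
  by_cases hw : w = v
  · subst hw
    rw [if_pos rfl, if_pos rfl, if_pos rfl, Derivation.map_smul, shiftDer_extVar, one_smul]
    rcases Nat.eq_zero_or_pos i with rfl | hi0
    · simp
    · rw [Nat.sub_add_cancel hi0, extVar_of_lt k w hi, neg_smul, neg_smul, add_smul, one_smul]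
      simp
  · rw [if_neg hw, if_neg hw, if_neg hw, map_zero, zero_smul, sub_zero]

/-- The exactness property used in the induction: modulo the tail variables at `v`, cycles of
degree `n` at `v` are `(p - 1)`-fold boundaries. -/
def ExactModTail (p : ℕ) {ι : Type*} [DecidableEq ι] (v : ι) (r n : ℕ) : Prop :=
  ∀ u : MvPolynomial (ι × Fin p) k, IsWeightedHomogeneous (pointDeg p v) u n →
    killVars (tailVars p v r) (shiftDer k p ι u) = 0 →
    ∃ w, IsWeightedHomogeneous (pointDeg p v) w n ∧
      killVars (tailVars p v r) (u - (shiftEnd k p ι ^ (p - 1)) w) = 0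

lemma isWeightedHomogeneous_backDer_pow {n : ℕ} {f : MvPolynomial (ι × Fin p) k}
    (hf : IsWeightedHomogeneous (pointDeg p v) f n) (j : ℕ) :
    IsWeightedHomogeneous (pointDeg p v)
      (((backDer k v).toLinearMap ^ j : Module.End k (MvPolynomial (ι × Fin p) k)) f) n := by
  induction j with
  | zero => exact hf
  | succ j ih =>
    rw [pow_succ', Module.End.mul_apply]
    refine isWeightedHomogeneous_derivation (e := 0) _ (fun s ↦ ?_) ih
    rw [backDer, mkDerivation_X]
    split_ifs with h
    · rw [smul_eq_C_mul]
      exact (isWeightedHomogeneous_extVar k fun _ ↦ by simp [pointDeg, h]).C_mul _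
    · exact isWeightedHomogeneous_zero _ _ _

variable [Fintype ι]

lemma exactModTail_self {n : ℕ} (hn : ¬ p ∣ n) : ExactModTail k p v p n := by
  intro u hu hdu
  rw [tailVars_self, killVars_empty] at hdu
  have h := pow_apply_pow_apply_of_commutator (shiftEnd k p ι) (backDer k v).toLinearMap (n : k) u hdu
    (fun m ↦ by
      refine Eq.trans ?_ (eulerDer_of_isWeightedHomogeneous k v
        (isWeightedHomogeneous_backDer_pow k v hu m))
      rw [← commutator_backDer, Derivation.commutator_apply]
      rfl) (p - 1)
  have hc : (((p - 1).factorial : k) * n ^ (p - 1)) ≠ 0 := by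
    refine mul_ne_zero ?_ (pow_ne_zero _ ?_)
    · rw [Ne, CharP.cast_eq_zero_iff k p, hp.out.dvd_factorial]
      have := hp.out.pos
      omega
    · rwa [Ne, CharP.cast_eq_zero_iff k p]
  refine ⟨(((p - 1).factorial : k) * n ^ (p - 1))⁻¹ •
    ((backDer k v).toLinearMap ^ (p - 1) : Module.End k (MvPolynomial (ι × Fin p) k)) u, ?_, ?_⟩
  · rw [smul_eq_C_mul]
    exact (isWeightedHomogeneous_backDer_pow k v hu _).C_mul _
  · rw [map_smul, h, smul_smul, inv_mul_cancel₀ hc, one_smul, sub_self, map_zero]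

variable {k v}

lemma notMem_tailVars {r : ℕ} (hr : r < p) : (v, ⟨r, hr⟩) ∉ tailVars p v (r + 1) := fun h ↦
  absurd h.2 (Nat.not_succ_le_self r)

lemma exists_killVars_tailVars {r n : ℕ} (hr : r < p) {f : MvPolynomial (ι × Fin p) k}
    (hf : IsWeightedHomogeneous (pointDeg p v) f (n + 1)) (h : killVars (tailVars p v r) f = 0) :
    ∃ g, IsWeightedHomogeneous (pointDeg p v) g n ∧
      killVars (tailVars p v (r + 1)) f = X (v, ⟨r, hr⟩) * g := by
  refine exists_killVars_eq_X_mul ?_ (by rwa [insert_tailVars])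
  rwa [pointDeg, if_pos rfl]

lemma killVars_shiftEnd_pow_X_mul {r : ℕ} (hr : r < p) (f : MvPolynomial (ι × Fin p) k) (j : ℕ) :
    killVars (tailVars p v (r + 1)) ((shiftEnd k p ι ^ j) (X (v, ⟨r, hr⟩) * f)) =
      X (v, ⟨r, hr⟩) * killVars (tailVars p v (r + 1)) ((shiftEnd k p ι ^ j) f) :=
  killVars_derivation_pow_X_mul (killVars_shiftDer_X k v (r + 1)) (notMem_tailVars hr)
    (by rw [shiftDer_X]; exact killVars_extVar k v le_rfl) f j

lemma killVars_X_mul {r : ℕ} (hr : r < p) (f : MvPolynomial (ι × Fin p) k) :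
    killVars (tailVars p v (r + 1)) (X (v, ⟨r, hr⟩) * f) =
      X (v, ⟨r, hr⟩) * killVars (tailVars p v (r + 1)) f := by
  rw [map_mul, killVars_X_of_notMem (notMem_tailVars hr)]

lemma killVars_tailVars_killVars_succ {r : ℕ} (f : MvPolynomial (ι × Fin p) k) :
    killVars (tailVars p v r) (killVars (tailVars p v (r + 1)) f) = killVars (tailVars p v r) f :=
  killVars_killVars (S := tailVars p v (r + 1)) (S' := tailVars p v r)
    (fun _ hs ↦ ⟨hs.1, (Nat.le_succ r).trans hs.2⟩) f

lemma isWeightedHomogeneous_X_mul_tail {r n : ℕ} (hr : r < p) {f : MvPolynomial (ι × Fin p) k}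
    (hf : IsWeightedHomogeneous (pointDeg p v) f n) :
    IsWeightedHomogeneous (pointDeg p v) (X (v, ⟨r, hr⟩) * f) (n + 1) := by
  have := (isWeightedHomogeneous_X k (pointDeg p v) (v, (⟨r, hr⟩ : Fin p))).mul hf
  rwa [pointDeg, if_pos rfl, add_comm] at this

lemma ExactModTail.exists_sub_pow {r n j : ℕ} (h : ExactModTail k p v r n) (hj : j < p)
    {a : MvPolynomial (ι × Fin p) k} (ha : IsWeightedHomogeneous (pointDeg p v) a n)
    (hda : killVars (tailVars p v r) ((shiftEnd k p ι ^ j) a) = 0) :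
    ∃ w, IsWeightedHomogeneous (pointDeg p v) w n ∧
      killVars (tailVars p v r) (a - (shiftEnd k p ι ^ (p - j)) w) = 0 := by
  let B : Submodule k (MvPolynomial (ι × Fin p) k) := LinearMap.ker (killVars (tailVars p v r)).toLinearMap
  have hB (f : MvPolynomial (ι × Fin p) k) : f ∈ B ↔ killVars (tailVars p v r) f = 0 := Iff.rfl
  obtain ⟨w, hw, hw'⟩ := exists_sub_pow_mem (p := p) (shiftEnd k p ι) B
    (weightedHomogeneousSubmodule k (pointDeg p v) n) (weightedHomogeneousSubmodule k (pointDeg p v) n)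
    (fun x hx ↦ (hB _).2 (killVars_derivation_eq_zero (killVars_shiftDer_X k v r) ((hB x).1 hx)))
    le_rfl (fun x hx ↦ isWeightedHomogeneous_shiftDer k v hx) h j hj a ha ((hB _).2 hda)
  exact ⟨w, hw, (hB _).1 hw'⟩

lemma ExactModTail.descend {r n : ℕ} (hr : r < p) (h₀ : ExactModTail k p v (r + 1) n)
    (h₁ : ExactModTail k p v (r + 1) (n + 1)) : ExactModTail k p v r (n + 1) := by
  intro u hu hdu
  obtain ⟨a, ha, hda⟩ := exists_killVars_tailVars hr (isWeightedHomogeneous_shiftDer k v hu) hdu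
  have hX : (X (v, ⟨r, hr⟩) : MvPolynomial (ι × Fin p) k) ≠ 0 := X_ne_zero _
  have hmod : killVars (tailVars p v (r + 1)) (shiftDer k p ι u - X (v, ⟨r, hr⟩) * a) = 0 := by
    rw [map_sub, ← hda, killVars_killVars subset_rfl, sub_self]
  have ha' : killVars (tailVars p v (r + 1)) ((shiftEnd k p ι ^ (p - 1)) a) = 0 := by
    have h := killVars_derivation_pow_eq_zero (killVars_shiftDer_X k v (r + 1)) hmod (p - 1)
    rw [map_sub, map_sub, sub_eq_zero, killVars_shiftEnd_pow_X_mul, shiftEnd_pow_shiftDer,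
      map_zero] at h
    exact (mul_eq_zero.1 h.symm).resolve_left hX
  obtain ⟨w, hw, hw'⟩ := h₀.exists_sub_pow (Nat.sub_lt hp.out.pos one_pos) ha ha'
  rw [show p - (p - 1) = 1 by have := hp.out.pos; omega, pow_one] at hw'
  have hw'' : killVars (tailVars p v (r + 1)) (a - shiftDer k p ι w) = 0 := hw'
  have hdw : killVars (tailVars p v (r + 1)) (shiftDer k p ι (u - X (v, ⟨r, hr⟩) * w)) = 0 := by
    have h : killVars (tailVars p v (r + 1)) (shiftDer k p ι (X (v, ⟨r, hr⟩) * w)) =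
      X (v, ⟨r, hr⟩) * killVars (tailVars p v (r + 1)) (shiftDer k p ι w) :=
      killVars_shiftEnd_pow_X_mul hr w 1
    rw [map_sub, sub_eq_zero] at hw''
    rw [map_sub, map_sub, h, ← hw'', ← killVars_X_mul, ← map_sub, hmod]
  obtain ⟨w', hw₁, hw₂⟩ := h₁ _ (hu.sub (isWeightedHomogeneous_X_mul_tail hr hw)) hdw
  refine ⟨w', hw₁, ?_⟩
  have h := congrArg (killVars (tailVars p v r)) hw₂
  rw [map_zero, killVars_tailVars_killVars_succ, sub_right_comm, map_sub, map_mul,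
    killVars_X_of_mem (S := tailVars p v r) ⟨rfl, le_rfl⟩, zero_mul, sub_zero] at h
  exact h

lemma exactModTail_of_lt {r n : ℕ} (h : p < n % p + r) (hr : r ≤ p) : ExactModTail k p v r n := by
  obtain ⟨m, hm⟩ : ∃ m, p = r + m := ⟨p - r, by omega⟩
  induction m generalizing r n with
  | zero =>
    obtain rfl : r = p := by omega
    exact exactModTail_self k v fun h' ↦ by have := Nat.mod_eq_zero_of_dvd h'; omega
  | succ m ih =>
    obtain ⟨n, rfl⟩ : ∃ n', n = n' + 1 := ⟨n - 1, by
      have := Nat.mod_le n p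
      omega⟩
    have h1 : (n + 1) % p = n % p + 1 := by
      have hn := Nat.mod_lt n hp.out.pos
      rw [Nat.add_mod, Nat.mod_eq_of_lt hp.out.one_lt]
      rcases Nat.lt_or_ge (n % p + 1) p with h' | h'
      · exact Nat.mod_eq_of_lt h'
      · have : (n + 1) % p = 0 := by
          rw [Nat.add_mod, Nat.mod_eq_of_lt hp.out.one_lt, show n % p + 1 = p by omega, Nat.mod_self]
        omega
    exact (ih (by omega) (by omega) (by omega)).descend (by omega) (ih (by omega) (by omega) (by omega))

lemma exists_eq_shiftEnd_pow_of_killVars {n : ℕ} (hn : p ∣ n) {r : ℕ} (hr0 : 0 < r) (hr : r ≤ p)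
    {u : MvPolynomial (ι × Fin p) k} (hu : IsWeightedHomogeneous (pointDeg p v) u n)
    (hdu : shiftDer k p ι u = 0) (h : killVars (tailVars p v r) u = 0) :
    ∃ w, u = (shiftEnd k p ι ^ (p - 1)) w := by
  obtain ⟨m, hm⟩ : ∃ m, p = r + m := ⟨p - r, by omega⟩
  induction m generalizing r u with
  | zero =>
    obtain rfl : r = p := by omega
    rw [tailVars_self, killVars_empty] at h
    exact ⟨0, by rw [h, map_zero]⟩
  | succ m ih =>
    have hr' : r < p := by omega
    rcases Nat.eq_zero_or_pos n with rfl | hn0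
    · refine ⟨0, ?_⟩
      rw [map_zero]
      ext d
      by_contra hd
      have hd' := hu hd
      have := congrArg (coeff d) h
      rw [coeff_killVars, if_pos] at this
      · exact hd this
      · intro s hs
        by_contra hs0
        have h1 := Finsupp.le_weight (pointDeg p v) (s := s) (by simp [pointDeg, hs.1]) d
        omega
    obtain ⟨n', rfl⟩ : ∃ n', n = n' + 1 := ⟨n - 1, by omega⟩
    obtain ⟨a, ha, hua⟩ := exists_killVars_tailVars hr' hu h
    have hmod : killVars (tailVars p v (r + 1)) (u - X (v, ⟨r, hr'⟩) * a) = 0 := by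
      rw [map_sub, ← hua, killVars_killVars subset_rfl, sub_self]
    have hda : killVars (tailVars p v (r + 1)) (shiftDer k p ι a) = 0 := by
      have h : killVars (tailVars p v (r + 1)) (shiftDer k p ι (X (v, ⟨r, hr'⟩) * a)) =
        X (v, ⟨r, hr'⟩) * killVars (tailVars p v (r + 1)) (shiftDer k p ι a) :=
        killVars_shiftEnd_pow_X_mul hr' a 1
      have h₁ := killVars_derivation_eq_zero (killVars_shiftDer_X k v (r + 1)) hmod
      rw [map_sub, map_sub, sub_eq_zero, h, hdu, map_zero] at h₁
      exact (mul_eq_zero.1 h₁.symm).resolve_left (X_ne_zero _)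
    have hmod' : n' % p = p - 1 := by
      have hn' := Nat.mod_lt n' hp.out.pos
      have h₁ := Nat.mod_eq_zero_of_dvd hn
      rw [Nat.add_mod, Nat.mod_eq_of_lt hp.out.one_lt] at h₁
      by_contra hne
      rw [Nat.mod_eq_of_lt (by omega)] at h₁
      omega
    obtain ⟨w, hw, hw'⟩ := exactModTail_of_lt (r := r + 1) (by omega) hr' a ha hda
    have hd' : shiftDer k p ι (u - (shiftEnd k p ι ^ (p - 1)) (X (v, ⟨r, hr'⟩) * w)) = 0 := by
      rw [map_sub, hdu, shiftDer_shiftEnd_pow, sub_zero]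
    have hk' : killVars (tailVars p v (r + 1))
        (u - (shiftEnd k p ι ^ (p - 1)) (X (v, ⟨r, hr'⟩) * w)) = 0 := by
      rw [map_sub, sub_eq_zero] at hw'
      rw [map_sub, killVars_shiftEnd_pow_X_mul, ← hw', ← killVars_X_mul, ← map_sub, hmod]
    obtain ⟨w', hw''⟩ := ih (r := r + 1) (by omega) hr'
      (hu.sub (isWeightedHomogeneous_shiftEnd_pow k v (isWeightedHomogeneous_X_mul_tail hr' hw) _))
      hd' hk' (by omega)
    exact ⟨w' + X (v, ⟨r, hr'⟩) * w, by rw [map_add, ← hw'', sub_add_cancel]⟩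

end Troesch

section TroeschExact

open MvPolynomial

variable {k : Type*} [Field k] {p : ℕ} {ι : Type*}

lemma killVars_eq_self {σ : Type*} {S : Set σ} {f : MvPolynomial σ k}
    (h : ∀ d, coeff d f ≠ 0 → ∀ i ∈ S, d i = 0) : killVars S f = f := by
  ext d
  rw [coeff_killVars]
  split_ifs with hd
  · rfl
  · by_contra hne
    exact hd (h d (Ne.symm hne))

/-- Shifting all the variables kills the polynomials in the first variables. -/
lemma killVars_shiftDer (f : MvPolynomial (ι × Fin p) k) :
    killVars {s : ι × Fin p | 1 ≤ (s.2 : ℕ)} (shiftDer k p ι f) = 0 := by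
  refine eq_of_leibniz (killVars {s : ι × Fin p | 1 ≤ (s.2 : ℕ)})
    ((killVars _).toLinearMap ∘ₗ (shiftDer k p ι).toLinearMap) 0 (fun f g ↦ ?_) (fun f g ↦ by simp)
    (fun s ↦ ?_) f
  · change killVars _ (shiftDer k p ι (f * g)) = killVars _ (shiftDer k p ι f) * killVars _ g +
      killVars _ f * killVars _ (shiftDer k p ι g)
    rw [Derivation.leibniz, map_add, smul_eq_mul, smul_eq_mul, map_mul, map_mul]
    ring
  · change killVars _ (shiftDer k p ι (X s)) = 0
    rw [shiftDer_X]
    rcases lt_or_ge (s.2 + 1 : ℕ) p with h | h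
    · rw [extVar_of_lt k _ h, killVars_X_of_mem]
      exact Nat.le_add_left 1 _
    · rw [extVar_of_le k _ h, map_zero]

variable (k p ι) in
/-- The Frobenius morphism with values in the first variables. -/
noncomputable def frobVar : MvPolynomial (ι × Unit) k →ₐ[k] MvPolynomial (ι × Fin p) k :=
  aeval fun s ↦ extVar k s.1 0 ^ p

lemma frobVar_X (s : ι × Unit) : frobVar k p ι (X s) = extVar k s.1 0 ^ p := aeval_X _ _

lemma killVars_frobVar (f : MvPolynomial (ι × Unit) k) :
    killVars {s : ι × Fin p | 1 ≤ (s.2 : ℕ)} (frobVar k p ι f) = frobVar k p ι f := by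
  refine DFunLike.congr_fun (algHom_ext (f := (killVars _).comp (frobVar k p ι))
    (g := frobVar k p ι) fun s ↦ ?_) f
  rw [AlgHom.comp_apply, frobVar_X, map_pow]
  rcases Nat.eq_zero_or_pos p with h | h
  · subst h
    rw [pow_zero, pow_zero]
  · rw [extVar_of_lt k _ h, killVars_X_of_notMem]
    exact Nat.not_succ_le_zero 0

variable [hp : Fact p.Prime] [CharP k p]

lemma shiftDer_frobVar (f : MvPolynomial (ι × Unit) k) : shiftDer k p ι (frobVar k p ι f) = 0 := by
  induction f using MvPolynomial.induction_on with
  | C a => rw [algHom_C, Derivation.map_algebraMap]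
  | add f g hf hg => rw [map_add, map_add, hf, hg, add_zero]
  | mul_X f s hf =>
    rw [map_mul, Derivation.leibniz, hf, smul_zero, add_zero, frobVar_X, Derivation.leibniz_pow,
      ← Nat.cast_smul_eq_nsmul k, CharP.cast_eq_zero, zero_smul, smul_zero]

lemma mem_range_frobVar [Finite ι] {u : MvPolynomial (ι × Fin p) k} (h : ∀ d, coeff d u ≠ 0 → ∀ v : ι,
    (∀ s ∈ tailVars p v 1, d s = 0) ∧ p ∣ d (v, ⟨0, hp.out.pos⟩)) : ∃ c, u = frobVar k p ι c := by
  have := Fintype.ofFinite ι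
  refine ⟨∑ d ∈ u.support, monomial (Finsupp.equivFunOnFinite.symm
    fun s : ι × Unit ↦ d (s.1, ⟨0, hp.out.pos⟩) / p) (coeff d u), ?_⟩
  conv_lhs => rw [u.as_sum]
  rw [map_sum]
  refine Finset.sum_congr rfl fun d hd ↦ ?_
  have hd' := h d (mem_support_iff.1 hd)
  have hX : (d.prod fun s e ↦ (X s : MvPolynomial (ι × Fin p) k) ^ e) =
      ∏ v : ι, extVar k v 0 ^ d (v, ⟨0, hp.out.pos⟩) := by
    rw [Finsupp.prod_fintype _ _ fun _ ↦ pow_zero _, Fintype.prod_prod_type]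
    refine Finset.prod_congr rfl fun v _ ↦ ?_
    rw [Finset.prod_eq_single ⟨0, hp.out.pos⟩, extVar_of_lt k _ hp.out.pos]
    · intro i _ hi
      rw [(hd' v).1 (v, i) ⟨rfl, Nat.one_le_iff_ne_zero.2 fun h0 ↦ hi (Fin.ext h0)⟩, pow_zero]
    · exact fun h ↦ absurd (Finset.mem_univ _) h
  have hY : ((Finsupp.equivFunOnFinite.symm fun s : ι × Unit ↦ d (s.1, ⟨0, hp.out.pos⟩) / p).prod
      fun s e ↦ (extVar k s.1 0 ^ p : MvPolynomial (ι × Fin p) k) ^ e) =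
      ∏ v : ι, extVar k v 0 ^ d (v, ⟨0, hp.out.pos⟩) := by
    rw [Finsupp.prod_fintype _ _ fun _ ↦ pow_zero _, Fintype.prod_prod_type]
    refine Finset.prod_congr rfl fun v _ ↦ ?_
    rw [Fintype.prod_unique, ← pow_mul]
    congr 1
    exact Nat.mul_div_cancel' (hd' v).2
  rw [frobVar, aeval_monomial, monomial_eq, algebraMap_eq, hX, hY]

variable [DecidableEq ι] [Fintype ι]

lemma shiftDer_killVars_eq_zero {v : ι} {n : ℕ} (hn : p ∣ n) {u : MvPolynomial (ι × Fin p) k}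
    (hu : IsWeightedHomogeneous (pointDeg p v) u n) (hdu : shiftDer k p ι u = 0) :
    shiftDer k p ι (killVars (tailVars p v 1) u) = 0 := by
  have hp0 := hp.out.pos
  let κ : MvPolynomial (ι × Fin p) k →ₐ[k] MvPolynomial (ι × Fin p) k := killVars (tailVars p v 1)
  have hκκ (f) : κ (κ f) = κ f := killVars_killVars subset_rfl f
  have h0 : κ (X (v, ⟨0, hp0⟩)) = X (v, ⟨0, hp0⟩) := killVars_X_of_notMem (notMem_tailVars hp0)
  have h1 : κ (extVar k v 1) = 0 := killVars_extVar k v le_rfl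
  have key (f : MvPolynomial (ι × Fin p) k) : X (v, ⟨0, hp0⟩) * shiftDer k p ι (κ f) =
      X (v, ⟨0, hp0⟩) * κ (shiftDer k p ι f) + extVar k v 1 * κ (eulerDer k v f) := by
    refine eq_of_leibniz κ
      (LinearMap.mulLeft k (X (v, ⟨0, hp0⟩)) ∘ₗ (shiftDer k p ι).toLinearMap ∘ₗ κ.toLinearMap)
      (LinearMap.mulLeft k (X (v, ⟨0, hp0⟩)) ∘ₗ κ.toLinearMap ∘ₗ (shiftDer k p ι).toLinearMap +
        LinearMap.mulLeft k (extVar k v 1) ∘ₗ κ.toLinearMap ∘ₗ (eulerDer k v).toLinearMap)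
      (fun f g ↦ ?_) (fun f g ↦ ?_) (fun s ↦ ?_) f
    · change X (v, ⟨0, hp0⟩) * shiftDer k p ι (κ (f * g)) =
        X (v, ⟨0, hp0⟩) * shiftDer k p ι (κ f) * κ g + κ f * (X (v, ⟨0, hp0⟩) * shiftDer k p ι (κ g))
      rw [map_mul, Derivation.leibniz, smul_eq_mul, smul_eq_mul]
      ring
    · change X (v, ⟨0, hp0⟩) * κ (shiftDer k p ι (f * g)) + extVar k v 1 * κ (eulerDer k v (f * g)) =
        (X (v, ⟨0, hp0⟩) * κ (shiftDer k p ι f) + extVar k v 1 * κ (eulerDer k v f)) * κ g +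
        κ f * (X (v, ⟨0, hp0⟩) * κ (shiftDer k p ι g) + extVar k v 1 * κ (eulerDer k v g))
      rw [Derivation.leibniz, Derivation.leibniz, smul_eq_mul, smul_eq_mul, smul_eq_mul, smul_eq_mul,
        map_add, map_add, map_mul, map_mul, map_mul, map_mul]
      ring
    · change X (v, ⟨0, hp0⟩) * shiftDer k p ι (κ (X s)) =
        X (v, ⟨0, hp0⟩) * κ (shiftDer k p ι (X s)) + extVar k v 1 * κ (eulerDer k v (X s))
      have he : eulerDer k v (X s) = pointDeg p v s • X s := mkDerivation_X _ _ _
      rw [he, shiftDer_X, map_nsmul]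
      obtain ⟨w, i⟩ := s
      by_cases hw : w = v
      · subst hw
        have hκ : κ (extVar k w (i + 1)) = 0 := killVars_extVar k w (Nat.le_add_left _ _)
        have hd : pointDeg p w (w, i) = 1 := if_pos rfl
        rw [hκ, hd, one_smul, mul_zero, zero_add]
        by_cases hi : i = ⟨0, hp0⟩
        · subst hi
          rw [h0, shiftDer_X, mul_comm]
        · have : κ (X (w, i)) = 0 := killVars_X_of_mem
            ⟨rfl, Nat.one_le_iff_ne_zero.2 fun h ↦ hi (Fin.ext h)⟩
          rw [this, map_zero, mul_zero, mul_zero]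
      · have hd : pointDeg p v (w, i) = 0 := if_neg hw
        have hk : κ (X (w, i)) = X (w, i) := killVars_X_of_notMem fun h ↦ hw h.1
        have hκ : κ (extVar k w (i + 1)) = extVar k w (i + 1) := by
          rcases lt_or_ge (i + 1 : ℕ) p with h | h
          · rw [extVar_of_lt k _ h]
            exact killVars_X_of_notMem fun h ↦ hw h.1
          · rw [extVar_of_le k _ h, map_zero]
        rw [hd, zero_smul, mul_zero, add_zero, hk, hκ, shiftDer_X]
  have h := key u
  rw [hdu, map_zero, mul_zero, zero_add, eulerDer_of_isWeightedHomogeneous k v hu,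
    (CharP.cast_eq_zero_iff k p n).2 hn, zero_smul, map_zero, mul_zero] at h
  exact (mul_eq_zero.1 h).resolve_left (X_ne_zero _)

lemma exists_eq_add_of_isWeightedHomogeneous (v : ι) {n : ℕ} {u : MvPolynomial (ι × Fin p) k}
    (hu : IsWeightedHomogeneous (pointDeg p v) u n) (hdu : shiftDer k p ι u = 0) :
    ∃ w u', u = (shiftEnd k p ι ^ (p - 1)) w + u' ∧ shiftDer k p ι u' = 0 ∧ ∀ d, coeff d u' ≠ 0 →
      coeff d u ≠ 0 ∧ (∀ s ∈ tailVars p v 1, d s = 0) ∧ p ∣ d (v, ⟨0, hp.out.pos⟩) := by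
  by_cases hn : p ∣ n
  · have hd' := shiftDer_killVars_eq_zero hn hu hdu
    have hk : killVars (tailVars p v 1) (u - killVars (tailVars p v 1) u) = 0 := by
      rw [map_sub, killVars_killVars subset_rfl, sub_self]
    obtain ⟨w, hw⟩ := exists_eq_shiftEnd_pow_of_killVars hn one_pos hp.out.one_le
      (hu.sub (isWeightedHomogeneous_killVars hu)) (by rw [map_sub, hdu, hd', sub_zero]) hk
    refine ⟨w, killVars (tailVars p v 1) u, by rw [← hw, sub_add_cancel], hd', fun d hd ↦ ?_⟩
    rw [coeff_killVars] at hd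
    split_ifs at hd with h
    · refine ⟨hd, h, ?_⟩
      have hd1 := hu hd
      rw [Finsupp.weight_apply, Finsupp.sum_fintype _ _ (by simp),
        Finset.sum_eq_single (v, ⟨0, hp.out.pos⟩)] at hd1
      · rw [pointDeg, if_pos rfl, smul_eq_mul, mul_one] at hd1
        rwa [hd1]
      · rintro ⟨w', i⟩ _ hi
        by_cases hw' : w' = v
        · subst hw'
          rw [h (w', i) ⟨rfl, Nat.one_le_iff_ne_zero.2 fun h0 ↦ hi (Prod.ext rfl (Fin.ext h0))⟩,
            zero_smul]
        · rw [pointDeg, if_neg hw', smul_zero]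
      · simp
    · exact absurd rfl hd
  · obtain ⟨w, -, hw⟩ := exactModTail_self k v hn u hu (by rw [hdu, map_zero])
    rw [tailVars_self, killVars_empty, sub_eq_zero] at hw
    exact ⟨w, 0, by rw [add_zero, ← hw], map_zero _, fun d hd ↦ absurd (coeff_zero d) hd⟩

lemma exists_eq_add_of_shiftDer_eq_zero (v : ι) {u : MvPolynomial (ι × Fin p) k}
    (hdu : shiftDer k p ι u = 0) :
    ∃ w u', u = (shiftEnd k p ι ^ (p - 1)) w + u' ∧ shiftDer k p ι u' = 0 ∧ ∀ d, coeff d u' ≠ 0 →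
      coeff d u ≠ 0 ∧ (∀ s ∈ tailVars p v 1, d s = 0) ∧ p ∣ d (v, ⟨0, hp.out.pos⟩) := by
  have hcomp (n : ℕ) : shiftDer k p ι (weightedHomogeneousComponent (pointDeg p v) n u) = 0 := by
    rw [← weightedHomogeneousComponent_derivation (e := 0) _ (fun s ↦ ?_), hdu, map_zero]
    rw [shiftDer_X]
    exact isWeightedHomogeneous_extVar k fun _ ↦ rfl
  choose w u' h₁ h₂ h₃ using fun n ↦ exists_eq_add_of_isWeightedHomogeneous v
    (weightedHomogeneousComponent_isWeightedHomogeneous n u) (hcomp n)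
  have hs := sum_weightedHomogeneousComponent (pointDeg p v) u
  have hf := weightedHomogeneousComponent_finsupp (w := pointDeg p v) u
  rw [finsum_eq_sum _ hf] at hs
  refine ⟨∑ n ∈ hf.toFinset, w n, ∑ n ∈ hf.toFinset, u' n, ?_, ?_, fun d hd ↦ ?_⟩
  · rw [map_sum, ← Finset.sum_add_distrib]
    conv_lhs => rw [← hs]
    exact Finset.sum_congr rfl fun n _ ↦ h₁ n
  · rw [map_sum]
    exact Finset.sum_eq_zero fun n _ ↦ h₂ n
  · rw [coeff_sum] at hd
    obtain ⟨n, -, hn⟩ := Finset.exists_ne_zero_of_sum_ne_zero hd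
    obtain ⟨h, h'⟩ := h₃ n d hn
    refine ⟨?_, h'⟩
    rw [coeff_weightedHomogeneousComponent] at h
    split_ifs at h
    · exact h
    · exact absurd rfl h

/-- The kernel of the shift is the sum of the image of its `(p - 1)`-th power and of the image of
the Frobenius morphism. -/
theorem exists_eq_shiftEnd_pow_add_frobVar {u : MvPolynomial (ι × Fin p) k}
    (hdu : shiftDer k p ι u = 0) :
    ∃ w c, u = (shiftEnd k p ι ^ (p - 1)) w + frobVar k p ι c := by
  have key (T : Finset ι) : ∃ w u', u = (shiftEnd k p ι ^ (p - 1)) w + u' ∧ shiftDer k p ι u' = 0 ∧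
      ∀ d, coeff d u' ≠ 0 → ∀ v ∈ T, (∀ s ∈ tailVars p v 1, d s = 0) ∧ p ∣ d (v, ⟨0, hp.out.pos⟩) := by
    induction T using Finset.induction_on with
    | empty => exact ⟨0, u, by rw [map_zero, zero_add], hdu, by simp⟩
    | insert v T hv ih =>
      obtain ⟨w, u', h₁, h₂, h₃⟩ := ih
      obtain ⟨w', u'', h₁', h₂', h₃'⟩ := exists_eq_add_of_shiftDer_eq_zero v h₂
      refine ⟨w + w', u'', by rw [map_add, add_assoc, ← h₁', h₁], h₂', fun d hd x hx ↦ ?_⟩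
      rcases Finset.mem_insert.1 hx with rfl | hx
      · exact (h₃' d hd).2
      · exact h₃ d (h₃' d hd).1 x hx
  obtain ⟨w, u', h₁, h₂, h₃⟩ := key Finset.univ
  obtain ⟨c, rfl⟩ := mem_range_frobVar fun d hd v ↦ h₃ d hd v (Finset.mem_univ v)
  exact ⟨w, c, h₁⟩

lemma killVars_shiftEnd_pow {j : ℕ} (hj : j ≠ 0) (w : MvPolynomial (ι × Fin p) k) :
    killVars {s : ι × Fin p | 1 ≤ (s.2 : ℕ)} ((shiftEnd k p ι ^ j) w) = 0 := by
  obtain ⟨j, rfl⟩ := Nat.exists_eq_succ_of_ne_zero hj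
  rw [Nat.succ_eq_add_one, pow_succ', Module.End.mul_apply]
  exact killVars_shiftDer _

theorem exists_eq_shiftEnd_pow {u : MvPolynomial (ι × Fin p) k}
    (hu : killVars {s : ι × Fin p | 1 ≤ (s.2 : ℕ)} u = 0) {i : ℕ} (hi : i < p)
    (hdu : (shiftEnd k p ι ^ i) u = 0) : ∃ w, u = (shiftEnd k p ι ^ (p - i)) w := by
  let K : Submodule k (MvPolynomial (ι × Fin p) k) :=
    LinearMap.ker (killVars {s : ι × Fin p | 1 ≤ (s.2 : ℕ)}).toLinearMap
  have hK (f : MvPolynomial (ι × Fin p) k) :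
      f ∈ K ↔ killVars {s : ι × Fin p | 1 ≤ (s.2 : ℕ)} f = 0 := Iff.rfl
  have h1 : p - 1 ≠ 0 := by have := hp.out.one_lt; omega
  obtain ⟨w, -, hw⟩ := exists_sub_pow_mem (p := p) (shiftEnd k p ι) ⊥ K ⊤
    (fun x hx ↦ by rw [Submodule.mem_bot] at hx ⊢; rw [hx, map_zero]) le_top
    (fun x _ ↦ (hK _).2 (killVars_shiftDer x)) (fun x hx hdx ↦ by
      obtain ⟨w, c, h⟩ := exists_eq_shiftEnd_pow_add_frobVar ((Submodule.mem_bot k).1 hdx)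
      have h' := congrArg (killVars {s : ι × Fin p | 1 ≤ (s.2 : ℕ)}) h
      rw [(hK x).1 hx, map_add, killVars_shiftEnd_pow h1, zero_add, killVars_frobVar] at h'
      refine ⟨w, trivial, ?_⟩
      rw [Submodule.mem_bot, h, ← h', add_zero, sub_self]) i hi u ((hK u).2 hu)
    ((Submodule.mem_bot k).2 hdu)
  exact ⟨w, sub_eq_zero.1 ((Submodule.mem_bot k).1 hw)⟩

end TroeschExact

section SplicedSequences

universe r v

variable (k : Type r) [Field k] {A : Type u} [Category.{v} A] [Abelian A] [Linear k A]
  [HasExt.{w} A] {X : A} {Z M N M' : ℕ → A} {i : ∀ j, Z j ⟶ M j} {q : ∀ j, M j ⟶ N j}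
  {h₀ : ∀ j, i j ≫ q j = 0} (hS : ∀ j, (ShortComplex.mk (i j) (q j) (h₀ j)).ShortExact)
  {i' : ∀ j, N j ⟶ M' j} {q' : ∀ j, M' j ⟶ Z (j + 1)} {h₀' : ∀ j, i' j ≫ q' j = 0}
  (hS' : ∀ j, (ShortComplex.mk (i' j) (q' j) (h₀' j)).ShortExact)
  (hM' : ∀ j t, Subsingleton (Ext X (M' j) t))

include hS' hM'

omit [Linear k A] in
lemma subsingleton_ext_syzygy_zero (j : ℕ) : Subsingleton (Ext X (N j) 0) := by
  have := hM' j 0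
  exact subsingleton_ext₁_zero (X := X) (hS' j)

omit [Linear k A] in
lemma subsingleton_ext_syzygy_succ (j t : ℕ) (h : Subsingleton (Ext X (Z (j + 1)) t)) :
    Subsingleton (Ext X (N j) (t + 1)) := by
  have := hM' j (t + 1)
  have h' : Subsingleton (Ext X (ShortComplex.mk (i' j) (q' j) (h₀' j)).X₃ t) := h
  exact subsingleton_ext₁_succ (X := X) (hS' j) t

include hS

omit [Linear k A] in
lemma subsingleton_ext_of_spliced {m : ℕ} (hM : ∀ j, 1 ≤ j → j < m → ∀ t, Subsingleton (Ext X (M j) t))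
    {j : ℕ} (hj : 1 ≤ j) {t : ℕ} (ht : t + 2 * j < 2 * m) : Subsingleton (Ext X (Z j) t) := by
  obtain ⟨e, he⟩ : ∃ e, e + j = m := ⟨m - j, by omega⟩
  induction e generalizing j t with
  | zero => omega
  | succ e ih =>
    have hMj := hM j hj (by omega)
    have hMt : Subsingleton (Ext X (ShortComplex.mk (i j) (q j) (h₀ j)).X₂ t) := hMj t
    match t with
    | 0 => exact subsingleton_ext₁_zero (X := X) (hS j)
    | t + 1 =>
      have hN : Subsingleton (Ext X (ShortComplex.mk (i j) (q j) (h₀ j)).X₃ t) := by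
        match t with
        | 0 => exact subsingleton_ext_syzygy_zero hS' hM' j
        | t + 1 => exact subsingleton_ext_syzygy_succ hS' hM' j t (ih (by omega) (by omega) (by omega))
      exact subsingleton_ext₁_succ (X := X) (hS j) t

lemma push_injective_of_spliced {m : ℕ} (hM : ∀ j, 1 ≤ j → j < m → ∀ t, Subsingleton (Ext X (M j) t))
    {t : ℕ} (ht : t + 1 < 2 * m) : Function.Injective (push k X (i 0) (t + 1)) := by
  have hN : Subsingleton (Ext X (ShortComplex.mk (i 0) (q 0) (h₀ 0)).X₃ t) := by
    match t with
    | 0 => exact subsingleton_ext_syzygy_zero hS' hM' 0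
    | t + 1 =>
      exact subsingleton_ext_syzygy_succ hS' hM' 0 t
        (subsingleton_ext_of_spliced hS hS' hM' hM le_rfl (by omega))
  exact push_f_injective k (hS 0) t

/-- The ranks of the groups of extensions with values in the cycles of a complex. -/
lemma rank_ext_of_spliced {m n T : ℕ} (hm : 0 < m) (hmn : m ∣ n) (hn : 0 < n) {J : ℕ} (hJ : n ≤ J)
    (hZ : ∀ j, J ≤ j → ∀ t, Subsingleton (Ext X (Z j) t))
    (hM : ∀ j s, 2 * s ≤ T → Module.rank k (Ext X (M j) (2 * s)) =
      if m ∣ j ∧ j < n ∧ n ∣ s then 1 else 0)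
    (hM₁ : ∀ j s, 2 * s + 1 ≤ T → Subsingleton (Ext X (M j) (2 * s + 1))) (j s : ℕ) :
    (2 * s ≤ T → Module.rank k (Ext X (Z j) (2 * s)) =
      if m ∣ s + j ∧ j ≤ (s + j) % n then 1 else 0) ∧
    (2 * s + 1 ≤ T → Subsingleton (Ext X (Z j) (2 * s + 1))) := by
  rcases lt_or_ge j J with hjJ | hjJ
  swap
  · have hlt := Nat.mod_lt (s + j) hn
    have := hZ j hjJ
    refine ⟨fun _ ↦ ?_, fun _ ↦ this _⟩
    rw [if_neg fun h ↦ by omega]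
    exact rank_subsingleton' k _
  obtain ⟨e, he⟩ : ∃ e, e + j = J := ⟨J - j, by omega⟩
  clear hjJ
  induction e generalizing j s with
  | zero =>
    have hlt := Nat.mod_lt (s + j) hn
    have := hZ j (by omega)
    refine ⟨fun _ ↦ ?_, fun _ ↦ this _⟩
    rw [if_neg fun h ↦ by omega]
    exact rank_subsingleton' k _
  | succ e ih =>
    have hN (s : ℕ) (hs : 2 * s ≤ T) :
        Subsingleton (Ext X (ShortComplex.mk (i j) (q j) (h₀ j)).X₃ (2 * s)) := by
      match s with
      | 0 => exact subsingleton_ext_syzygy_zero hS' hM' j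
      | s + 1 => exact subsingleton_ext_syzygy_succ hS' hM' j _ ((ih (j + 1) s (by omega)).2 (by omega))
    refine ⟨fun hs ↦ ?_, fun hs ↦ ?_⟩
    · have hMj := hM j s hs
      match s with
      | 0 =>
        have := hN 0 hs
        have hb : Function.Bijective (push k X (ShortComplex.mk (i j) (q j) (h₀ j)).f 0) :=
          ⟨push_f_injective_zero k (hS j), push_f_surjective k (hS j) 0⟩
        refine (rank_ext_of_bijective k _ hb).trans (hMj.trans ?_)
        refine if_congr ?_ rfl rfl
        rw [zero_add]
        refine and_congr_right fun _ ↦ ⟨fun h ↦ (Nat.mod_eq_of_lt h.1).ge, fun h ↦ ?_⟩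
        exact ⟨h.trans_lt (Nat.mod_lt _ hn), dvd_zero n⟩
      | s + 1 =>
        have := hN (s + 1) hs
        have hMo : Subsingleton (Ext X (ShortComplex.mk (i j) (q j) (h₀ j)).X₂ (2 * s + 1)) :=
          hM₁ j s (by omega)
        have hN' : Subsingleton (Ext X (ShortComplex.mk (i j) (q j) (h₀ j)).X₃ (2 * s + 1 + 1)) := this
        have hr := rank_ext_add k (X := X) (hS j) (2 * s + 1)
        refine hr.symm.trans ?_
        have h₂ : Function.Bijective (conn k X (hS' j) (2 * s)) := by
          have h1 : Subsingleton (Ext X (ShortComplex.mk (i' j) (q' j) (h₀' j)).X₂ (2 * s)) := hM' j _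
          have h2 : Subsingleton (Ext X (ShortComplex.mk (i' j) (q' j) (h₀' j)).X₂ (2 * s + 1)) :=
            hM' j _
          exact ⟨conn_injective k (hS' j) _, conn_surjective k (hS' j) _⟩
        have h₃ := (rank_ext_of_bijective k _ h₂).symm
        have h₄ := (ih (j + 1) s (by omega)).1 (by omega)
        refine (congrArg₂ (· + ·) (h₃.trans h₄) hMj).trans ?_
        have hs' : s + 1 + j = s + (j + 1) := by omega
        rw [hs']
        have hlt := Nat.mod_lt (s + (j + 1)) hn
        have hd : n ∣ s + 1 ∧ j < n ↔ (s + (j + 1)) % n = j := by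
          constructor
          · rintro ⟨⟨c, hc⟩, hj⟩
            rw [← hs', hc, Nat.mul_add_mod, Nat.mod_eq_of_lt hj]
          · intro h
            refine ⟨?_, by omega⟩
            have := Nat.dvd_sub_mod (n := n) (s + (j + 1))
            rwa [h, ← hs', Nat.add_sub_cancel] at this
        by_cases h₅ : (s + (j + 1)) % n = j
        · have h₆ := hd.2 h₅
          rw [if_neg fun h ↦ by omega, zero_add]
          refine if_congr ?_ rfl rfl
          have h₇ : m ∣ j ↔ m ∣ s + (j + 1) := by
            rw [← hs']
            exact (Nat.dvd_add_right (hmn.trans h₆.1)).symm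
          rw [h₇, h₅]
          tauto
        · rw [if_neg (c := m ∣ j ∧ j < n ∧ n ∣ s + 1) fun h ↦ h₅ (hd.1 ⟨h.2.2, h.2.1⟩), add_zero]
          refine if_congr (and_congr_right fun _ ↦ ?_) rfl rfl
          omega
    · have := hN s (by omega)
      have hMo : Subsingleton (Ext X (ShortComplex.mk (i j) (q j) (h₀ j)).X₂ (2 * s + 1)) := hM₁ j s hs
      exact subsingleton_ext₁_succ (X := X) (hS j) _

end SplicedSequences

section TroeschHomogeneous

open MvPolynomial

/-- The bidegrees of the variables. -/
abbrev colorWt (p : ℕ) (i : Fin p) : ℕ × ℕ := (1, i)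

lemma weight_colorWt {p : ℕ} {ι : Type*} (d : ι × Fin p →₀ ℕ) :
    Finsupp.weight (fun s : ι × Fin p ↦ colorWt p s.2) d =
      (d.sum fun _ n ↦ n, d.sum fun s n ↦ n * s.2) := by
  rw [Finsupp.weight_apply, Finsupp.sum, Finsupp.sum, Finsupp.sum]
  refine Prod.ext ?_ ?_
  · rw [Prod.fst_sum]
    exact Finset.sum_congr rfl fun s _ ↦ mul_one _
  · rw [Prod.snd_sum]
    rfl

variable {k : Type*} [Field k] {p : ℕ} {ι : Type*}

lemma isWeightedHomogeneous_shiftDer_X (s : ι × Fin p) :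
    IsWeightedHomogeneous (fun s : ι × Fin p ↦ colorWt p s.2) (shiftDer k p ι (X s))
      (colorWt p s.2 + (0, 1)) := by
  rw [shiftDer_X]
  exact isWeightedHomogeneous_extVar k fun _ ↦ rfl

lemma isWeightedHomogeneous_colorWt_shiftEnd_pow {n w : ℕ} (a : ℕ) {f : MvPolynomial (ι × Fin p) k}
    (hf : IsWeightedHomogeneous (fun s : ι × Fin p ↦ colorWt p s.2) f (n, w)) :
    IsWeightedHomogeneous (fun s : ι × Fin p ↦ colorWt p s.2) ((shiftEnd k p ι ^ a) f) (n, w + a) := by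
  induction a with
  | zero => exact hf
  | succ a ih =>
    rw [pow_succ', Module.End.mul_apply]
    exact isWeightedHomogeneous_derivation _ isWeightedHomogeneous_shiftDer_X ih

lemma component_shiftEnd_pow (n w a : ℕ) (f : MvPolynomial (ι × Fin p) k) :
    weightedHomogeneousComponent (fun s : ι × Fin p ↦ colorWt p s.2) (n, w + a)
      ((shiftEnd k p ι ^ a) f) = (shiftEnd k p ι ^ a)
        (weightedHomogeneousComponent (fun s : ι × Fin p ↦ colorWt p s.2) (n, w) f) := by
  induction a with
  | zero => rfl
  | succ a ih =>
    rw [pow_succ', Module.End.mul_apply, Module.End.mul_apply, ← ih]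
    exact weightedHomogeneousComponent_derivation _ isWeightedHomogeneous_shiftDer_X _ (n, w + a)

lemma isWeightedHomogeneous_frobVar_X [hp : Fact p.Prime] (s : ι × Unit) :
    IsWeightedHomogeneous (fun s : ι × Fin p ↦ colorWt p s.2) (frobVar k p ι (X s)) (p, 0) := by
  rw [frobVar_X]
  have h : IsWeightedHomogeneous (fun s : ι × Fin p ↦ colorWt p s.2) (extVar k s.1 0) (1, 0) :=
    isWeightedHomogeneous_extVar k fun _ ↦ rfl
  simpa using h.pow p

lemma isWeightedHomogeneous_frobVar [hp : Fact p.Prime] {n : ℕ} {f : MvPolynomial (ι × Unit) k}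
    (hf : IsWeightedHomogeneous (fun _ ↦ (1 : ℕ)) f n) :
    IsWeightedHomogeneous (fun s : ι × Fin p ↦ colorWt p s.2) (frobVar k p ι f) (p * n, 0) := by
  have := isWeightedHomogeneous_algHom (w' := fun s : ι × Fin p ↦ colorWt p s.2)
    ((AddMonoidHom.inl ℕ ℕ).comp (nsmulAddMonoidHom p)) (frobVar k p ι) (fun s ↦ ?_) hf
  · simpa using this
  · simpa using isWeightedHomogeneous_frobVar_X s

lemma eq_zero_of_isWeightedHomogeneous_colorWt {n w : ℕ} (h : (p - 1) * n < w)
    {f : MvPolynomial (ι × Fin p) k}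
    (hf : IsWeightedHomogeneous (fun s : ι × Fin p ↦ colorWt p s.2) f (n, w)) : f = 0 := by
  ext d
  by_contra hd
  have h₁ := hf hd
  rw [weight_colorWt, Prod.mk.injEq] at h₁
  have h₂ : (d.sum fun s n ↦ n * (s.2 : ℕ)) ≤ d.sum fun _ n ↦ n * (p - 1) :=
    Finset.sum_le_sum fun s _ ↦ Nat.mul_le_mul_left _ (by omega)
  rw [Finsupp.sum, Finsupp.sum, ← Finset.sum_mul] at h₂
  rw [Finsupp.sum, Finsupp.sum] at h₁
  rw [h₁.1, h₁.2, mul_comm] at h₂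
  omega

variable [hp : Fact p.Prime] [CharP k p] [DecidableEq ι] [Fintype ι]

lemma exists_eq_shiftEnd_pow_of_isWeightedHomogeneous {n w a b : ℕ} (hab : a + b = p) (ha : 0 < a)
    (hb : 0 < b) {u : MvPolynomial (ι × Fin p) k}
    (hu : IsWeightedHomogeneous (fun s : ι × Fin p ↦ colorWt p s.2) u (n, w + b))
    (hdu : (shiftEnd k p ι ^ a) u = 0) :
    ∃ u', IsWeightedHomogeneous (fun s : ι × Fin p ↦ colorWt p s.2) u' (n, w) ∧
      u = (shiftEnd k p ι ^ b) u' := by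
  have hk : killVars {s : ι × Fin p | 1 ≤ (s.2 : ℕ)} u = 0 := by
    ext d
    rw [coeff_killVars]
    split_ifs with h
    · by_contra hd
      have h₁ := hu hd
      rw [weight_colorWt, Prod.mk.injEq] at h₁
      have h₂ : (d.sum fun s n ↦ n * (s.2 : ℕ)) = 0 := Finset.sum_eq_zero fun s _ ↦ by
        rcases Nat.eq_zero_or_pos (s.2 : ℕ) with hs | hs
        · exact (congrArg _ hs).trans (mul_zero _)
        · exact (congrArg (· * (s.2 : ℕ)) (h s hs)).trans (zero_mul _)
      omega
    · exact (coeff_zero d).symm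
  obtain ⟨x, hx⟩ := exists_eq_shiftEnd_pow hk (i := a) (by omega) hdu
  refine ⟨_, weightedHomogeneousComponent_isWeightedHomogeneous (n, w) x, ?_⟩
  rw [← component_shiftEnd_pow, show b = p - a by omega, ← hx, show p - a = b by omega]
  exact (weightedHomogeneousComponent_eq_self hu).symm

lemma exists_eq_frobVar_of_isWeightedHomogeneous {n : ℕ} {u : MvPolynomial (ι × Fin p) k}
    (hu : IsWeightedHomogeneous (fun s : ι × Fin p ↦ colorWt p s.2) u (p * n, 0))
    (hdu : shiftDer k p ι u = 0) :
    ∃ c, IsWeightedHomogeneous (fun _ ↦ (1 : ℕ)) c n ∧ u = frobVar k p ι c := by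
  have hk : killVars {s : ι × Fin p | 1 ≤ (s.2 : ℕ)} u = u := killVars_eq_self fun d hd s hs ↦ by
    have h₁ := hu hd
    rw [weight_colorWt, Prod.mk.injEq, Finsupp.sum, Finsupp.sum, Finset.sum_eq_zero_iff] at h₁
    by_contra h₂
    have h₃ := h₁.2 s (Finsupp.mem_support_iff.2 h₂)
    have h₄ : 1 ≤ (s.2 : ℕ) := hs
    rcases Nat.mul_eq_zero.1 h₃ with h | h
    · exact h₂ h
    · omega
  obtain ⟨w, c, h⟩ := exists_eq_shiftEnd_pow_add_frobVar hdu
  have h1 : p - 1 ≠ 0 := by have := hp.out.one_lt; omega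
  have h' := congrArg (killVars {s : ι × Fin p | 1 ≤ (s.2 : ℕ)}) h
  rw [hk, map_add, killVars_shiftEnd_pow h1, zero_add, killVars_frobVar] at h'
  have hc (m : ℕ) : weightedHomogeneousComponent (fun s : ι × Fin p ↦ colorWt p s.2) (p * m, 0) u =
      frobVar k p ι (weightedHomogeneousComponent (fun _ ↦ 1) m c) := by
    rw [h', weightedHomogeneousComponent_algHom (w := fun _ ↦ (p, 0)) _ isWeightedHomogeneous_frobVar_X]
    congr 1
    ext d
    rw [coeff_weightedHomogeneousComponent, coeff_weightedHomogeneousComponent]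
    refine if_congr ?_ rfl rfl
    rw [Finsupp.weight_apply, Finsupp.weight_apply, Finsupp.sum, Finsupp.sum, ← Finset.sum_smul,
      ← Finset.sum_smul, Prod.smul_mk, Prod.mk.injEq, smul_eq_mul, smul_eq_mul, smul_eq_mul, mul_zero,
      mul_one, mul_comm p]
    exact ⟨fun h ↦ Nat.eq_of_mul_eq_mul_right hp.out.pos h.1, fun h ↦ ⟨by rw [h], rfl⟩⟩
  refine ⟨_, weightedHomogeneousComponent_isWeightedHomogeneous n c, ?_⟩
  rw [← hc]
  exact (weightedHomogeneousComponent_eq_self hu).symm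

end TroeschHomogeneous

section TroeschFunctors

open MvPolynomial

variable (k : Type u) [Field k] (p : ℕ) [hp : Fact p.Prime] [Algebra (ZMod p) k]

variable {k p} in
lemma polySubst_extVar {V W : Mt (ZMod p)} (f : V ⟶ W) (v : V.ι) (n : ℕ) :
    polySubst k p (Fin p) f (extVar k v n) = ∑ w, Mt.mat f v w • extVar k w n := by
  rcases lt_or_ge n p with h | h
  · rw [extVar_of_lt k v h, polySubst_X]
    exact Finset.sum_congr rfl fun w _ ↦ by rw [extVar_of_lt k w h]
  · rw [extVar_of_le k v h, map_zero]
    refine (Finset.sum_eq_zero fun w _ ↦ ?_).symm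
    rw [extVar_of_le k w h, smul_zero]

variable {k p} in
lemma shiftDer_polySubst {V W : Mt (ZMod p)} (f : V ⟶ W) (x : MvPolynomial (V.ι × Fin p) k) :
    shiftDer k p W.ι (polySubst k p (Fin p) f x) = polySubst k p (Fin p) f (shiftDer k p V.ι x) := by
  refine eq_of_leibniz (polySubst k p (Fin p) f)
    ((shiftDer k p W.ι).toLinearMap ∘ₗ (polySubst k p (Fin p) f).toLinearMap)
    ((polySubst k p (Fin p) f).toLinearMap ∘ₗ (shiftDer k p V.ι).toLinearMap)
    (fun x y ↦ ?_) (fun x y ↦ ?_) (fun v ↦ ?_) x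
  · change shiftDer k p W.ι (polySubst k p (Fin p) f (x * y)) =
      shiftDer k p W.ι (polySubst k p (Fin p) f x) * polySubst k p (Fin p) f y +
        polySubst k p (Fin p) f x * shiftDer k p W.ι (polySubst k p (Fin p) f y)
    rw [map_mul, Derivation.leibniz, smul_eq_mul, smul_eq_mul]
    ring
  · change polySubst k p (Fin p) f (shiftDer k p V.ι (x * y)) =
      polySubst k p (Fin p) f (shiftDer k p V.ι x) * polySubst k p (Fin p) f y +
        polySubst k p (Fin p) f x * polySubst k p (Fin p) f (shiftDer k p V.ι y)
    rw [Derivation.leibniz, smul_eq_mul, smul_eq_mul, map_add, map_mul, map_mul]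
    ring
  · change shiftDer k p W.ι (polySubst k p (Fin p) f (X v)) =
      polySubst k p (Fin p) f (shiftDer k p V.ι (X v))
    rw [polySubst_X, shiftDer_X, polySubst_extVar, map_sum]
    refine Finset.sum_congr rfl fun w _ ↦ ?_
    refine ((shiftEnd k p W.ι).map_smul_of_tower (Mt.mat f v.1 w) (X (w, v.2))).trans ?_
    exact congrArg _ (shiftDer_X k (w, v.2))

variable {k p} in
lemma shiftEnd_pow_polySubst {V W : Mt (ZMod p)} (f : V ⟶ W) (a : ℕ) (x : MvPolynomial (V.ι × Fin p) k) :
    (shiftEnd k p W.ι ^ a) (polySubst k p (Fin p) f x) =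
      polySubst k p (Fin p) f ((shiftEnd k p V.ι ^ a) x) := by
  induction a generalizing x with
  | zero => rfl
  | succ a ih =>
    rw [pow_succ, pow_succ, Module.End.mul_apply, Module.End.mul_apply, ← ih]
    exact congrArg _ (shiftDer_polySubst f x)

/-- The powers of the shift, as natural transformations. -/
noncomputable def shiftNat (a : ℕ) : polyFun k p (Fin p) ⟶ polyFun k p (Fin p) :=
  homMk (fun V ↦ shiftEnd k p V.ι ^ a) fun f x ↦ shiftEnd_pow_polySubst f a x

/-- Polynomials in `p` families of variables, homogeneous of degree `n` and of weight `w`. -/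
noncomputable abbrev biFun (n w : ℕ) : Mt (ZMod p) ⥤ ModuleCat.{u} k := homFun k p (colorWt p) (n, w)

variable {k p}

/-- The powers of the shift between functors of homogeneous polynomials. -/
noncomputable def biShift (n : ℕ) {w w' : ℕ} (a : ℕ) (h : w' = w + a) :
    biFun k p n w ⟶ biFun k p n w' :=
  homMap (shiftNat k p a) fun V x hx ↦ h ▸ isWeightedHomogeneous_colorWt_shiftEnd_pow a hx

lemma hval_biShift {n w w' a : ℕ} (h : w' = w + a) {V : Mt (ZMod p)} (x : (biFun k p n w).obj V) :
    hval ((biShift n a h).app V x) = (shiftEnd k p V.ι ^ a) (hval x) := rfl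

variable (k p) in
/-- The kernels of the powers of the shift. -/
noncomputable abbrev biKer (n w a : ℕ) : Mt (ZMod p) ⥤ ModuleCat.{u} k :=
  (kerSubfun (biShift (k := k) (p := p) n a (Eq.refl (w + a)))).toFunctor

variable (k p) in
/-- The inclusion of the kernel of a power of the shift. -/
noncomputable abbrev biKerIncl (n w a : ℕ) : biKer k p n w a ⟶ biFun k p n w :=
  (kerSubfun (biShift (k := k) (p := p) n a (Eq.refl (w + a)))).ι

lemma charP_of_algebra_zmod (k : Type*) [Field k] (p : ℕ) [Fact p.Prime] [Algebra (ZMod p) k] :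
    CharP k p :=
  charP_of_injective_algebraMap (algebraMap (ZMod p) k).injective p

/-- The powers of the shift, with values in the kernel of the complementary power. -/
noncomputable def biCycle (n : ℕ) {w w' a b : ℕ} (hab : a + b = p) (h : w' = w + a) :
    biFun k p n w ⟶ biKer k p n w' b :=
  (kerSubfun (biShift n b rfl)).lift (biShift n a h) fun V x ↦ hval_injective (by
    have := charP_of_algebra_zmod k p
    change (shiftEnd k p V.ι ^ b) ((shiftEnd k p V.ι ^ a) (hval x)) = 0
    rw [← Module.End.mul_apply, ← pow_add, add_comm b, hab]
    exact shiftEnd_pow_char k _)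

lemma biKerIncl_biCycle (n : ℕ) {w w' a b : ℕ} (hab : a + b = p) (h : w' = w + a) :
    biKerIncl k p n w a ≫ biCycle n hab h = 0 := by
  subst h
  exact hom_ext_apply fun V x ↦ Subtype.ext
    ((kerSubfun (biShift (k := k) (p := p) n a (Eq.refl (w + a)))).ι_mem V x)

lemma shortExact_biCycle (n : ℕ) {w w' a b : ℕ} (hab : a + b = p) (ha : 0 < a) (hb : 0 < b)
    (h : w' = w + a) : (ShortComplex.mk _ _ (biKerIncl_biCycle (k := k) n hab h)).ShortExact := by
  have := charP_of_algebra_zmod k p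
  subst h
  refine (shortExact_iff _).2 ⟨Subfun.ι_injective _, fun V y ↦ ?_, fun V x hx ↦ ?_⟩
  · let y' : (biFun k p n (w + a)).obj V := (biKerIncl k p n (w + a) b).app V y
    have hy : (shiftEnd k p V.ι ^ b) (hval y') = 0 :=
      congrArg hval ((kerSubfun (biShift (k := k) (p := p) n b (Eq.refl (w + a + b)))).ι_mem V y)
    obtain ⟨x, hx, h⟩ := exists_eq_shiftEnd_pow_of_isWeightedHomogeneous ((add_comm b a).trans hab)
      hb ha (hval_mem y') hy
    exact ⟨hmk x hx, Subtype.ext (hval_injective h.symm)⟩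
  · exact ⟨⟨x, congrArg (biKerIncl k p n (w + a) b |>.app V) hx⟩, rfl⟩

lemma subsingleton_biFun_obj {n w : ℕ} (h : (p - 1) * n < w) (V : Mt (ZMod p)) :
    Subsingleton ((biFun k p n w).obj V) :=
  subsingleton_of_forall_eq 0 fun x ↦ hval_injective
    (eq_zero_of_isWeightedHomogeneous_colorWt h (hval_mem x))

variable (k p) in
/-- The Frobenius morphism with values in the first family of variables. -/
noncomputable def frobVarNat : polyFun k p Unit ⟶ polyFun k p (Fin p) :=
  algNat (fun V ↦ frobVar k p V.ι) fun {V W} f v ↦ by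
    have := charP_of_algebra_zmod k p
    have : CharP (MvPolynomial (W.ι × Fin p) k) p :=
      charP_of_injective_algebraMap (algebraMap (ZMod p) (MvPolynomial (W.ι × Fin p) k)).injective p
    rw [polySubst_X, frobVar_X, map_sum, map_pow, polySubst_extVar, sum_pow_char]
    refine Finset.sum_congr rfl fun w _ ↦ ?_
    refine (map_zmod_smul (frobVar k p W.ι).toRingHom (Mt.mat f v.1 w) (X (w, v.2))).trans ?_
    change _ • frobVar k p W.ι (X (w, v.2)) = _
    rw [frobVar_X, Algebra.smul_def, Algebra.smul_def, mul_pow, ← map_pow, ZMod.pow_card]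

/-- The Frobenius morphism to homogeneous polynomials of weight zero. -/
noncomputable def biFrob {n m : ℕ} (h : m = p * n) : symFun k p n ⟶ biFun k p m 0 :=
  homMap (frobVarNat k p) fun V f hf ↦ h ▸ isWeightedHomogeneous_frobVar hf

variable (k) in
/-- The inclusion of the variables of color `i`. -/
noncomputable def colorHom (ι : Type*) (i : Fin p) :
    MvPolynomial (ι × Unit) k →ₐ[k] MvPolynomial (ι × Fin p) k := aeval fun v ↦ X (v.1, i)

variable (k) in
/-- The projection to the variables of color `i`. -/
noncomputable def uncolorHom (ι : Type*) (i : Fin p) :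
    MvPolynomial (ι × Fin p) k →ₐ[k] MvPolynomial (ι × Unit) k :=
  aeval fun v ↦ if v.2 = i then X (v.1, ()) else 0

omit hp [Algebra (ZMod p) k] in
lemma colorHom_X {ι : Type*} (i : Fin p) (v : ι × Unit) : colorHom k ι i (X v) = X (v.1, i) :=
  aeval_X _ _

omit hp [Algebra (ZMod p) k] in
lemma uncolorHom_X {ι : Type*} (i : Fin p) (v : ι × Fin p) :
    uncolorHom k ι i (X v) = if v.2 = i then X (v.1, ()) else 0 :=
  aeval_X _ _

variable (k p) in
/-- The inclusion of the variables of color `i`, as a natural transformation. -/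
noncomputable def colorNat (i : Fin p) : polyFun k p Unit ⟶ polyFun k p (Fin p) :=
  algNat (fun V ↦ colorHom k V.ι i) fun {V W} f v ↦ by
    rw [colorHom_X, polySubst_X, polySubst_X, map_sum]
    refine Finset.sum_congr rfl fun w _ ↦ ?_
    refine (map_zmod_smul (colorHom k W.ι i).toRingHom (Mt.mat f v.1 w) (X (w, v.2))).trans ?_
    exact congrArg _ (colorHom_X _ _)

variable (k p) in
/-- The projection to the variables of color `i`, as a natural transformation. -/
noncomputable def uncolorNat (i : Fin p) : polyFun k p (Fin p) ⟶ polyFun k p Unit :=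
  algNat (fun V ↦ uncolorHom k V.ι i) fun {V W} f v ↦ by
    rw [uncolorHom_X, polySubst_X, map_sum]
    have (w : W.ι) : uncolorHom k W.ι i (Mt.mat f v.1 w • X (w, v.2)) =
        Mt.mat f v.1 w • if v.2 = i then (X (w, ()) : MvPolynomial _ k) else 0 := by
      refine (map_zmod_smul (uncolorHom k W.ι i).toRingHom (Mt.mat f v.1 w) (X (w, v.2))).trans ?_
      exact congrArg _ (uncolorHom_X _ _)
    rw [Finset.sum_congr rfl fun w _ ↦ this w]
    split_ifs
    · rw [polySubst_X]
    · rw [map_zero]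
      exact Finset.sum_eq_zero fun w _ ↦ smul_zero _

/-- The inclusion of the homogeneous polynomials in the variables of color `i`. -/
noncomputable def biColor (i : Fin p) {n w : ℕ} (h : w = n * i) : symFun k p n ⟶ biFun k p n w :=
  homMap (colorNat k p i) fun V f hf ↦ h ▸
    isWeightedHomogeneous_algHom (w := fun _ ↦ 1) (w' := fun s : V.ι × Fin p ↦ colorWt p s.2)
      ((AddMonoidHom.id ℕ).prod (AddMonoidHom.mulRight (i : ℕ))) (colorHom k V.ι i) (fun s ↦ by
        rw [colorHom_X]
        simpa using isWeightedHomogeneous_X k (fun s : V.ι × Fin p ↦ colorWt p s.2) (s.1, i)) hf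

/-- The projection to the homogeneous polynomials in the variables of color `i`. -/
noncomputable def biUncolor (i : Fin p) (n w : ℕ) : biFun k p n w ⟶ symFun k p n :=
  homMap (uncolorNat k p i) fun V f hf ↦
    isWeightedHomogeneous_algHom (w := fun _ ↦ 1) (w' := fun _ ↦ 1) (m := n) (AddMonoidHom.id ℕ)
      (uncolorHom k V.ι i) (fun s ↦ by
        rw [uncolorHom_X]
        split_ifs
        · exact isWeightedHomogeneous_X _ _ _
        · exact isWeightedHomogeneous_zero _ _ _) fun d hd ↦ by
      have := hf hd
      rw [weight_colorWt, Prod.mk.injEq] at this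
      rw [← this.1, Finsupp.weight_apply]
      simp

lemma biColor_biUncolor (i : Fin p) {n w : ℕ} (h : w = n * i) :
    biColor (k := k) i h ≫ biUncolor i n w = 𝟙 _ := hom_ext_apply fun V x ↦ hval_injective (by
  refine AlgHom.congr_fun (φ₁ := (uncolorHom k V.ι i).comp (colorHom k V.ι i)) (φ₂ := AlgHom.id k _)
    (algHom_ext fun s ↦ ?_) (hval x)
  rw [AlgHom.comp_apply, colorHom_X, uncolorHom_X, if_pos rfl]
  rfl)

lemma biFrob_biUncolor {n m : ℕ} (h : m = p * n) :
    biFrob (k := k) h ≫ biUncolor ⟨0, hp.out.pos⟩ m 0 = frob k h :=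
  hom_ext_apply fun V x ↦ hval_injective (by
  refine AlgHom.congr_fun (φ₁ := (uncolorHom k V.ι ⟨0, hp.out.pos⟩).comp (frobVar k p V.ι))
    (φ₂ := expand p) (algHom_ext fun s ↦ ?_) (hval x)
  rw [AlgHom.comp_apply, frobVar_X, map_pow, extVar_of_lt k _ hp.out.pos, uncolorHom_X, if_pos rfl,
    expand_X])

end TroeschFunctors

section MultidegreeDecomposition

open MvPolynomial

variable (k : Type u) [Field k] (p : ℕ) [hp : Fact p.Prime] [Algebra (ZMod p) k]

/-- The multidegree of a color. -/
noncomputable abbrev multiWt (p : ℕ) (i : Fin p) : Fin p →₀ ℕ := Finsupp.single i 1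

lemma weight_colorWt_eq {p : ℕ} {ι : Type*} (d : ι × Fin p →₀ ℕ) :
    Finsupp.weight (fun s : ι × Fin p ↦ colorWt p s.2) d =
      Finsupp.weight (colorWt p) (Finsupp.weight (fun s : ι × Fin p ↦ multiWt p s.2) d) := by
  rw [Finsupp.weight_apply, Finsupp.weight_apply (fun s : ι × Fin p ↦ multiWt p s.2), Finsupp.sum,
    Finsupp.sum, map_sum]
  refine Finset.sum_congr rfl fun s _ ↦ ?_
  rw [map_nsmul, Finsupp.weight_single, one_smul]

lemma weight_colorWt_univ {p : ℕ} (d : Fin p →₀ ℕ) :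
    Finsupp.weight (colorWt p) d = (∑ i, d i, ∑ i, d i * (i : ℕ)) := by
  rw [Finsupp.weight_apply, Finsupp.sum_fintype d (fun i c ↦ c • colorWt p i) fun _ ↦ zero_smul ℕ _]
  refine Prod.ext ?_ ?_
  · rw [Prod.fst_sum]
    simp
  · rw [Prod.snd_sum]
    simp

/-- The projection to the component of given multidegree. -/
noncomputable def multiProj (n w : ℕ) (d : Fin p →₀ ℕ) : biFun k p n w ⟶ biFun k p n w :=
  homIncl k p (colorWt p) (n, w) ≫ homComp k p (multiWt p) d ≫ homIncl k p (multiWt p) d ≫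
    homComp k p (colorWt p) (n, w)

variable {k p}

open Classical in
lemma coeff_hval_multiProj {n w : ℕ} (d : Fin p →₀ ℕ) {V : Mt (ZMod p)} (x : (biFun k p n w).obj V)
    (e : V.ι × Fin p →₀ ℕ) : coeff e (hval ((multiProj k p n w d).app V x)) =
      if Finsupp.weight (fun s : V.ι × Fin p ↦ multiWt p s.2) e = d then coeff e (hval x) else 0 := by
  change coeff e (weightedHomogeneousComponent (fun s : V.ι × Fin p ↦ colorWt p s.2) (n, w)
    (weightedHomogeneousComponent (fun s : V.ι × Fin p ↦ multiWt p s.2) d (hval x))) = _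
  rw [coeff_weightedHomogeneousComponent, coeff_weightedHomogeneousComponent]
  split_ifs with h₁ h₂ h₂
  · rfl
  · rfl
  · exact ((hval_mem x).coeff_eq_zero e h₁).symm
  · rfl

lemma multiProj_single_of_ne {n w : ℕ} {i : Fin p} (h : w ≠ n * i) :
    multiProj k p n w (Finsupp.single i n) = 0 := hom_ext_apply fun V x ↦ hval_injective (by
  ext e
  rw [coeff_hval_multiProj]
  split_ifs with he
  · refine (hval_mem x).coeff_eq_zero e fun h' ↦ h ?_
    rw [weight_colorWt_eq, he, Finsupp.weight_single] at h'
    simpa using (congrArg Prod.snd h').symm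
  · rfl)

lemma sum_multiProj (n w : ℕ) :
    ∑ d ∈ Finset.finsuppAntidiag (Finset.univ : Finset (Fin p)) n, multiProj k p n w d = 𝟙 _ := by
  classical
  refine hom_ext_apply fun V x ↦ hval_injective ?_
  let φ : (biFun k p n w ⟶ biFun k p n w) →+ MvPolynomial (V.ι × Fin p) k :=
    { toFun f := hval (f.app V x)
      map_zero' := rfl
      map_add' _ _ := rfl }
  change φ (∑ d ∈ _, _) = hval x
  rw [map_sum]
  ext e
  rw [coeff_sum]
  refine (Finset.sum_congr rfl fun d _ ↦ coeff_hval_multiProj d x e).trans ?_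
  rw [Finset.sum_ite_eq]
  split_ifs with h
  · rfl
  · refine ((hval_mem x).coeff_eq_zero e fun h' ↦ h ?_).symm
    rw [weight_colorWt_eq, weight_colorWt_univ] at h'
    exact Finset.mem_finsuppAntidiag.2 ⟨congrArg Prod.fst h', Finset.subset_univ _⟩

lemma multiProj_single {n w : ℕ} {i : Fin p} (h : w = n * i) :
    multiProj k p n w (Finsupp.single i n) = biUncolor i n w ≫ biColor i h :=
  hom_ext_apply fun V x ↦ hval_injective (by
  classical
  have key : (colorHom k V.ι i).comp (uncolorHom k V.ι i) = killVars {s | s.2 ≠ i} :=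
    algHom_ext fun s ↦ by
      rw [AlgHom.comp_apply, uncolorHom_X]
      split_ifs with hs
      · rw [killVars_X_of_notMem (by simpa using hs), colorHom_X, ← hs]
      · rw [killVars_X_of_mem (by simpa using hs), map_zero]
  refine Eq.trans ?_ (AlgHom.congr_fun key (hval x)).symm
  ext e
  rw [coeff_hval_multiProj, coeff_killVars]
  by_cases he : coeff e (hval x) = 0
  · rw [he, ite_self, ite_self]
  have h₁ := hval_mem x he
  rw [weight_colorWt, Prod.mk.injEq] at h₁
  suffices h₀ : Finsupp.weight (fun s : V.ι × Fin p ↦ multiWt p s.2) e = Finsupp.single i n ↔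
      ∀ s ∈ {s : V.ι × Fin p | s.2 ≠ i}, e s = 0 by
    by_cases h₂ : Finsupp.weight (fun s : V.ι × Fin p ↦ multiWt p s.2) e = Finsupp.single i n
    · rw [if_pos h₂, if_pos (h₀.1 h₂)]
    · rw [if_neg h₂, if_neg fun h₃ ↦ h₂ (h₀.2 h₃)]
  rw [Finsupp.weight_apply]
  constructor
  · intro h₂ s hs
    have h₃ := DFunLike.congr_fun h₂ s.2
    rw [Finsupp.single_eq_of_ne hs, Finsupp.sum, Finsupp.finsetSum_apply,
      Finset.sum_eq_zero_iff] at h₃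
    by_contra h₄
    simpa [h₄] using h₃ s (Finsupp.mem_support_iff.2 h₄)
  · intro h₂
    rw [← h₁.1, Finsupp.sum, Finsupp.sum, Finsupp.single_finsetSum]
    refine Finset.sum_congr rfl fun s hs ↦ ?_
    have : s.2 = i := by
      by_contra h₃
      exact Finsupp.mem_support_iff.1 hs (h₂ s h₃)
    rw [this, Finsupp.smul_single, smul_eq_mul, mul_one])

variable [HasExt.{w} (Mt (ZMod p) ⥤ ModuleCat.{u} k)]
  (Y : Mt (ZMod p) ⥤ ModuleCat.{u} k) [Y.Additive]

lemma subsingleton_ext_multi {d : Fin p →₀ ℕ} {i j : Fin p} (hij : i ≠ j) (hi : d i ≠ 0)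
    (hj : d j ≠ 0) (t : ℕ) : Subsingleton (Ext Y (homFun k p (multiWt p) d) t) := by
  classical
  let χ (a : Fin p → Polynomial k) : Multiplicative (Fin p →₀ ℕ) →* Polynomial k :=
    { toFun d := ∏ c, a c ^ (Multiplicative.toAdd d) c
      map_one' := by simp
      map_mul' d e := by simp [pow_add, Finset.prod_mul_distrib] }
  have hχ (a : Fin p → Polynomial k) (c : Fin p) : χ a (Multiplicative.ofAdd (multiWt p c)) = a c := by
    change ∏ c', a c' ^ (Finsupp.single c 1) c' = _
    rw [Finset.prod_eq_single c]
    · simp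
    · intro b _ hb
      simp [Finsupp.single_eq_of_ne hb]
    · simp
  have hχ₀ (a : Fin p → Polynomial k) (c : Fin p) (ha : a c = 0) (hc : d c ≠ 0) :
      χ a (Multiplicative.ofAdd d) = 0 := Finset.prod_eq_zero (Finset.mem_univ c) (by
    rw [ha]
    exact zero_pow hc)
  refine subsingleton_ext_homFun (fun c ↦ if c = i then 1 else 0) (fun c ↦ if c = i then 0 else 1)
    (multiWt p) d Y 1 _ _ (fun c ↦ ?_) (hχ _) (hχ _) 0 ?_ ?_ ?_ t
  · split_ifs <;> simp
  · simp
  · rw [hχ₀ _ j (if_neg hij.symm) hj, Polynomial.coeff_zero]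
  · rw [hχ₀ _ i (if_pos rfl) hi, Polynomial.coeff_zero]

lemma push_multiProj_eq_zero {n w : ℕ} (hn : 0 < n) {d : Fin p →₀ ℕ}
    (hd : d ∈ Finset.finsuppAntidiag (Finset.univ : Finset (Fin p)) n)
    (h : ∀ i : Fin p, w = n * i → d ≠ Finsupp.single i n) (t : ℕ) (x : Ext Y (biFun k p n w) t) :
    push k Y (multiProj k p n w d) t x = 0 := by
  by_cases hd' : ∃ i j, i ≠ j ∧ d i ≠ 0 ∧ d j ≠ 0
  · obtain ⟨i, j, hij, hi, hj⟩ := hd'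
    have := subsingleton_ext_multi (k := k) Y hij hi hj t
    rw [multiProj, push_comp, push_comp, Subsingleton.elim (push k Y (homComp k p _ d) t _) 0,
      map_zero]
  · push Not at hd'
    have hsum := (Finset.mem_finsuppAntidiag.1 hd).1
    obtain ⟨i, hi⟩ : ∃ i, d i ≠ 0 := by
      by_contra! h₀
      simp [h₀] at hsum
      omega
    have hdi : d = Finsupp.single i n := by
      ext j
      rw [Finset.sum_eq_single i (fun j _ hj ↦ hd' i j hj.symm hi) (by simp)] at hsum
      rcases eq_or_ne j i with rfl | hj
      · rw [Finsupp.single_eq_same, hsum]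
      · rw [Finsupp.single_eq_of_ne hj, hd' i j hj.symm hi]
    rw [hdi, multiProj_single_of_ne fun hw ↦ h i hw hdi, push_zero]

lemma subsingleton_ext_biFun {n w : ℕ} (hn : 0 < n) (h : ∀ i : Fin p, w ≠ n * i) (t : ℕ) :
    Subsingleton (Ext Y (biFun k p n w) t) :=
  subsingleton_of_forall_eq 0 fun x ↦ by
    rw [← push_id k Y t x, ← sum_multiProj n w, push_sum]
    exact Finset.sum_eq_zero fun d hd ↦
      push_multiProj_eq_zero Y hn hd (fun i hi ↦ absurd hi (h i)) t x

lemma push_biUncolor_bijective {n w : ℕ} (hn : 0 < n) {i : Fin p} (h : w = n * i) (t : ℕ) :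
    Function.Bijective (push k Y (biUncolor i n w) t) := by
  refine Function.bijective_iff_has_inverse.2 ⟨push k Y (biColor i h) t, fun x ↦ ?_, fun x ↦ ?_⟩
  · rw [← push_comp, ← multiProj_single h]
    conv_rhs => rw [← push_id k Y t x, ← sum_multiProj n w, push_sum]
    refine (Finset.sum_eq_single _ (fun d hd hne ↦ push_multiProj_eq_zero Y hn hd
      (fun j hj hdj ↦ hne ?_) t x) fun hi ↦ (hi ?_).elim).symm
    · rw [hdj, Fin.ext (Nat.eq_of_mul_eq_mul_left hn (hj.symm.trans h))]
    · exact Finset.mem_finsuppAntidiag.2 ⟨by simp [Finsupp.single_apply], Finset.subset_univ _⟩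
  · rw [← push_comp, biColor_biUncolor, push_id]

end MultidegreeDecomposition

section SymmetricPowers

open MvPolynomial

variable {k : Type u} [Field k] {p : ℕ} [hp : Fact p.Prime] [Algebra (ZMod p) k]

omit [Algebra (ZMod p) k] in
lemma uncolorHom_frobVar {ι : Type*} (f : MvPolynomial (ι × Unit) k) :
    uncolorHom k ι ⟨0, hp.out.pos⟩ (frobVar k p ι f) = expand p f :=
  AlgHom.congr_fun (φ₁ := (uncolorHom k ι ⟨0, hp.out.pos⟩).comp (frobVar k p ι))
    (φ₂ := expand p) (algHom_ext fun s ↦ by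
      rw [AlgHom.comp_apply, frobVar_X, map_pow, extVar_of_lt k _ hp.out.pos, uncolorHom_X,
        if_pos rfl, expand_X]) f

/-- The Frobenius morphism with values in the kernel of the shift. -/
noncomputable def biFrobKer {n m : ℕ} (h : m = p * n) : symFun k p n ⟶ biKer k p m 0 1 :=
  (kerSubfun (biShift m 1 rfl)).lift (biFrob h) fun V x ↦ hval_injective (by
    have := charP_of_algebra_zmod k p
    exact shiftDer_frobVar (hval x))

lemma biFrobKer_incl {n m : ℕ} (h : m = p * n) :
    biFrobKer (k := k) h ≫ biKerIncl k p m 0 1 = biFrob h := rfl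

instance isIso_biFrobKer {n m : ℕ} (h : m = p * n) : IsIso (biFrobKer (k := k) h) := by
  have := charP_of_algebra_zmod k p
  have : Mono (biFrobKer (k := k) h) := (mono_iff_injective _).2 fun V x y hxy ↦
    hval_injective (expand_injective hp.out.pos (by
      rw [← uncolorHom_frobVar, ← uncolorHom_frobVar]
      exact congrArg (uncolorHom k V.ι ⟨0, hp.out.pos⟩)
        (congrArg hval (congrArg ((biKerIncl k p m 0 1).app V) hxy))))
  have : Epi (biFrobKer (k := k) h) := (epi_iff_surjective _).2 fun V y ↦ by
    subst h
    let y' : (biFun k p (p * n) 0).obj V := (biKerIncl k p (p * n) 0 1).app V y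
    have hy : shiftDer k p V.ι (hval y') = 0 :=
      congrArg hval ((kerSubfun (biShift (k := k) (p := p) (p * n) 1 (Eq.refl (0 + 1)))).ι_mem V y)
    obtain ⟨c, hc, h⟩ := exists_eq_frobVar_of_isWeightedHomogeneous (hval_mem y') hy
    exact ⟨hmk c hc, Subtype.ext (hval_injective h.symm)⟩
  exact isIso_of_mono_of_epi _

lemma subsingleton_ext_of_obj [HasExt.{w} (Mt (ZMod p) ⥤ ModuleCat.{u} k)]
    (Y : Mt (ZMod p) ⥤ ModuleCat.{u} k) {F : Mt (ZMod p) ⥤ ModuleCat.{u} k}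
    (h : ∀ V, Subsingleton (F.obj V)) (t : ℕ) : Subsingleton (Ext Y F t) :=
  subsingleton_of_forall_eq 0 fun x ↦ by
    have : 𝟙 F = 0 := hom_ext_apply fun V x ↦ Subsingleton.elim _ _
    rw [← push_id k Y t x, this, push_zero]

lemma shortExact_biCycle_one (n j : ℕ) : (ShortComplex.mk _ _ (biKerIncl_biCycle (k := k) n
    (Nat.add_sub_cancel' hp.out.one_le) (Eq.refl (p * j + 1)))).ShortExact :=
  shortExact_biCycle n _ one_pos (Nat.sub_pos_of_lt hp.out.one_lt) _

lemma mul_succ_eq_of_pos (hp : 0 < p) (j : ℕ) : p * (j + 1) = p * j + 1 + (p - 1) := by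
  rw [mul_add, add_assoc, Nat.add_sub_cancel' hp, mul_one]

lemma shortExact_biCycle_sub_one (n j : ℕ) : (ShortComplex.mk _ _ (biKerIncl_biCycle (k := k) n
    (Nat.sub_add_cancel hp.out.one_le) (mul_succ_eq_of_pos hp.out.pos j))).ShortExact :=
  shortExact_biCycle n _ (Nat.sub_pos_of_lt hp.out.one_lt) one_pos _

variable [HasExt.{w} (Mt (ZMod p) ⥤ ModuleCat.{u} k)]

section

variable (Y : Mt (ZMod p) ⥤ ModuleCat.{u} k) [Y.Additive]

lemma subsingleton_ext_biFun_mul_add_one {n m : ℕ} (h : m = p * n) (hn : 0 < n) (j t : ℕ) :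
    Subsingleton (Ext Y (biFun k p m (p * j + 1)) t) :=
  subsingleton_ext_biFun Y (h ▸ Nat.mul_pos hp.out.pos hn) (fun i hi ↦ by
    have h₁ : p ∣ p * j + 1 := ⟨n * i, by rw [hi, h, mul_assoc]⟩
    exact hp.out.one_lt.ne' (Nat.dvd_one.1 ((Nat.dvd_add_right (dvd_mul_right p j)).1 h₁))) t

lemma subsingleton_ext_biFun_mul {n m : ℕ} (h : m = p * n) (hn : 0 < n) {j : ℕ}
    (hj : ¬ (n ∣ j ∧ j < m)) (t : ℕ) : Subsingleton (Ext Y (biFun k p m (p * j)) t) :=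
  subsingleton_ext_biFun Y (h ▸ Nat.mul_pos hp.out.pos hn) (fun i hi ↦ hj (by
    rw [h, mul_assoc] at hi
    have h₁ := Nat.eq_of_mul_eq_mul_left hp.out.pos hi
    rw [h₁, h, mul_comm p]
    exact ⟨dvd_mul_right _ _, Nat.mul_lt_mul_of_pos_left i.2 hn⟩)) t

lemma push_frob_injective {n m : ℕ} (h : m = p * n) (hn : 0 < n) {t : ℕ} (ht : t + 1 < 2 * n) :
    Function.Injective (push k Y (frob k h) (t + 1)) := by
  have h₁ := push_injective_of_spliced k (X := Y) (shortExact_biCycle_one (k := k) (p := p) m)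
    (shortExact_biCycle_sub_one m) (subsingleton_ext_biFun_mul_add_one Y h hn) (m := n)
    (fun j hj hjn ↦ subsingleton_ext_biFun_mul Y h hn fun h' ↦
      hjn.not_ge (Nat.le_of_dvd hj h'.1)) ht
  have h₂ := (push_biUncolor_bijective (k := k) (p := p) Y (h ▸ Nat.mul_pos hp.out.pos hn)
    (i := ⟨0, hp.out.pos⟩) (w := 0) rfl (t + 1)).injective
  have h₃ := (push_bijective_of_iso k (X := Y) (asIso (biFrobKer (k := k) h)) (t + 1)).injective
  rw [← biFrob_biUncolor, ← biFrobKer_incl]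
  intro x y hxy
  rw [push_comp, push_comp, push_comp, push_comp] at hxy
  exact h₃ (h₁ (h₂ hxy))

end

lemma subsingleton_ext_symFun_of_lt (h : ℕ) {t : ℕ} (ht : t + 1 < 2 * p ^ h) :
    Subsingleton (Ext (scalarFun k p) (symFun k p (p ^ h)) (t + 1)) :=
  subsingleton_ext_of_frob_injective p _ (scalarPt k p) scalarFun_hom_ext t h fun h' hh' ↦
    push_frob_injective _ _ (pow_pos hp.out.pos _) (ht.trans_le
      (Nat.mul_le_mul_left 2 (Nat.pow_le_pow_right hp.out.pos hh')))

lemma rank_ext_symFun_of_lt (e h T : ℕ) (hT : T < 2 * p ^ (h + e)) (s : ℕ) :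
    (2 * s ≤ T → Module.rank k (Ext (scalarFun k p) (symFun k p (p ^ h)) (2 * s)) =
      if p ^ h ∣ s then 1 else 0) ∧
    (2 * s + 1 ≤ T → Subsingleton (Ext (scalarFun k p) (symFun k p (p ^ h)) (2 * s + 1))) := by
  induction e generalizing h s with
  | zero =>
    rw [add_zero] at hT
    refine ⟨fun hs ↦ ?_, fun hs ↦ subsingleton_ext_symFun_of_lt h (by omega)⟩
    match s with
    | 0 => rw [if_pos (dvd_zero _)]; exact rank_ext_symFun_zero h
    | s + 1 =>
      have : Subsingleton (Ext (scalarFun k p) (symFun k p (p ^ h)) (2 * (s + 1))) :=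
        subsingleton_ext_symFun_of_lt h (t := 2 * s + 1) (by omega)
      rw [if_neg fun hd ↦ by have := Nat.le_of_dvd s.succ_pos hd; omega, rank_subsingleton' k _]
  | succ e ih =>
    have hq := pow_pos hp.out.pos h
    have hpq := pow_pos hp.out.pos (h + 1)
    have ih' := fun s ↦ ih (h + 1) (by rwa [add_assoc, add_comm 1]) s
    have hbij (j : ℕ) (hj : p ^ h ∣ j) (hj' : j < p ^ (h + 1)) (t : ℕ) :
        ∃ i : Fin p, Function.Bijective (push k (scalarFun k p)
          (biUncolor i (p ^ (h + 1)) (p * j)) t) := by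
      obtain ⟨i, rfl⟩ := hj
      rw [pow_succ] at hj'
      exact ⟨⟨i, lt_of_mul_lt_mul_left hj' hq.le⟩, push_biUncolor_bijective _ hpq
        (by rw [pow_succ', mul_assoc]) t⟩
    choose i hbij using hbij
    have key := rank_ext_of_spliced k (X := scalarFun k p)
      (shortExact_biCycle_one (k := k) (p := p) (p ^ (h + 1)))
      (shortExact_biCycle_sub_one (p ^ (h + 1)))
      (subsingleton_ext_biFun_mul_add_one _ (pow_succ' p h) hq) (m := p ^ h) (n := p ^ (h + 1))
      (T := T) hq (pow_dvd_pow p h.le_succ) hpq (J := p ^ (h + 1)) le_rfl (fun j hj t ↦ ?_)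
      (fun j s hs ↦ ?_) (fun j s hs ↦ ?_) 0 s
    · have h₃ := push_bijective_of_iso k (X := scalarFun k p)
        (asIso (biFrobKer (k := k) (pow_succ' p h)))
      refine ⟨fun hs ↦ ?_, fun hs ↦ ?_⟩
      · refine (rank_ext_of_bijective k _ (h₃ (2 * s))).trans ((key.1 hs).trans ?_)
        simp
      · have := key.2 hs
        exact (h₃ (2 * s + 1)).injective.subsingleton
    · refine subsingleton_ext_of_obj _ (fun V ↦ ?_) t
      have hlt : (p - 1) * p ^ (h + 1) < p * j :=
        (Nat.mul_lt_mul_of_pos_right (Nat.sub_lt hp.out.pos one_pos) hpq).trans_le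
          (Nat.mul_le_mul_left p hj)
      have := subsingleton_biFun_obj (k := k) hlt V
      exact (Subfun.ι_injective (kerSubfun (biShift (k := k) (p := p) (p ^ (h + 1)) 1
        (Eq.refl (p * j + 1)))) V).subsingleton
    · by_cases hj : p ^ h ∣ j ∧ j < p ^ (h + 1)
      · rw [rank_ext_of_bijective k _ (hbij j hj.1 hj.2 (2 * s)), (ih' s).1 hs]
        exact if_congr (by simp [hj.1, hj.2]) rfl rfl
      · have := subsingleton_ext_biFun_mul (scalarFun k p) (pow_succ' p h) hq hj (2 * s)
        rw [rank_subsingleton' k _, if_neg fun h' ↦ hj ⟨h'.1, h'.2.1⟩]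
    · by_cases hj : p ^ h ∣ j ∧ j < p ^ (h + 1)
      · have := (ih' s).2 hs
        exact (hbij j hj.1 hj.2 (2 * s + 1)).injective.subsingleton
      · exact subsingleton_ext_biFun_mul (scalarFun k p) (pow_succ' p h) hq hj _

end SymmetricPowers

section ScalarExtensions

open MvPolynomial

variable {k : Type u} [Field k] {p : ℕ} [hp : Fact p.Prime] [Algebra (ZMod p) k]

lemma coeff_powMap_zero {ι : Type} [Fintype ι] (x : ι → k) (v : ι) :
    coeff (Finsupp.single (v, ()) 1) (powMap (p := p) 0 ι x) = x v := by
  classical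
  rw [powMap_apply, coeff_sum, Finset.sum_eq_single v]
  · rw [coeff_smul, pow_zero, pow_one, coeff_X, if_pos rfl, smul_eq_mul, mul_one]
  · intro w _ hw
    rw [coeff_smul, pow_zero, pow_one, coeff_X, if_neg, smul_zero]
    intro h
    exact hw (congrArg Prod.fst ((Finsupp.single_left_inj one_ne_zero).1 h))
  · simp

lemma powMap_zero_coeff {ι : Type} [Fintype ι] {f : MvPolynomial (ι × Unit) k}
    (hf : IsWeightedHomogeneous (fun _ ↦ 1) f 1) :
    powMap (p := p) 0 ι (fun v ↦ coeff (Finsupp.single (v, ()) 1) f) = f := by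
  ext d
  by_cases hd : Finsupp.weight (fun _ : ι × Unit ↦ 1) d = 1
  · obtain ⟨⟨v, ⟨⟩⟩, rfl⟩ : ∃ v, d = Finsupp.single v 1 := by
      refine (Finsupp.sum_eq_one_iff d).1 (Eq.trans ?_ hd)
      rw [Finsupp.weight_apply]
      simp
    exact coeff_powMap_zero _ v
  · rw [hf.coeff_eq_zero d hd, IsWeightedHomogeneous.coeff_eq_zero (isWeightedHomogeneous_powMap 0 _)
      d (by rwa [pow_zero])]

instance isIso_powNat_zero : IsIso (powNat (k := k) (p := p) 0) := by
  have : Mono (powNat (k := k) (p := p) 0) := (mono_iff_injective _).2 fun V x y hxy ↦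
    funext fun v ↦ by
      have h := congrArg (coeff (Finsupp.single (v, ()) 1)) (congrArg hval hxy)
      exact (coeff_powMap_zero (p := p) _ v).symm.trans (h.trans (coeff_powMap_zero _ v))
  have : Epi (powNat (k := k) (p := p) 0) := (epi_iff_surjective _).2 fun V y ↦
    ⟨fun v ↦ coeff (Finsupp.single (v, ()) 1) (hval y), hval_injective (powMap_zero_coeff (hval_mem y))⟩
  exact isIso_of_mono_of_epi _

variable (k p) [HasExt.{w} (Mt (ZMod p) ⥤ ModuleCat.{u} k)]

lemma rank_ext_scalarFun_even (s : ℕ) :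
    Module.rank k (Ext (scalarFun k p) (scalarFun k p) (2 * s)) = 1 := by
  obtain ⟨e, he⟩ : ∃ e, 2 * s < 2 * p ^ (0 + e) := ⟨s, by
    have := Nat.lt_pow_self (n := s) hp.out.one_lt
    rw [zero_add]
    omega⟩
  rw [rank_ext_of_bijective k _ (push_bijective_of_iso k (asIso (powNat (k := k) (p := p) 0)) (2 * s))]
  refine ((rank_ext_symFun_of_lt e 0 _ he s).1 le_rfl).trans ?_
  simp

lemma subsingleton_ext_scalarFun_odd (s : ℕ) :
    Subsingleton (Ext (scalarFun k p) (scalarFun k p) (2 * s + 1)) := by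
  obtain ⟨e, he⟩ : ∃ e, 2 * s + 1 < 2 * p ^ (0 + e) := ⟨s, by
    have := Nat.lt_pow_self (n := s) hp.out.one_lt
    rw [zero_add]
    omega⟩
  have := (rank_ext_symFun_of_lt (k := k) e 0 _ he s).2 le_rfl
  exact (push_bijective_of_iso k (X := scalarFun k p) (asIso (powNat (k := k) (p := p) 0))
    (2 * s + 1)).injective.subsingleton

end ScalarExtensions

section FirstVariable

universe v r

variable (k : Type r) [Field k] {A : Type u} [Category.{v} A] [Abelian A] [Linear k A]
  [HasExt.{w} A]

lemma pull_conn {X Y : A} (f : X ⟶ Y) {S : ShortComplex A} (hS : S.ShortExact) (t : ℕ)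
    (x : Ext Y S.X₃ t) :
    pull k f S.X₁ (t + 1) (conn k Y hS t x) = conn k X hS t (pull k f S.X₃ t x) := by
  rw [pull_apply, conn_apply, conn_apply, pull_apply, Ext.comp_assoc _ _ _ _ _ (by lia)]

variable {S : ShortComplex A} (hS : S.ShortExact)

include hS in
lemma subsingleton_ext_of_pull_bijective (G : A)
    (h : ∀ t, Function.Bijective (pull k S.f G t)) (t : ℕ) : Subsingleton (Ext S.X₃ G t) := by
  refine subsingleton_of_forall_eq 0 fun x ↦ ?_
  have hx : pull k S.g G t x = 0 := (h t).1 (by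
    rw [map_zero, ← pull_comp, S.zero, pull_apply, Ext.mk₀_zero, Ext.zero_comp])
  cases t with
  | zero =>
    have := hS.epi_g
    obtain ⟨f, rfl⟩ := (Ext.mk₀_bijective _ _).2 x
    rw [pull_apply, Ext.mk₀_comp_mk₀] at hx
    have : S.g ≫ f = 0 := (Ext.mk₀_bijective _ _).1 (hx.trans (Ext.mk₀_zero _ _).symm)
    rw [(cancel_epi S.g).1 (this.trans Limits.comp_zero.symm), Ext.mk₀_zero]
  | succ t =>
    obtain ⟨y, rfl⟩ := Ext.contravariant_sequence_exact₃ hS G x hx (add_comm 1 t)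
    obtain ⟨z, rfl⟩ := (h t).2 y
    exact hS.extClass_comp_assoc z

include hS in
lemma pull_g_bijective (G : A) (h : ∀ t, Subsingleton (Ext S.X₁ G t)) (t : ℕ) :
    Function.Bijective (pull k S.g G t) := by
  refine ⟨(injective_iff_map_eq_zero _).2 fun x hx ↦ ?_, fun x ↦ ?_⟩
  · cases t with
    | zero =>
      have := hS.epi_g
      obtain ⟨f, rfl⟩ := (Ext.mk₀_bijective _ _).2 x
      rw [pull_apply, Ext.mk₀_comp_mk₀] at hx
      have : S.g ≫ f = 0 := (Ext.mk₀_bijective _ _).1 (hx.trans (Ext.mk₀_zero _ _).symm)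
      rw [(cancel_epi S.g).1 (this.trans Limits.comp_zero.symm), Ext.mk₀_zero]
    | succ t =>
      obtain ⟨y, rfl⟩ := Ext.contravariant_sequence_exact₃ hS G x hx (add_comm 1 t)
      rw [(h t).elim y 0, Ext.comp_zero]
  · exact Ext.contravariant_sequence_exact₂ hS G x ((h t).elim _ _)

variable [EnoughInjectives A]

/-- Endomorphisms of the identity functor act in the same way through both variables of `Ext`. -/
lemma pull_eq_push_of_natural (η : ∀ F : A, F ⟶ F)
    (hη : ∀ {F G : A} (f : F ⟶ G), η F ≫ f = f ≫ η G) (X F : A) (t : ℕ) (x : Ext X F t) :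
    pull k (η X) F t x = push k X (η F) t x := by
  induction t generalizing F with
  | zero =>
    obtain ⟨f, rfl⟩ := (Ext.mk₀_bijective _ _).2 x
    rw [pull_apply, Ext.mk₀_comp_mk₀, push_mk₀, hη]
  | succ t ih =>
    have hS := shortExact_cokernel (Injective.ι F)
    have := subsingleton_ext_of_injective (X := X) (Injective.under F) t
    obtain ⟨y, rfl⟩ := conn_surjective k hS t x
    refine (pull_conn k _ hS t y).trans ?_
    rw [ih]
    exact (conn_naturality k hS hS ⟨η _, η _, η _, hη _, hη _⟩ t y).symm

/-- Vanishing of a class on a coproduct is detected on the summands. -/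
lemma eq_zero_of_pull_eq_zero {J : Type*} {F : J → A} {T : A} (ι : ∀ j, F j ⟶ T)
    (hι : ∀ {G : A} (f g : T ⟶ G), (∀ j, ι j ≫ f = ι j ≫ g) → f = g)
    (hι' : ∀ {G : A} (f : ∀ j, F j ⟶ G), ∃ g : T ⟶ G, ∀ j, ι j ≫ g = f j)
    (G : A) (t : ℕ) (x : Ext T G t) (hx : ∀ j, pull k (ι j) G t x = 0) : x = 0 := by
  induction t generalizing G with
  | zero =>
    obtain ⟨f, rfl⟩ := (Ext.mk₀_bijective _ _).2 x
    have : f = 0 := hι _ _ fun j ↦ (Ext.mk₀_bijective _ _).1 (by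
      rw [Limits.comp_zero, Ext.mk₀_zero, ← hx j, pull_apply, Ext.mk₀_comp_mk₀])
    rw [this, Ext.mk₀_zero]
  | succ t ih =>
    have hS := shortExact_cokernel (Injective.ι G)
    have := subsingleton_ext_of_injective (X := T) (Injective.under G) t
    obtain ⟨y, rfl⟩ := conn_surjective k hS t x
    have H (j : J) := exists_push_g k hS t (pull k (ι j) _ t y) (by rw [← pull_conn]; exact hx j)
    cases t with
    | zero =>
      choose z hz using H
      choose f hf using fun j ↦ (Ext.mk₀_bijective _ _).2 (z j)
      obtain ⟨g, hg⟩ := hι' f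
      have : y = push k T (Limits.cokernel.π (Injective.ι G)) 0 (Ext.mk₀ g) := by
        refine sub_eq_zero.1 (ih _ _ fun j ↦ ?_)
        rw [map_sub, pull_push, pull_apply _ _ _ _ (Ext.mk₀ g), Ext.mk₀_comp_mk₀, hg, hf]
        exact sub_eq_zero.2 (hz j).symm
      rw [this]
      exact conn_push_g k hS 0 _
    | succ t =>
      rw [ih _ y fun j ↦ ?_, map_zero]
      obtain ⟨z, hz⟩ := H j
      rw [← hz, (subsingleton_ext_of_injective (Injective.under G) t).elim z 0, map_zero]

include k in
/-- Dimension shifting. -/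
lemma exists_cosyzygy (F : A) (t : ℕ) :
    ∃ G : A, ∀ Y : A, Subsingleton (Ext Y F (t + 1)) ↔ Subsingleton (Ext Y G 1) := by
  induction t generalizing F with
  | zero => exact ⟨F, fun _ ↦ Iff.rfl⟩
  | succ t ih =>
    have hS := shortExact_cokernel (Injective.ι F)
    obtain ⟨G, hG⟩ := ih (Limits.cokernel (Injective.ι F))
    refine ⟨G, fun Y ↦ Iff.trans ?_ (hG Y)⟩
    have h₁ : Subsingleton (Ext Y (Injective.under F) (t + 1)) := subsingleton_ext_of_injective _ t
    have h₂ : Subsingleton (Ext Y (Injective.under F) (t + 1 + 1)) :=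
      subsingleton_ext_of_injective _ (t + 1)
    exact (Equiv.ofBijective _ ⟨conn_injective (X := Y) k hS (t + 1),
      conn_surjective k hS (t + 1)⟩).subsingleton_congr.symm

end FirstVariable

section LinearFunctorMaps

universe r

variable {R : Type r} [CommRing R] {k : Type u} [Field k]
  {M N P : Type u} [AddCommGroup M] [Module k M] [AddCommGroup N] [Module k N]
  [AddCommGroup P] [Module k P]
  {actM : R →+* Module.End k M} {actN : R →+* Module.End k N} {actP : R →+* Module.End k P}

/-- The natural transformation induced by an equivariant map. -/
def linMap (f : M →ₗ[k] N) (h : ∀ c m, f (actM c m) = actN c (f m)) : linFun actM ⟶ linFun actN :=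
  homMk (fun V ↦ (LinearMap.pi fun v ↦ f ∘ₗ LinearMap.proj v : (V.ι → M) →ₗ[k] V.ι → N))
    fun g x ↦ funext fun w ↦ by
      refine (congrArg f (linFun_map_apply actM g x w)).trans ?_
      refine Eq.trans ?_ (linFun_map_apply actN g _ w).symm
      rw [map_sum]
      exact Finset.sum_congr rfl fun v _ ↦ h _ _

lemma linMap_app_apply (f : M →ₗ[k] N) (h : ∀ c m, f (actM c m) = actN c (f m)) (V : Mt R)
    (x : (linFun actM).obj V) (v : V.ι) : (linMap (R := R) f h).app V x v = f (x v) := rfl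

lemma shortExact_linMap (f : M →ₗ[k] N) (hf : ∀ c m, f (actM c m) = actN c (f m))
    (g : N →ₗ[k] P) (hg : ∀ c m, g (actN c m) = actP c (g m)) (hf' : Function.Injective f)
    (hg' : Function.Surjective g) (h : Function.Exact f g) :
    (ShortComplex.mk (linMap (R := R) f hf) (linMap g hg) (hom_ext_apply fun _ x ↦
      funext fun v ↦ (h _).2 ⟨x v, rfl⟩)).ShortExact :=
  shortExact_mk (linMap (R := R) f hf) (linMap g hg)
    (fun V (x y : V.ι → M) hxy ↦ funext fun v ↦ hf' (congrFun hxy v))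
    (fun V (x : V.ι → P) ↦ ⟨fun v ↦ (hg' (x v)).choose, funext fun v ↦ (hg' (x v)).choose_spec⟩)
    (fun V (x : V.ι → M) ↦ funext fun v ↦ (h _).2 ⟨x v, rfl⟩)
    fun V (x : V.ι → N) hx ↦ by
      choose y hy using fun v ↦ (h (x v)).1 (congrFun hx v)
      exact ⟨y, funext hy⟩

/-- Multiplication by a scalar, as an endomorphism of the identity functor. -/
def center (c : R) (F : Mt R ⥤ ModuleCat.{u} k) : F ⟶ F :=
  homMk (fun V ↦ (F.map (Mt.ofMat (c • (1 : Matrix V.ι V.ι R)))).hom) fun {V W} g x ↦ by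
    change F.map (Mt.ofMat (c • (1 : Matrix W.ι W.ι R))) (F.map g x) =
      F.map g (F.map (Mt.ofMat (c • (1 : Matrix V.ι V.ι R))) x)
    rw [← map_comp_apply, ← map_comp_apply]
    refine congrArg (fun h ↦ F.map h x) (Mt.hom_ext ?_)
    simp

lemma center_naturality (c : R) {F G : Mt R ⥤ ModuleCat.{u} k} (f : F ⟶ G) :
    center c F ≫ f = f ≫ center c G :=
  hom_ext_apply fun _ x ↦ nat_apply f _ x

lemma center_linFun_apply (c : R) (V : Mt R) (x : (linFun actM).obj V) (v : V.ι) :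
    (center c (linFun actM)).app V x v = actM c (x v) := by
  refine (linFun_map_apply actM _ x v).trans ?_
  rw [Finset.sum_eq_single v (fun w _ h ↦ by simp [Matrix.one_apply_ne h]) (by simp)]
  simp

end LinearFunctorMaps

section ModuleFunctors

variable {k : Type u} [Field k] {A : Type u} [CommRing A] [Algebra k A] (r : k →+* A)
  (M N : Type u) [AddCommGroup M] [Module k M] [Module A M] [IsScalarTower k A M]
  [AddCommGroup N] [Module k N] [Module A N] [IsScalarTower k A N]

/-- The action of `k` on an `A`-module given by a homomorphism `r : k →+* A`. -/
def actThrough : k →+* Module.End k M := (Algebra.lsmul k k M : A →ₐ[k] _).toRingHom.comp r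

lemma actThrough_apply (c : k) (m : M) : actThrough r M c m = r c • m := rfl

/-- The functor `V ↦ M ⊗ V`, where `k` acts on `M` through `r : k →+* A`. -/
abbrev modFun : Mt k ⥤ ModuleCat.{u} k := linFun (actThrough r M)

variable {M N}

/-- The natural transformation induced by an `A`-linear map. -/
def modMap (f : M →ₗ[A] N) : modFun r M ⟶ modFun r N :=
  linMap (f.restrictScalars k) fun c m ↦ f.map_smul (r c) m

lemma modMap_app_apply (f : M →ₗ[A] N) (V : Mt k) (x : (modFun r M).obj V) (v : V.ι) :
    (modMap r f).app V x v = f (x v) := rfl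

variable (M) in
/-- The ideal generated by the differences of the two actions of `k`. -/
def diffIdeal : Ideal A := Ideal.span (Set.range fun c : k ↦ r c - algebraMap k A c)

variable (k) in
/-- The tautological functor. -/
abbrev idFun : Mt k ⥤ ModuleCat.{u} k := linFun (Module.toModuleEnd k (S := k) k)

variable [HasExt.{w} (Mt k ⥤ ModuleCat.{u} k)]

lemma pull_smul_eq_zero {a : A} (ha : a ∈ diffIdeal r) (t : ℕ) (x : Ext (modFun r M) (idFun k) t) :
    pull k (modMap r (a • (LinearMap.id : M →ₗ[A] M))) (idFun k) t x = 0 := by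
  have hadd {X Y : Mt k ⥤ ModuleCat.{u} k} (f g : X ⟶ Y) (y : Ext Y (idFun k) t) :
      pull k (f + g) (idFun k) t y = pull k f (idFun k) t y + pull k g (idFun k) t y := by
    rw [pull_apply, Ext.mk₀_add, Ext.add_comp]; rfl
  induction ha using Submodule.span_induction with
  | mem a h =>
    obtain ⟨c, rfl⟩ := h
    have h₁ : modMap r ((r c - algebraMap k A c) • (LinearMap.id : M →ₗ[A] M)) +
        c • 𝟙 (modFun r M) = center c (modFun r M) := by
      refine hom_ext_apply fun V x ↦ funext fun v ↦ ?_
      refine Eq.trans ?_ (center_linFun_apply c V x v).symm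
      change (r c - algebraMap k A c) • x v + c • x v = r c • x v
      rw [sub_smul, algebraMap_smul, sub_add_cancel]
    have h₂ : center c (idFun k) = c • 𝟙 (idFun k) :=
      hom_ext_apply fun V x ↦ funext fun v ↦ center_linFun_apply c V x v
    have h₃ := pull_eq_push_of_natural k (fun F ↦ center c F) (center_naturality c) (modFun r M)
      (idFun k) t x
    rw [← h₁, h₂, push_smul, push_id, hadd, pull_apply _ (c • _), Ext.mk₀_smul, Ext.smul_comp,
      Ext.mk₀_id_comp] at h₃
    exact add_eq_right.1 h₃
  | zero =>
    have : modMap r ((0 : A) • (LinearMap.id : M →ₗ[A] M)) = 0 :=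
      hom_ext_apply fun V x ↦ funext fun v ↦ zero_smul A (x v)
    rw [this, pull_apply, Ext.mk₀_zero, Ext.zero_comp]
  | add a b _ _ ha hb =>
    have : modMap r ((a + b) • (LinearMap.id : M →ₗ[A] M)) =
        modMap r (a • (LinearMap.id : M →ₗ[A] M)) + modMap r (b • (LinearMap.id : M →ₗ[A] M)) :=
      hom_ext_apply fun V x ↦ funext fun v ↦ add_smul a b (x v)
    rw [this, hadd, ha, hb, add_zero]
  | smul a b _ hb =>
    have : modMap r ((a • b) • (LinearMap.id : M →ₗ[A] M)) =
        modMap r (a • (LinearMap.id : M →ₗ[A] M)) ≫ modMap r (b • (LinearMap.id : M →ₗ[A] M)) :=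
      hom_ext_apply fun V x ↦ funext fun v ↦ (smul_assoc a b (x v)).trans (smul_comm _ _ _)
    rw [this, pull_comp, hb, map_zero]

omit [HasExt.{w} (Mt k ⥤ ModuleCat.{u} k)] in
lemma modFun_finsupp_hom_ext {G : Mt k ⥤ ModuleCat.{u} k} {f g : modFun r (ℕ →₀ M) ⟶ G}
    (h : ∀ n, modMap r (Finsupp.lsingle n) ≫ f = modMap r (Finsupp.lsingle n) ≫ g) : f = g := by
  ext V : 2
  refine ModuleCat.hom_ext ?_
  refine LinearMap.pi_ext' fun v ↦ Finsupp.lhom_ext' fun n ↦ LinearMap.ext fun m ↦ ?_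
  classical
  have := congrArg (fun φ ↦ φ.app V (Pi.single v m : V.ι → M)) (h n)
  have e : (modMap r (Finsupp.lsingle n)).app V (Pi.single v m : V.ι → M) =
      (Pi.single v (Finsupp.single n m) : V.ι → ℕ →₀ M) := by
    refine funext fun w ↦ ?_
    refine (modMap_app_apply r _ V _ w).trans ?_
    exact Pi.apply_single (fun _ (x : M) ↦ Finsupp.single n x) (fun _ ↦ Finsupp.single_zero n) v m w
  exact (congrArg (f.app V) e).symm.trans (this.trans (congrArg (g.app V) e))

omit [HasExt.{w} (Mt k ⥤ ModuleCat.{u} k)] in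
lemma exists_modFun_finsupp_hom {G : Mt k ⥤ ModuleCat.{u} k} (f : ∀ n : ℕ, modFun r M ⟶ G) :
    ∃ g : modFun r (ℕ →₀ M) ⟶ G, ∀ n, modMap r (Finsupp.lsingle n) ≫ g = f n := by
  classical
  let φ (V : Mt k) : (V.ι → ℕ →₀ M) →ₗ[k] G.obj V := ∑ v, Finsupp.lsum ℕ (fun n ↦
    ((f n).app V).hom ∘ₗ (LinearMap.single k (fun _ : V.ι ↦ M) v)) ∘ₗ LinearMap.proj v
  have hφ (V : Mt k) (x : V.ι → M) (n : ℕ) : φ V (fun v ↦ Finsupp.single n (x v)) = (f n).app V x := by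
    have : (f n).app V x = (f n).app V (∑ v, (Pi.single v (x v) : V.ι → M)) :=
      congrArg _ (Finset.univ_sum_single x).symm
    rw [this]
    refine Eq.trans ?_ (map_sum ((f n).app V).hom (fun v ↦ (Pi.single v (x v) : V.ι → M)) _).symm
    simp only [φ, LinearMap.sum_apply, LinearMap.comp_apply, LinearMap.proj_apply,
      Finsupp.lsum_single]
    rfl
  have hnat {V W : Mt k} (a : V ⟶ W) : φ W ∘ₗ ((modFun r (ℕ →₀ M)).map a).hom = (G.map a).hom ∘ₗ φ V := by
    refine LinearMap.pi_ext' fun v ↦ Finsupp.lhom_ext' fun n ↦ LinearMap.ext fun m ↦ ?_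
    have e' : (Pi.single v (Finsupp.single n m) : V.ι → ℕ →₀ M) =
      fun w ↦ Finsupp.single n ((Pi.single v m : V.ι → M) w) := funext fun w ↦
        (Pi.apply_single (fun _ (x : M) ↦ Finsupp.single n x) (fun _ ↦ Finsupp.single_zero n) v m w).symm
    change φ W ((modFun r (ℕ →₀ M)).map a (Pi.single v (Finsupp.single n m) : V.ι → ℕ →₀ M)) =
      G.map a (φ V (Pi.single v (Finsupp.single n m) : V.ι → ℕ →₀ M))
    rw [e', hφ]
    refine Eq.trans ?_ (nat_apply (f n) a (Pi.single v m : V.ι → M))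
    refine Eq.trans (congrArg (φ W) ?_) (hφ W _ n)
    exact (nat_apply (modMap r (Finsupp.lsingle n : M →ₗ[A] ℕ →₀ M)) a _).symm
  exact ⟨homMk φ fun a x ↦ LinearMap.congr_fun (hnat a) x, fun n ↦ hom_ext_apply fun V x ↦ hφ V x n⟩

omit [Algebra k A] [Module k M] [IsScalarTower k A M] [Module k N] [IsScalarTower k A N] in
/-- The telescope of a sequence of multiplications. -/
lemma telescope_exact (δ : ℕ → A) (σ : ℕ → M →ₗ[A] N) (hσ : ∀ n, Function.Injective (σ n))
    (hδ : ∀ n m, σ n m = σ (n + 1) (δ n • m)) (s : (ℕ →₀ M) →ₗ[A] (ℕ →₀ M))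
    (hs : ∀ n m, s (Finsupp.single n m) = Finsupp.single (n + 1) (δ n • m)) :
    Function.Injective (LinearMap.id - s : (ℕ →₀ M) →ₗ[A] ℕ →₀ M) ∧
      Function.Exact (LinearMap.id - s : (ℕ →₀ M) →ₗ[A] ℕ →₀ M) (Finsupp.lsum ℕ σ : (ℕ →₀ M) →ₗ[A] N) := by
  have hs₀ (x : ℕ →₀ M) : s x 0 = 0 := by
    induction x using Finsupp.induction_linear with
    | zero => simp
    | add x y hx hy => simp [hx, hy]
    | single n m => simp [hs]
  have hs₁ (x : ℕ →₀ M) (i : ℕ) : s x (i + 1) = δ i • x i := by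
    induction x using Finsupp.induction_linear with
    | zero => simp
    | add x y hx hy => simp [hx, hy]
    | single n m => by_cases h : n = i <;> simp [hs, h]
  refine ⟨(injective_iff_map_eq_zero _).2 fun x hx ↦ Finsupp.ext fun i ↦ ?_, fun x ↦ ⟨fun hx ↦ ?_, ?_⟩⟩
  · have hx' : x = s x := sub_eq_zero.1 hx
    induction i with
    | zero => rw [hx', hs₀]; rfl
    | succ i ih => rw [hx', hs₁, ih]; simp
  · let y : ℕ → M := fun i ↦ Nat.rec (x 0) (fun i z ↦ x (i + 1) + δ i • z) i
    have hy (i : ℕ) : σ i (y i) = ∑ j ∈ Finset.range (i + 1), σ j (x j) := by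
      induction i with
      | zero => simp [y]
      | succ i ih =>
        rw [Finset.sum_range_succ, ← ih, hδ i, ← map_add]
        exact congrArg (σ (i + 1)) (add_comm _ _)
    obtain ⟨b, hb⟩ : ∃ b, ∀ i, b < i → x i = 0 := by
      obtain ⟨b, hb⟩ := x.support.bddAbove
      exact ⟨b, fun i hi ↦ by_contra fun h ↦ hi.not_ge (hb (Finsupp.mem_support_iff.2 h))⟩
    have hy₀ (i : ℕ) (hi : b < i) : y i = 0 := by
      refine hσ i (((hy i).trans ?_).trans (map_zero _).symm)
      rw [← hx, Finsupp.lsum_apply, Finsupp.sum]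
      refine (Finset.sum_subset (fun j hj ↦ ?_) fun j _ hj ↦ ?_).symm
      · rw [Finset.mem_range]
        by_contra h
        exact Finsupp.mem_support_iff.1 hj (hb j (by lia))
      · rw [Finsupp.notMem_support_iff.1 hj, map_zero]
    refine ⟨Finsupp.onFinset (Finset.range (b + 1)) y fun i hi ↦ ?_, Finsupp.ext fun i ↦ ?_⟩
    · rw [Finset.mem_range]
      by_contra h
      exact hi (hy₀ i (by lia))
    · rw [LinearMap.sub_apply, Finsupp.sub_apply, LinearMap.id_apply]
      cases i with
      | zero => rw [hs₀]; simp [y]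
      | succ i =>
        rw [hs₁]
        exact add_sub_cancel_right (x (i + 1)) (δ i • y i)
  · rintro ⟨y, rfl⟩
    induction y using Finsupp.induction_linear with
    | zero => simp
    | add x y hx hy => rw [map_add, map_add, hx, hy, add_zero]
    | single n m =>
      rw [LinearMap.sub_apply, LinearMap.id_apply, hs, map_sub]
      simp [hδ n m]

lemma subsingleton_ext_telescope (δ : ℕ → A) (hδ' : ∀ n, δ n ∈ diffIdeal r) (σ : ℕ → M →ₗ[A] N)
    (hσ : ∀ n, Function.Injective (σ n)) (hδ : ∀ n m, σ n m = σ (n + 1) (δ n • m))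
    (hsurj : ∀ x, ∃ n m, σ n m = x) (t : ℕ) :
    Subsingleton (Ext (modFun r N) (idFun k) t) := by
  let s : (ℕ →₀ M) →ₗ[A] (ℕ →₀ M) :=
    Finsupp.lsum ℕ fun n ↦ (Finsupp.lsingle (n + 1)) ∘ₗ (δ n • LinearMap.id)
  have hs (n : ℕ) (m : M) : s (Finsupp.single n m) = Finsupp.single (n + 1) (δ n • m) := by simp [s]
  obtain ⟨h₁, h₂⟩ := telescope_exact δ σ hσ hδ s hs
  have hS := shortExact_linMap (R := k) (actM := actThrough r (ℕ →₀ M))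
    (actN := actThrough r (ℕ →₀ M)) (actP := actThrough r N)
    ((LinearMap.id - s).restrictScalars k) (fun c m ↦ (LinearMap.id - s).map_smul (r c) m)
    ((Finsupp.lsum ℕ σ : (ℕ →₀ M) →ₗ[A] N).restrictScalars k)
    (fun c m ↦ (Finsupp.lsum ℕ σ : (ℕ →₀ M) →ₗ[A] N).map_smul (r c) m) h₁
    (fun x ↦ by
      obtain ⟨n, m, rfl⟩ := hsurj x
      exact ⟨Finsupp.single n m, by simp⟩) h₂
  have hzero (t : ℕ) (x : Ext (modFun r (ℕ →₀ M)) (idFun k) t) :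
      pull k (modMap r s) (idFun k) t x = 0 := by
    refine eq_zero_of_pull_eq_zero k (fun n : ℕ ↦ modMap r (Finsupp.lsingle n : M →ₗ[A] ℕ →₀ M))
      (fun f g h ↦ modFun_finsupp_hom_ext r h) (fun f ↦ exists_modFun_finsupp_hom r f) _ t _ fun n ↦ ?_
    have : modMap r (Finsupp.lsingle n : M →ₗ[A] ℕ →₀ M) ≫ modMap r s =
        modMap r (δ n • LinearMap.id) ≫ modMap r (Finsupp.lsingle (n + 1)) :=
      hom_ext_apply fun V x ↦ funext fun v ↦ hs n (x v)
    rw [← pull_comp, this, pull_comp, pull_smul_eq_zero r (hδ' n)]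
  refine subsingleton_ext_of_pull_bijective k hS _ (fun t ↦ ?_) t
  have hid : modMap r (LinearMap.id - s) = 𝟙 (modFun r (ℕ →₀ M)) - modMap r s :=
    hom_ext_apply fun V x ↦ rfl
  have h (x : Ext (modFun r (ℕ →₀ M)) (idFun k) t) :
      pull k (modMap r (LinearMap.id - s)) (idFun k) t x = x := by
    have h' : pull k (𝟙 (modFun r (ℕ →₀ M)) - modMap r s) (idFun k) t x =
        x - pull k (modMap r s) (idFun k) t x := by
      rw [pull_apply, sub_eq_add_neg, Ext.mk₀_add, Ext.mk₀_neg, Ext.add_comp, Ext.neg_comp,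
        Ext.mk₀_id_comp, ← sub_eq_add_neg]; rfl
    rw [hid, h', hzero, sub_zero]
  exact ⟨fun x y hxy ↦ (h x).symm.trans (hxy.trans (h y)), fun x ↦ ⟨x, h x⟩⟩

end ModuleFunctors

section Lifting

universe v r

lemma exists_lift_of_subsingleton_ext (k : Type r) [Field k] {A : Type u} [Category.{v} A] [Abelian A]
    [Linear k A] [HasExt.{w} A] {S S' : ShortComplex A} (hS : S.ShortExact) (hS' : S'.ShortExact)
    [Injective S.X₂] [Subsingleton (Ext S'.X₃ S.X₁ 1)] (g : S'.X₁ ⟶ S.X₂) (f : S'.X₂ ⟶ S.X₃)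
    (h : g ≫ S.g = S'.f ≫ f) : ∃ g' : S'.X₂ ⟶ S.X₂, S'.f ≫ g' = g ∧ g' ≫ S.g = f := by
  have := hS'.mono_f
  have := hS'.epi_g
  let g₁ := Injective.factorThru g S'.f
  have hg₁ : S'.f ≫ g₁ = g := Injective.comp_factorThru g S'.f
  obtain ⟨a, ha⟩ : ∃ a : S'.X₃ ⟶ S.X₃, S'.g ≫ a = f - g₁ ≫ S.g :=
    ⟨hS'.exact.desc _ (by rw [Preadditive.comp_sub, ← h, ← Category.assoc, hg₁, sub_self]),
      hS'.exact.g_desc _ _⟩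
  obtain ⟨b, hb⟩ := exists_push_g (X := S'.X₃) k hS 0 (Ext.mk₀ a) (Subsingleton.elim _ _)
  obtain ⟨c, rfl⟩ := (Ext.mk₀_bijective _ _).2 b
  rw [push_mk₀] at hb
  have hc := (Ext.mk₀_bijective _ _).1 hb
  refine ⟨g₁ + S'.g ≫ c, ?_, ?_⟩
  · rw [Preadditive.comp_add, hg₁, S'.zero_assoc, Limits.zero_comp, add_zero]
  · rw [Preadditive.add_comp, Category.assoc, hc, ha, add_sub_cancel]

end Lifting

section Primitives

universe r

variable {R : Type r} [CommRing R] {k : Type u} [Field k] {M : Type u} [AddCommGroup M] [Module k M]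
  {act : R →+* Module.End k M} {E : Mt R ⥤ ModuleCat.{u} k}

/-- The conditions on a map `M → E(R)` that characterize the natural transformations
`linFun act ⟶ E`. -/
structure IsPrim (act : R →+* Module.End k M) (φ : M →ₗ[k] E.obj (Mt.pt R)) : Prop where
  equivariant (c : R) (m : M) : E.map (Mt.ofVec fun _ ↦ c) (φ m) = φ (act c m)
  additive {V : Mt R} (a b : V.ι → R) (m : M) :
    E.map (Mt.ofVec (a + b)) (φ m) = E.map (Mt.ofVec a) (φ m) + E.map (Mt.ofVec b) (φ m)

lemma IsPrim.map_sum {φ : M →ₗ[k] E.obj (Mt.pt R)} (h : IsPrim act φ) {V : Mt R} {J : Type*}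
    (s : Finset J) (a : J → V.ι → R) (m : M) :
    E.map (Mt.ofVec (∑ j ∈ s, a j)) (φ m) = ∑ j ∈ s, E.map (Mt.ofVec (a j)) (φ m) :=
  _root_.map_sum (AddMonoidHom.mk' (fun a : V.ι → R ↦ E.map (Mt.ofVec a) (φ m))
    fun a b ↦ h.additive a b m) a s

lemma Mt.ofVec_comp {V W : Mt R} (a : V.ι → R) (g : V ⟶ W) :
    Mt.ofVec a ≫ g = Mt.ofVec (Matrix.vecMul a (Mt.mat g)) :=
  Mt.hom_ext (by rw [Mt.mat_comp]; rfl)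

/-- The natural transformation given by a map satisfying `IsPrim`. -/
def primHom (φ : M →ₗ[k] E.obj (Mt.pt R)) (h : IsPrim act φ) : linFun act ⟶ E :=
  homMk (fun V ↦ (∑ v : V.ι, (E.map (Mt.ofVec (V := V) (Pi.single v 1))).hom ∘ₗ φ ∘ₗ LinearMap.proj v :
    (V.ι → M) →ₗ[k] E.obj V)) fun {V W} g x ↦ by
      have H (U : Mt R) (y : U.ι → M) : (∑ v : U.ι, (E.map (Mt.ofVec (V := U) (Pi.single v 1))).hom ∘ₗ
          φ ∘ₗ LinearMap.proj v : (U.ι → M) →ₗ[k] E.obj U) y =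
          ∑ v : U.ι, E.map (Mt.ofVec (V := U) (Pi.single v 1)) (φ (y v)) :=
        LinearMap.sum_apply _ _ _
      refine (H W _).trans (Eq.trans ?_ (congrArg (E.map g) (H V x)).symm)
      have h₁ (w : W.ι) : φ ((linFun act).map g x w) = ∑ v, E.map (Mt.ofVec fun _ ↦ Mt.mat g v w) (φ (x v)) := by
        refine (congrArg φ (linFun_map_apply act g x w)).trans ?_
        rw [_root_.map_sum]
        exact Finset.sum_congr rfl fun v _ ↦ (h.equivariant _ _).symm
      have h₂ (v : V.ι) : E.map g (E.map (Mt.ofVec (V := V) (Pi.single v 1)) (φ (x v))) =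
          ∑ w, E.map (Mt.ofVec (V := W) (Pi.single w 1)) (E.map (Mt.ofVec fun _ ↦ Mt.mat g v w) (φ (x v))) := by
        rw [← map_comp_apply, Mt.ofVec_comp, Matrix.single_one_vecMul,
          ← Finset.univ_sum_single (Matrix.row (Mt.mat g) v), h.map_sum]
        refine Finset.sum_congr rfl fun w _ ↦ ?_
        rw [← map_comp_apply]
        refine congrArg (fun a ↦ E.map a (φ (x v))) (Mt.hom_ext (Matrix.ext fun i j ↦ ?_))
        rw [Mt.mat_comp, Matrix.mul_apply]
        refine Eq.trans ?_ (Fintype.sum_unique (ι := Unit) _).symm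
        change (Pi.single w (Mt.mat g v w) : W.ι → R) j = Mt.mat g v w * (Pi.single w 1 : W.ι → R) j
        by_cases hj : j = w
        · subst hj; simp
        · simp [hj]
      refine Eq.trans ?_ (_root_.map_sum (E.map g).hom _ _).symm
      refine Eq.trans ?_ (Finset.sum_congr rfl fun v _ ↦ (h₂ v).symm)
      rw [Finset.sum_comm]
      refine Finset.sum_congr rfl fun w _ ↦ ?_
      rw [h₁]
      exact _root_.map_sum (E.map _).hom _ _

lemma primHom_app_linPt (φ : M →ₗ[k] E.obj (Mt.pt R)) (h : IsPrim act φ) (m : M) :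
    (primHom φ h).app (Mt.pt R) (linPt act m) = φ m := by
  refine (LinearMap.sum_apply (ι := Unit) (M := Unit → M) _ _ _).trans
    ((Fintype.sum_unique (ι := Unit) _).trans ?_)
  have : Mt.ofVec (V := Mt.pt R) (Pi.single (M := fun _ : Unit ↦ R) () 1) = 𝟙 (Mt.pt R) := by
    refine Mt.hom_ext (Matrix.ext fun _ _ ↦ ?_)
    rw [Mt.mat_id]
    exact (Pi.single_eq_same (M := fun _ : Unit ↦ R) () 1).trans (Matrix.one_apply_eq _).symm
  exact (congrArg (fun a ↦ E.map a (φ m)) this).trans (map_id_apply E _)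

lemma linFun_hom_ext {f g : linFun act ⟶ E}
    (h : ∀ m, f.app (Mt.pt R) (linPt act m) = g.app (Mt.pt R) (linPt act m)) : f = g := by
  refine hom_ext_apply fun V x ↦ ?_
  rw [linFun_eq_sum act x]
  refine (map_sum (f.app V).hom _ _).trans (Eq.trans ?_ (map_sum (g.app V).hom _ _).symm)
  refine Finset.sum_congr rfl fun v _ ↦ ?_
  exact (nat_apply f _ _).trans ((congrArg _ (h _)).trans (nat_apply g _ _).symm)

/-- The linear map `M → E(R)` underlying a natural transformation `linFun act ⟶ E`. -/
def ptMap (f : linFun act ⟶ E) : M →ₗ[k] E.obj (Mt.pt R) :=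
  (f.app (Mt.pt R)).hom ∘ₗ (LinearMap.pi fun _ ↦ LinearMap.id : M →ₗ[k] Unit → M)

lemma ptMap_apply (f : linFun act ⟶ E) (m : M) :
    ptMap f m = f.app (Mt.pt R) (linPt act m) := rfl

lemma isPrim_ptMap (f : linFun act ⟶ E) : IsPrim act (ptMap f) where
  equivariant c m := by
    refine (nat_apply f _ _).symm.trans (congrArg (f.app _) (funext fun w ↦ ?_))
    exact linFun_map_ofVec act (V := Mt.pt R) _ m w
  additive {V} a b m := by
    have (a : V.ι → R) : E.map (Mt.ofVec a) (ptMap f m) =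
      f.app V ((linFun act).map (Mt.ofVec a) (linPt act m)) := (nat_apply f _ _).symm
    rw [this, this, this]
    refine Eq.trans (congrArg (f.app V) ?_) (map_add (f.app V).hom _ _)
    refine funext fun w ↦ ?_
    refine (linFun_map_ofVec act (a + b) m w).trans ?_
    refine Eq.trans ?_ (congrArg₂ (· + ·) (linFun_map_ofVec act a m w) (linFun_map_ofVec act b m w)).symm
    rw [Pi.add_apply, map_add, LinearMap.add_apply]

end Primitives

section PerfectRings

variable {A : Type*} [CommRing A] (p : ℕ) [hp : Fact p.Prime] [CharP A p] [PerfectRing A p]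

/-- Ideals closed under `p`-th roots. -/
def RootClosed (L : Ideal A) : Prop := ∀ x, x ^ p ∈ L → x ∈ L

/-- The iterated `p`-th roots of an element of a perfect ring. -/
noncomputable def root (δ : A) (n : ℕ) : A := ((frobeniusEquiv A p).symm)^[n] δ

lemma root_succ_pow (δ : A) (n : ℕ) : root p δ (n + 1) ^ p = root p δ n := by
  rw [root, Function.iterate_succ_apply', frobeniusEquiv_symm_pow_p]; rfl

lemma exists_root_mul (δ : A) (n m : ℕ) : ∃ d, root p δ n = d * root p δ (n + m) := by
  induction m with
  | zero => exact ⟨1, (one_mul _).symm⟩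
  | succ m ih =>
    obtain ⟨d, hd⟩ := ih
    refine ⟨d * root p δ (n + m + 1) ^ (p - 1), ?_⟩
    rw [hd, ← root_succ_pow p δ (n + m), mul_assoc]
    exact congrArg (d * ·) (pow_sub_one_mul hp.out.ne_zero _).symm

variable {p}

lemma RootClosed.root_mem {L : Ideal A} (hL : RootClosed p L) {δ : A} (h : δ ∈ L) (n : ℕ) :
    root p δ n ∈ L := by
  induction n with
  | zero => exact h
  | succ n ih => exact hL _ (by rwa [root_succ_pow])

lemma RootClosed.mul_root_mem_iff {L : Ideal A} (hL : RootClosed p L) (δ a : A) (n : ℕ) :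
    a * root p δ n ∈ L ↔ a * δ ∈ L := by
  induction n with
  | zero => rfl
  | succ n ih =>
    refine Iff.trans ⟨fun h ↦ ?_, fun h ↦ hL _ ?_⟩ ih
    · rw [← root_succ_pow p δ n, ← pow_sub_one_mul hp.out.ne_zero (root p δ (n + 1)), mul_left_comm]
      exact L.mul_mem_left _ h
    · rw [mul_pow, root_succ_pow, ← pow_sub_one_mul hp.out.ne_zero a, mul_assoc]
      exact L.mul_mem_left _ h

variable (p) in
/-- The ideal generated by `L` and the iterated `p`-th roots of `δ`. -/
noncomputable def adjoinRoots (L : Ideal A) (δ : A) : Ideal A where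
  carrier := {x | ∃ n a, x - a * root p δ n ∈ L}
  zero_mem' := ⟨0, 0, by simp⟩
  add_mem' := by
    rintro x y ⟨n, a, hx⟩ ⟨m, b, hy⟩
    obtain ⟨d, hd⟩ := exists_root_mul p δ n m
    obtain ⟨e, he⟩ := exists_root_mul p δ m n
    refine ⟨n + m, a * d + b * e, ?_⟩
    rw [hd] at hx
    rw [he, add_comm m n] at hy
    convert L.add_mem hx hy using 1
    ring
  smul_mem' := by
    rintro c x ⟨n, a, hx⟩
    refine ⟨n, c * a, ?_⟩
    convert L.mul_mem_left c hx using 1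
    rw [smul_eq_mul]
    ring

lemma le_adjoinRoots (L : Ideal A) (δ : A) : L ≤ adjoinRoots p L δ :=
  fun x hx ↦ ⟨0, 0, by simpa using hx⟩

lemma root_mem_adjoinRoots (L : Ideal A) (δ : A) (n : ℕ) : root p δ n ∈ adjoinRoots p L δ :=
  ⟨n, 1, by simp⟩

lemma adjoinRoots_le {L J : Ideal A} (hJ : RootClosed p J) (h : L ≤ J) {δ : A} (hδ : δ ∈ J) :
    adjoinRoots p L δ ≤ J := by
  rintro x ⟨n, a, hx⟩
  have := J.add_mem (h hx) (J.mul_mem_left a (hJ.root_mem hδ n))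
  rwa [sub_add_cancel] at this

lemma rootClosed_adjoinRoots {L : Ideal A} (hL : RootClosed p L) (δ : A) :
    RootClosed p (adjoinRoots p L δ) := by
  rintro x ⟨n, a, hx⟩
  refine ⟨n + 1, (frobeniusEquiv A p).symm a, hL _ ?_⟩
  rw [sub_pow_char, mul_pow, frobeniusEquiv_symm_pow_p, root_succ_pow]
  exact hx

end PerfectRings

section Vanishing

variable {k : Type u} [Field k] {A : Type u} [CommRing A] [Algebra k A] (r : k →+* A)
  {p : ℕ} [hp : Fact p.Prime] [CharP A p] [PerfectRing A p]
  [HasExt.{w} (Mt k ⥤ ModuleCat.{u} k)]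

omit [HasExt.{w} (Mt k ⥤ ModuleCat.{u} k)] in
lemma shortExact_modMap {M N P : Type u} [AddCommGroup M] [Module k M] [Module A M]
    [IsScalarTower k A M] [AddCommGroup N] [Module k N] [Module A N] [IsScalarTower k A N]
    [AddCommGroup P] [Module k P] [Module A P] [IsScalarTower k A P] {f : M →ₗ[A] N} {g : N →ₗ[A] P}
    (hf : Function.Injective f) (hg : Function.Surjective g) (h : Function.Exact f g)
    (h₀ : modMap r f ≫ modMap r g = 0) : (ShortComplex.mk (modMap r f) (modMap r g) h₀).ShortExact :=
  shortExact_linMap (R := k) (actM := actThrough r M) (actN := actThrough r N)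
    (actP := actThrough r P) (f.restrictScalars k) (fun c m ↦ f.map_smul (r c) m)
    (g.restrictScalars k) (fun c m ↦ g.map_smul (r c) m) hf hg h

lemma subsingleton_ext_adjoinRoots (hJ : RootClosed p (diffIdeal r)) {L : Ideal A}
    (hL : RootClosed p L) {δ : A} (hδ : δ ∈ diffIdeal r) (t : ℕ) :
    Subsingleton (Ext (modFun r (adjoinRoots p L δ ⧸ L.submoduleOf (adjoinRoots p L δ)))
      (idFun k) t) := by
  set L' := adjoinRoots p L δ with hL'
  let K : Ideal A := Submodule.comap (LinearMap.toSpanSingleton A A δ) L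
  have hK (a : A) : a ∈ K ↔ a * δ ∈ L := Iff.rfl
  let τ (n : ℕ) : A →ₗ[A] L' ⧸ L.submoduleOf L' := (L.submoduleOf L').mkQ ∘ₗ
    LinearMap.toSpanSingleton A L' ⟨root p δ n, root_mem_adjoinRoots L δ n⟩
  have hτ (n : ℕ) (a : A) : τ n a = 0 ↔ a ∈ K := by
    refine (Submodule.Quotient.mk_eq_zero _).trans ?_
    rw [hK, ← hL.mul_root_mem_iff δ a n]
    rfl
  let σ (n : ℕ) : A ⧸ K →ₗ[A] L' ⧸ L.submoduleOf L' := Submodule.liftQ K (τ n) fun a ha ↦ (hτ n a).2 ha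
  refine subsingleton_ext_telescope r (fun n ↦ root p δ (n + 1) ^ (p - 1)) (fun n ↦ ?_) σ (fun n ↦ ?_)
    (fun n m ↦ ?_) (fun x ↦ ?_) t
  · exact Ideal.pow_mem_of_mem _ (hJ.root_mem hδ _) _ (Nat.sub_pos_of_lt hp.out.one_lt)
  · refine LinearMap.ker_eq_bot.1 (Submodule.ker_liftQ_eq_bot _ _ _ fun a ha ↦ (hτ n a).1 ha)
  · obtain ⟨a, rfl⟩ := Submodule.Quotient.mk_surjective _ m
    change τ n a = τ (n + 1) (root p δ (n + 1) ^ (p - 1) * a)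
    refine congrArg (L.submoduleOf L').mkQ (Subtype.ext ?_)
    change a * root p δ n = root p δ (n + 1) ^ (p - 1) * a * root p δ (n + 1)
    rw [← root_succ_pow p δ n, ← pow_sub_one_mul hp.out.ne_zero (root p δ (n + 1))]
    ring
  · obtain ⟨⟨x, n, a, hx⟩, rfl⟩ := Submodule.Quotient.mk_surjective _ x
    refine ⟨n, Submodule.Quotient.mk a, Eq.symm ?_⟩
    exact (Submodule.Quotient.eq (L.submoduleOf L') (x := ⟨x, n, a, hx⟩)
      (y := a • ⟨root p δ n, root_mem_adjoinRoots L δ n⟩)).2 hx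

/-- The inclusion of functors induced by an inclusion of ideals. -/
def inclMap {L L' : Ideal A} (h : L ≤ L') : modFun r L ⟶ modFun r L' :=
  modMap r (Submodule.inclusion h)

/-- The projection onto the functor associated with a quotient. -/
def quotMap (L L' : Ideal A) : modFun r L' ⟶ modFun r (L' ⧸ L.submoduleOf L') :=
  modMap r (L.submoduleOf L').mkQ

lemma inclMap_comp_quotMap {L L' : Ideal A} (h : L ≤ L') : inclMap r h ≫ quotMap r L L' = 0 :=
  hom_ext_apply fun _ x ↦ funext fun v ↦
    (Submodule.Quotient.mk_eq_zero _).2 (show (x v).1 ∈ L from (x v).2)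

lemma exact_inclusion_mkQ {L L' : Ideal A} (h : L ≤ L') :
    Function.Exact (Submodule.inclusion h) (L.submoduleOf L').mkQ := fun x ↦
  (Submodule.Quotient.mk_eq_zero _).trans ⟨fun hx ↦ ⟨⟨x.1, hx⟩, rfl⟩, by rintro ⟨y, rfl⟩; exact y.2⟩

lemma shortExact_inclMap {L L' : Ideal A} (h : L ≤ L') :
    (ShortComplex.mk (inclMap r h) (quotMap r L L') (inclMap_comp_quotMap r h)).ShortExact :=
  shortExact_modMap r (Submodule.inclusion_injective h) (Submodule.mkQ_surjective _)
    (exact_inclusion_mkQ h) _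

end Vanishing

section Zorn

variable {k : Type u} [Field k] {A : Type u} [CommRing A] [Algebra k A] (r : k →+* A) (p : ℕ)
  {J : Ideal A} {E Q : Mt k ⥤ ModuleCat.{u} k} (π : E ⟶ Q) (f : modFun r J ⟶ Q)

/-- A partially defined lift of `f` along `π`, on a root-closed ideal contained in `J`. -/
structure IsPartialLift (φ : A →ₗ.[k] E.obj (Mt.pt k)) : Prop where
  mul_mem (a : A) (x : φ.domain) : a * x ∈ φ.domain
  root_mem (x : A) (h : x ^ p ∈ φ.domain) : x ∈ φ.domain
  equivariant (c : k) (x : φ.domain) :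
    E.map (Mt.ofVec fun _ ↦ c) (φ x) = φ ⟨r c * x, mul_mem _ x⟩
  additive {V : Mt k} (a b : V.ι → k) (x : φ.domain) :
    E.map (Mt.ofVec (a + b)) (φ x) = E.map (Mt.ofVec a) (φ x) + E.map (Mt.ofVec b) (φ x)
  lift (x : φ.domain) : ∃ h : (x : A) ∈ J, π.app (Mt.pt k) (φ x) = ptMap f ⟨x, h⟩

variable {r p π f}

lemma isPartialLift_bot (hp : p ≠ 0) [IsReduced A] :
    IsPartialLift r p π f (⊥ : A →ₗ.[k] E.obj (Mt.pt k)) where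
  mul_mem a x := by
    rw [(Submodule.mem_bot k).1 x.2, mul_zero]
    exact zero_mem _
  root_mem x h := (Submodule.mem_bot k).2 (pow_eq_zero_iff hp |>.1 ((Submodule.mem_bot k).1 h))
  equivariant c x := map_zero _
  additive a b x := by
    have (W : Mt k) (g : Mt.pt k ⟶ W) : E.map g ((⊥ : A →ₗ.[k] E.obj (Mt.pt k)) x) = 0 := map_zero (E.map g).hom
    rw [this, this, this, add_zero]
  lift x := by
    have hx : (x : A) = 0 := (Submodule.mem_bot k).1 x.2
    refine ⟨hx ▸ J.zero_mem, ?_⟩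
    have : (⟨x, hx ▸ J.zero_mem⟩ : J) = 0 := Subtype.ext hx
    rw [this, map_zero]
    exact map_zero (π.app _).hom

lemma isPartialLift_sSup {c : Set (A →ₗ.[k] E.obj (Mt.pt k))} (hc : DirectedOn (· ≤ ·) c)
    (hne : c.Nonempty) (h : ∀ φ ∈ c, IsPartialLift r p π f φ) :
    IsPartialLift r p π f (LinearPMap.sSup c hc) := by
  have key (x : (LinearPMap.sSup c hc).domain) : ∃ φ ∈ c, ∃ h : (x : A) ∈ φ.domain,
      LinearPMap.sSup c hc x = φ ⟨x, h⟩ := by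
    obtain ⟨φ, hφ, hx⟩ := (LinearPMap.mem_domain_sSup_iff hne hc).1 x.2
    exact ⟨φ, hφ, hx, LinearPMap.sSup_apply hc hφ ⟨x, hx⟩⟩
  have hmul (a : A) (x : (LinearPMap.sSup c hc).domain) : a * x ∈ (LinearPMap.sSup c hc).domain := by
    obtain ⟨φ, hφ, hx, -⟩ := key x
    exact (LinearPMap.le_sSup hc hφ).1 ((h φ hφ).mul_mem a ⟨x, hx⟩)
  refine ⟨hmul, fun x hx ↦ ?_, fun c x ↦ ?_, fun a b x ↦ ?_, fun x ↦ ?_⟩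
  · obtain ⟨φ, hφ, hx'⟩ := (LinearPMap.mem_domain_sSup_iff hne hc).1 hx
    exact (LinearPMap.le_sSup hc hφ).1 ((h φ hφ).root_mem x hx')
  · obtain ⟨φ, hφ, hx, e⟩ := key x
    rw [e, (h φ hφ).equivariant c]
    exact (LinearPMap.sSup_apply hc hφ ⟨_, (h φ hφ).mul_mem _ ⟨x, hx⟩⟩).symm
  · obtain ⟨φ, hφ, hx, e⟩ := key x
    rw [e, (h φ hφ).additive]
  · obtain ⟨φ, hφ, hx, e⟩ := key x
    rw [e]
    exact (h φ hφ).lift ⟨x, hx⟩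

variable {φ : A →ₗ.[k] E.obj (Mt.pt k)} (h : IsPartialLift r p π f φ)

/-- The ideal on which a partial lift is defined. -/
def IsPartialLift.ideal (h : IsPartialLift r p π f φ) : Ideal A :=
  { φ.domain.toAddSubmonoid with smul_mem' := fun a x hx ↦ h.mul_mem a ⟨x, hx⟩ }

lemma IsPartialLift.rootClosed : RootClosed p h.ideal := h.root_mem

lemma IsPartialLift.ideal_le : h.ideal ≤ J := fun x hx ↦ (h.lift ⟨x, hx⟩).choose

/-- The linear map underlying a partial lift. -/
def IsPartialLift.linearMap : h.ideal →ₗ[k] E.obj (Mt.pt k) where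
  toFun x := φ ⟨x, x.2⟩
  map_add' x y := φ.map_add ⟨x, x.2⟩ ⟨y, y.2⟩
  map_smul' c x := φ.map_smul c ⟨x, x.2⟩

lemma IsPartialLift.isPrim : IsPrim (actThrough r h.ideal) h.linearMap where
  equivariant c x := h.equivariant c ⟨x, x.2⟩
  additive a b x := h.additive a b ⟨x, x.2⟩

/-- The natural transformation associated with a partial lift. -/
def IsPartialLift.hom : modFun r h.ideal ⟶ E := primHom h.linearMap h.isPrim

lemma IsPartialLift.ptMap_hom (x : h.ideal) : ptMap h.hom x = φ ⟨x, x.2⟩ :=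
  primHom_app_linPt h.linearMap h.isPrim x

lemma IsPartialLift.hom_comp : h.hom ≫ π = inclMap r h.ideal_le ≫ f :=
  linFun_hom_ext fun x ↦ (congrArg (π.app (Mt.pt k)) (h.ptMap_hom x)).trans
    (h.lift ⟨x, x.2⟩).choose_spec

/-- The partially defined map associated with a lift defined on an ideal. -/
def liftPMap {L : Ideal A} (g : modFun r L ⟶ E) : A →ₗ.[k] E.obj (Mt.pt k) :=
  ⟨L.restrictScalars k, ptMap g⟩

lemma isPartialLift_liftPMap {L : Ideal A} (hL : RootClosed p L) (hLJ : L ≤ J) (g : modFun r L ⟶ E)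
    (hg : g ≫ π = inclMap r hLJ ≫ f) : IsPartialLift r p π f (liftPMap g) where
  mul_mem a x := L.mul_mem_left a x.2
  root_mem := hL
  equivariant c x := (isPrim_ptMap g).equivariant c x
  additive a b x := (isPrim_ptMap g).additive a b x
  lift x := ⟨hLJ x.2, congrArg (fun η ↦ η.app (Mt.pt k) (linPt (actThrough r L) x)) hg⟩

variable [hp : Fact p.Prime] [CharP A p] [PerfectRing A p] [HasExt.{w} (Mt k ⥤ ModuleCat.{u} k)]

lemma exists_lift_of_diffIdeal (hJ : RootClosed p (diffIdeal r)) {t : ℕ}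
    {S : ShortComplex (Mt k ⥤ ModuleCat.{u} k)} (hS : S.ShortExact) [Injective S.X₂]
    (hG : ∀ Y, Subsingleton (Ext Y (idFun k) (t + 1)) → Subsingleton (Ext Y S.X₁ 1))
    (f : modFun r (diffIdeal r) ⟶ S.X₃) : ∃ g, g ≫ S.g = f := by
  have : IsReduced A := (isReduced_iff_pow_one_lt p hp.out.one_lt).2 fun x hx ↦
    (injective_iff_map_eq_zero (frobenius A p)).1 (PerfectRing.bijective_frobenius (R := A) (p := p)).1 x hx
  obtain ⟨φ, -, hφ⟩ := zorn_le_nonempty₀ {φ | IsPartialLift r p S.g f φ} (fun c hc hch φ hφ ↦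
    ⟨LinearPMap.sSup c hch.directedOn, isPartialLift_sSup hch.directedOn ⟨φ, hφ⟩ fun φ hφ ↦ hc hφ,
      fun ψ hψ ↦ LinearPMap.le_sSup hch.directedOn hψ⟩) ⊥ (isPartialLift_bot hp.out.ne_zero)
  have h : IsPartialLift r p S.g f φ := hφ.1
  suffices hle : diffIdeal r ≤ h.ideal by
    refine ⟨inclMap r hle ≫ h.hom, ?_⟩
    rw [Category.assoc, h.hom_comp]
    rfl
  intro δ hδ
  have : Subsingleton (Ext (ShortComplex.mk _ _ (inclMap_comp_quotMap r
      (le_adjoinRoots (p := p) h.ideal δ))).X₃ S.X₁ 1) :=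
    hG _ (subsingleton_ext_adjoinRoots r hJ h.rootClosed hδ (t + 1))
  have hle : adjoinRoots p h.ideal δ ≤ diffIdeal r := adjoinRoots_le hJ h.ideal_le hδ
  obtain ⟨g, hg₁, hg₂⟩ := exists_lift_of_subsingleton_ext k hS
    (shortExact_inclMap r (le_adjoinRoots (p := p) h.ideal δ)) h.hom (inclMap r hle ≫ f) (by
      rw [h.hom_comp]; rfl)
  have hmax := hφ.2 (isPartialLift_liftPMap (rootClosed_adjoinRoots h.rootClosed δ) hle g hg₂)
    ⟨fun x hx ↦ le_adjoinRoots (p := p) h.ideal δ hx, fun x y hxy ↦ by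
      have e := congrArg (fun η ↦ ptMap η ⟨x, x.2⟩) hg₁
      refine ((h.ptMap_hom ⟨x, x.2⟩).symm.trans e.symm).trans ?_
      exact congrArg (ptMap g) (show (⟨x.1, le_adjoinRoots h.ideal δ x.2⟩ : adjoinRoots p h.ideal δ) =
        ⟨y.1, y.2⟩ from Subtype.ext hxy)⟩
  exact hmax.1 (root_mem_adjoinRoots h.ideal δ 0)

/-- The functor given by a root-closed ideal of differences is orthogonal to the identity functor. -/
lemma subsingleton_ext_diffIdeal (hJ : RootClosed p (diffIdeal r)) (t : ℕ) :
    Subsingleton (Ext (modFun r (diffIdeal r)) (idFun k) t) := by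
  refine subsingleton_of_forall_eq 0 fun x ↦ ?_
  cases t with
  | zero =>
    obtain ⟨f, rfl⟩ := (Ext.mk₀_bijective _ _).2 x
    suffices f = 0 by rw [this, Ext.mk₀_zero]
    refine linFun_hom_ext fun x ↦ ?_
    let y : diffIdeal r := ⟨root p (x : A) 1, hJ.root_mem x.2 1⟩
    have ha : (y : A) ^ (p - 1) ∈ diffIdeal r :=
      Ideal.pow_mem_of_mem _ y.2 _ (Nat.sub_pos_of_lt hp.out.one_lt)
    have h₁ := pull_smul_eq_zero r (M := diffIdeal r) ha 0 (Ext.mk₀ f)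
    rw [pull_apply, Ext.mk₀_comp_mk₀] at h₁
    have h₂ := (Ext.mk₀_bijective _ _).1 (h₁.trans (Ext.mk₀_zero _ _).symm)
    have h₃ : x = (y : A) ^ (p - 1) • y := Subtype.ext
      ((root_succ_pow p (x : A) 0).symm.trans (pow_sub_one_mul hp.out.ne_zero _).symm)
    have h₄ := congrArg (fun η ↦ η.app (Mt.pt k) (linPt (actThrough r (diffIdeal r)) y)) h₂
    rw [h₃]
    exact h₄
  | succ t =>
    obtain ⟨G, hG⟩ := exists_cosyzygy k (idFun k) t
    suffices Subsingleton (Ext (modFun r (diffIdeal r)) G 1) from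
      @Subsingleton.elim _ ((hG _).2 this) _ _
    have hS := shortExact_cokernel (Injective.ι G)
    refine subsingleton_of_forall_eq 0 fun x ↦ ?_
    have := subsingleton_ext_of_injective (X := modFun r (diffIdeal r)) (Injective.under G) 0
    obtain ⟨y, rfl⟩ := conn_surjective k hS 0 x
    obtain ⟨f, rfl⟩ := (Ext.mk₀_bijective _ _).2 y
    obtain ⟨g, rfl⟩ := exists_lift_of_diffIdeal (S := ShortComplex.mk _ _ _) hJ hS
      (fun Y ↦ (hG Y).1) f
    rw [← push_mk₀ k]
    exact conn_push_g k hS 0 _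

end Zorn

section TensorSquare

open TensorProduct

variable (k : Type u) [Field k] (p : ℕ) [hp : Fact p.Prime] [Algebra (ZMod p) k]

/-- The tensor square of `k` over the prime field. -/
abbrev TensorSq : Type u := k ⊗[ZMod p] k

/-- The second algebra structure on the tensor square. -/
abbrev sndAction : k →+* TensorSq k p :=
  (Algebra.TensorProduct.includeRight : k →ₐ[ZMod p] TensorSq k p).toRingHom

/-- Multiplication as a `k`-linear map on the tensor square. -/
noncomputable def mulMap : TensorSq k p →ₗ[k] k :=
  (Algebra.TensorProduct.lmul'' (ZMod p) (S := k)).toLinearMap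

lemma mulMap_tmul (a b : k) : mulMap k p (a ⊗ₜ b) = a * b :=
  Algebra.TensorProduct.lmul'_apply_tmul a b

instance charP_tensorSq : CharP (TensorSq k p) p := by
  have := charP_of_algebra_zmod k p
  exact charP_of_injective_algebraMap (algebraMap k (TensorSq k p)).injective p

instance perfectRing_tensorSq [PerfectField k] : PerfectRing (TensorSq k p) p := by
  have := charP_of_algebra_zmod k p
  have := PerfectField.toPerfectRing (K := k) p
  let e : k ≃ₐ[ZMod p] k := AlgEquiv.ofRingEquiv (f := frobeniusEquiv k p) fun x ↦ by
    rw [frobeniusEquiv_apply, frobenius_def, ← map_pow, ZMod.pow_card]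
  let e' := Algebra.TensorProduct.congr e e
  have h : ⇑(frobenius (TensorSq k p) p) = e' := by
    refine funext fun x ↦ ?_
    induction x using TensorProduct.induction_on with
    | zero => simp
    | add x y hx hy => rw [map_add, map_add, hx, hy]
    | tmul a b =>
      refine (Algebra.TensorProduct.tmul_pow a b p).trans ?_
      rfl
  exact ⟨(congrArg Function.Bijective h).mpr e'.bijective⟩

lemma mem_diffIdeal_iff (x : TensorSq k p) :
    x ∈ diffIdeal (sndAction k p) ↔ mulMap k p x = 0 := by
  have h := KaehlerDifferential.span_range_eq_ideal (ZMod p) k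
  have h' : x ∈ diffIdeal (sndAction k p) ↔ x ∈ KaehlerDifferential.ideal (ZMod p) k := by
    rw [← h]; rfl
  exact h'.trans Iff.rfl

lemma rootClosed_diffIdeal : RootClosed p (diffIdeal (sndAction k p)) := fun x hx ↦ by
  rw [mem_diffIdeal_iff] at hx ⊢
  have : mulMap k p (x ^ p) = mulMap k p x ^ p :=
    map_pow (Algebra.TensorProduct.lmul'' (ZMod p) (S := k)) x p
  exact pow_eq_zero_iff hp.out.ne_zero |>.1 (this.symm.trans hx)

/-- The functor `V ↦ k ⊗ V`, the tensor product being taken over the prime field. -/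
noncomputable abbrev tensorFun : Mt k ⥤ ModuleCat.{u} k := modFun (sndAction k p) (TensorSq k p)

lemma mulMap_sndAction (c : k) (m : TensorSq k p) :
    mulMap k p (actThrough (sndAction k p) (TensorSq k p) c m) =
      Module.toModuleEnd k (S := k) k c (mulMap k p m) := by
  have : mulMap k p (sndAction k p c * m) = mulMap k p (sndAction k p c) * mulMap k p m :=
    map_mul (Algebra.TensorProduct.lmul'' (ZMod p) (S := k)) _ _
  refine this.trans (congrArg (· * _) ?_)
  exact (mulMap_tmul k p 1 c).trans (one_mul c)

/-- The natural transformation given by scalar multiplication. -/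
noncomputable def mulHom : tensorFun k p ⟶ idFun k := linMap (mulMap k p) (mulMap_sndAction k p)

lemma pull_mulHom_bijective [PerfectField k] [HasExt.{w} (Mt k ⥤ ModuleCat.{u} k)] (t : ℕ) :
    Function.Bijective (pull k (mulHom k p) (idFun k) t) := by
  have hS := shortExact_linMap (R := k) (actM := actThrough (sndAction k p) (diffIdeal (sndAction k p)))
    (actN := actThrough (sndAction k p) (TensorSq k p))
    ((diffIdeal (sndAction k p)).subtype.restrictScalars k) (fun _ _ ↦ rfl) (mulMap k p)
    (mulMap_sndAction k p) (Subtype.val_injective) (fun a ↦ ⟨a ⊗ₜ 1, (mulMap_tmul k p a 1).trans (mul_one a)⟩)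
    fun x ↦ (mem_diffIdeal_iff k p x).symm.trans
      ⟨fun hx ↦ ⟨⟨x, hx⟩, rfl⟩, by rintro ⟨y, rfl⟩; exact y.2⟩
  exact pull_g_bijective k hS (idFun k)
    (subsingleton_ext_diffIdeal (p := p) (rootClosed_diffIdeal k p)) t

end TensorSquare

section MapFunctors

universe r b

variable {R : Type r} [CommRing R] {X : Type u} [AddCommGroup X] [Module R X]

/-- The action of a matrix on a family of vectors. -/
def Mt.smulVec {V W : Mt R} (f : V ⟶ W) (a : W.ι → X) : V.ι → X := fun v ↦ ∑ w, Mt.mat f v w • a w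

lemma Mt.smulVec_comp {V W T : Mt R} (f : V ⟶ W) (g : W ⟶ T) (a : T.ι → X) :
    Mt.smulVec (f ≫ g) a = Mt.smulVec f (Mt.smulVec g a) := by
  funext v
  simp only [Mt.smulVec, Mt.mat_comp, Matrix.mul_apply, Finset.sum_smul, Finset.smul_sum, mul_smul]
  exact Finset.sum_comm

lemma Mt.smulVec_id {V : Mt R} (a : V.ι → X) : Mt.smulVec (𝟙 V) a = a := by
  funext v
  simp only [Mt.smulVec, Mt.mat_id, Matrix.one_apply, ite_smul, one_smul, zero_smul]
  exact (Finset.sum_ite_eq _ _ _).trans (if_pos (Finset.mem_univ _))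

variable (R X) in
/-- The functor `V ↦ Map(Hom(V, X), U)`. -/
def mapFun {k : Type u} [Field k] (U : ModuleCat.{u} k) : Mt R ⥤ ModuleCat.{u} k :=
  funMk (fun V ↦ (V.ι → X) → U)
    (fun f ↦ { toFun := fun g a ↦ g (Mt.smulVec f a)
               map_add' := fun _ _ ↦ rfl
               map_smul' := fun _ _ ↦ rfl })
    (fun V x ↦ funext fun a ↦ congrArg x (Mt.smulVec_id a))
    (fun f g x ↦ funext fun a ↦ congrArg x (Mt.smulVec_comp f g a))

variable {β : Type b} (B : Module.Basis β R X)

/-- The object of rank the cardinality of a finite set. -/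
abbrev finObj (R : Type r) (s : Finset β) : Mt R := ⟨Fin s.card⟩

/-- The elements of a finite set. -/
noncomputable def elt (s : Finset β) (i : Fin s.card) : β := s.equivFin.symm i

lemma sum_elt {M : Type*} [AddCommMonoid M] (s : Finset β) (f : β → M) :
    ∑ i, f (elt s i) = ∑ x ∈ s, f x :=
  (Equiv.sum_comp s.equivFin.symm fun x : s ↦ f x).trans (Finset.sum_coe_sort s f)

/-- The coordinates of a family of vectors. -/
noncomputable def coordHom {V : Mt R} (a : V.ι → X) (s : Finset β) : V ⟶ finObj R s :=
  Mt.ofMat fun v i ↦ B.repr (a v) (elt s i)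

lemma coordHom_smulVec {V W : Mt R} (f : V ⟶ W) (a : W.ι → X) (s : Finset β) :
    coordHom B (Mt.smulVec f a) s = f ≫ coordHom B a s := by
  refine Mt.hom_ext ?_
  ext v i
  rw [Mt.mat_comp, Matrix.mul_apply]
  change B.repr (∑ w, Mt.mat f v w • a w) (elt s i) = ∑ w, Mt.mat f v w * B.repr (a w) (elt s i)
  rw [map_sum, Finsupp.finsetSum_apply]
  simp

/-- The vectors `a` are combinations of the elements of the basis indexed by `s`. -/
def SuppIn (V : Mt R) (a : V.ι → X) (s : Finset β) : Prop := ∀ v, (B.repr (a v)).support ⊆ s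

lemma SuppIn.smulVec_coordHom {V : Mt R} {a : V.ι → X} {s : Finset β} (h : SuppIn B V a s) :
    Mt.smulVec (coordHom B a s) (fun i ↦ B (elt s i)) = a := by
  funext v
  change ∑ i, B.repr (a v) (elt s i) • B (elt s i) = a v
  rw [sum_elt s fun x ↦ B.repr (a v) x • B x]
  conv_rhs => rw [← B.linearCombination_repr (a v)]
  rw [Finsupp.linearCombination_apply, Finsupp.sum_of_support_subset _ (h v)]
  simp

/-- The inclusion between coordinate spaces. -/
noncomputable def inclHom (s t : Finset β) : finObj R s ⟶ finObj R t :=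
  coordHom B (fun i ↦ B (elt s i)) t

lemma SuppIn.coordHom_inclHom {V : Mt R} {a : V.ι → X} {s : Finset β} (h : SuppIn B V a s)
    (t : Finset β) : coordHom B a s ≫ inclHom B s t = coordHom B a t := by
  rw [inclHom, ← coordHom_smulVec, h.smulVec_coordHom]

lemma suppIn_elt {s t : Finset β} (h : s ⊆ t) :
    SuppIn B (finObj R s) (fun i ↦ B (elt s i)) t := fun i ↦ by
  rw [B.repr_self]
  refine Finsupp.support_single_subset.trans ?_
  rw [Finset.singleton_subset_iff]
  exact h (s.equivFin.symm i).2

lemma inclHom_self (s : Finset β) : inclHom B s s = 𝟙 (finObj R s) := by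
  classical
  refine Mt.hom_ext ?_
  ext i j
  change B.repr (B (elt s i)) (elt s j) = (1 : Matrix _ _ R) i j
  rw [B.repr_self, Matrix.one_apply, Finsupp.single_apply]
  refine if_congr ?_ rfl rfl
  exact (Subtype.val_injective.comp s.equivFin.symm.injective).eq_iff

lemma inclHom_comp {s t : Finset β} (h : s ⊆ t) (r : Finset β) :
    inclHom B s t ≫ inclHom B t r = inclHom B s r :=
  (suppIn_elt B h).coordHom_inclHom B r

lemma exists_suppIn (V : Mt R) (a : V.ι → X) : ∃ s : Finset β, SuppIn B V a s := by
  classical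
  exact ⟨Finset.univ.biUnion fun v ↦ (B.repr (a v)).support,
    fun v ↦ Finset.subset_biUnion_of_mem (fun v ↦ (B.repr (a v)).support) (Finset.mem_univ v)⟩

lemma SuppIn.smulVec {V W : Mt R} {a : W.ι → X} {s : Finset β} (h : SuppIn B W a s) (f : V ⟶ W) :
    SuppIn B V (Mt.smulVec f a) s := fun v x hx ↦ by
  by_contra hxs
  refine Finsupp.mem_support_iff.1 hx ?_
  change B.repr (∑ w, Mt.mat f v w • a w) x = 0
  rw [map_sum, Finsupp.finsetSum_apply]
  refine Finset.sum_eq_zero fun w _ ↦ ?_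
  have : B.repr (a w) x = 0 := Finsupp.notMem_support_iff.1 fun h' ↦ hxs (h w h')
  rw [map_smul, Finsupp.smul_apply, this, smul_zero]

section Limit

variable {k : Type u} [Field k]

/-- The transition maps of the directed system of values of a functor on coordinate spaces. -/
noncomputable abbrev coordMap (F : Mt R ⥤ ModuleCat.{u} k) (s t : Finset β) (_ : s ≤ t) :
    F.obj (finObj R s) →ₗ[k] F.obj (finObj R t) := (F.map (inclHom B s t)).hom

instance (F : Mt R ⥤ ModuleCat.{u} k) :
    DirectedSystem (fun s : Finset β ↦ F.obj (finObj R s)) (coordMap B F · · ·) where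
  map_self s x := (congrArg (fun f ↦ F.map f x) (inclHom_self B s)).trans (map_id_apply F x)
  map_map s t r h h' x := (map_comp_apply F _ _ x).symm.trans
    (congrArg (fun f ↦ F.map f x) (inclHom_comp B h _))

variable [DecidableEq β]

/-- The value at `X` of the extension of `F` commuting with filtered colimits. -/
abbrev limObj (F : Mt R ⥤ ModuleCat.{u} k) : Type (max b u) :=
  Module.DirectLimit (fun s : Finset β ↦ F.obj (finObj R s)) (coordMap B F)

/-- The map from the value at a coordinate space. -/
noncomputable abbrev limOf (F : Mt R ⥤ ModuleCat.{u} k) (s : Finset β) : F.obj (finObj R s) →ₗ[k] limObj B F :=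
  Module.DirectLimit.of k (Finset β) (fun s : Finset β ↦ F.obj (finObj R s)) (coordMap B F) s

/-- Functoriality of `limObj`. -/
noncomputable def limMap {F G : Mt R ⥤ ModuleCat.{u} k} (φ : F ⟶ G) : limObj B F →ₗ[k] limObj B G :=
  Module.DirectLimit.map (fun s ↦ (φ.app (finObj R s)).hom)
    fun s t _ ↦ LinearMap.ext fun x ↦ nat_apply φ (inclHom B s t) x

lemma limMap_limOf {F G : Mt R ⥤ ModuleCat.{u} k} (φ : F ⟶ G) (s : Finset β)
    (x : F.obj (finObj R s)) : limMap B φ (limOf B F s x) = limOf B G s (φ.app _ x) :=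
  Module.DirectLimit.map_apply_of (G := fun s : Finset β ↦ F.obj (finObj R s)) (fun s ↦ (φ.app (finObj R s)).hom)
    (fun s t _ ↦ LinearMap.ext fun x ↦ nat_apply φ (inclHom B s t) x) x

lemma limMap_injective {F G : Mt R ⥤ ModuleCat.{u} k} (φ : F ⟶ G) [Mono φ] :
    Function.Injective (limMap B φ) := by
  have hφ := (mono_iff_injective φ).1 inferInstance
  refine (injective_iff_map_eq_zero _).2 fun x hx ↦ ?_
  obtain ⟨s, y, rfl⟩ := Module.DirectLimit.exists_of x
  rw [limMap_limOf] at hx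
  obtain ⟨t, hst, ht⟩ := Module.DirectLimit.of.zero_exact hx
  have : coordMap B F s t hst y = 0 := hφ _ <| by
    rw [map_zero]
    exact (nat_apply φ (inclHom B s t) y).trans ht
  rw [← Module.DirectLimit.of_f (hij := hst), this, map_zero]

/-- Evaluation of a natural transformation to `mapFun X U` at the identity of `X`. -/
noncomputable def evalMapFun {F : Mt R ⥤ ModuleCat.{u} k} {U : ModuleCat.{u} k} (φ : F ⟶ mapFun R X U) :
    limObj B F →ₗ[k] U :=
  Module.DirectLimit.lift k (Finset β) _ (coordMap B F)
    (fun s ↦ (LinearMap.proj (R := k) (φ := fun _ : Fin s.card → X ↦ U) fun i ↦ B (elt s i)) ∘ₗ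
      (φ.app (finObj R s)).hom)
    fun s t hst x ↦ by
      have h := congrFun (nat_apply φ (inclHom B s t) x) fun i ↦ B (elt t i)
      exact h.trans (congrArg (φ.app (finObj R s) x : (Fin s.card → X) → U)
        ((suppIn_elt B hst).smulVec_coordHom B))

lemma limOf_coordHom_eq {V : Mt R} {a : V.ι → X} {s t : Finset β} (hs : SuppIn B V a s)
    (hst : s ⊆ t) (G : Mt R ⥤ ModuleCat.{u} k) (x : G.obj V) :
    limOf B G s (G.map (coordHom B a s) x) = limOf B G t (G.map (coordHom B a t) x) := by
  refine (Module.DirectLimit.of_f (hij := hst)).symm.trans (congrArg (limOf B G t) ?_)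
  exact (map_comp_apply G _ _ x).symm.trans
    (congrArg (fun f ↦ G.map f x) (hs.coordHom_inclHom B t))

/-- The map `G V ⟶ G X` induced by a family of vectors of `X`. -/
noncomputable def limAt (G : Mt R ⥤ ModuleCat.{u} k) (V : Mt R) (a : V.ι → X) :
    G.obj V →ₗ[k] limObj B G :=
  limOf B G (exists_suppIn B V a).choose ∘ₗ
    (G.map (coordHom B a (exists_suppIn B V a).choose)).hom

lemma limAt_eq {V : Mt R} {a : V.ι → X} {s : Finset β} (hs : SuppIn B V a s)
    (G : Mt R ⥤ ModuleCat.{u} k) (x : G.obj V) :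
    limAt B G V a x = limOf B G s (G.map (coordHom B a s) x) :=
  (limOf_coordHom_eq B (exists_suppIn B V a).choose_spec Finset.subset_union_left G x).trans
    (limOf_coordHom_eq B hs (t := (exists_suppIn B V a).choose ∪ s)
      Finset.subset_union_right G x).symm

lemma limAt_map (G : Mt R ⥤ ModuleCat.{u} k) {V W : Mt R} (f : V ⟶ W) (a : W.ι → X)
    (x : G.obj V) : limAt B G W a (G.map f x) = limAt B G V (Mt.smulVec f a) x := by
  obtain ⟨s, hs⟩ := exists_suppIn B W a
  rw [limAt_eq B hs, limAt_eq B (hs.smulVec B f), coordHom_smulVec, map_comp_apply]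

/-- A natural transformation to `mapFun X U` from a linear form. -/
noncomputable def toMapFun {G : Mt R ⥤ ModuleCat.{u} k} {U : ModuleCat.{u} k}
    (Ψ : limObj B G →ₗ[k] U) : G ⟶ mapFun R X U :=
  homMk (fun V ↦ LinearMap.pi fun a : V.ι → X ↦ Ψ ∘ₗ limAt B G V a)
    fun f x ↦ funext fun a ↦ congrArg Ψ (limAt_map B G f a x)

lemma comp_toMapFun {F G : Mt R ⥤ ModuleCat.{u} k} {U : ModuleCat.{u} k} (i : F ⟶ G)
    (φ : F ⟶ mapFun R X U) (Ψ : limObj B G →ₗ[k] U)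
    (h : ∀ x, Ψ (limMap B i x) = evalMapFun B φ x) : i ≫ toMapFun B Ψ = φ := by
  refine hom_ext_apply fun V x ↦ funext fun a : V.ι → X ↦ ?_
  obtain ⟨s, hs⟩ := exists_suppIn B V a
  change Ψ (limAt B G V a (i.app V x)) = _
  rw [limAt_eq B hs, ← nat_apply, ← limMap_limOf, h]
  refine (Module.DirectLimit.lift_of _ _ _).trans ?_
  refine (congrFun (nat_apply φ (coordHom B a s) x) fun i ↦ B (elt s i)).trans ?_
  exact congrArg (φ.app V x : (V.ι → X) → U) (hs.smulVec_coordHom B)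

end Limit

lemma injective_mapFun {k : Type u} [Field k] [Module.Free R X] (U : ModuleCat.{u} k) :
    Injective (mapFun R X U) where
  factors {F G} φ i _ := by
    classical
    let B := Module.Free.chooseBasis R X
    obtain ⟨Ψ, hΨ⟩ := exists_extend_of_injective (limMap B i) (limMap_injective B i) (evalMapFun B φ)
    exact ⟨toMapFun B Ψ, comp_toMapFun B i φ Ψ hΨ⟩

end MapFunctors

section BaseChange

universe r

/-- Extension of scalars. -/
def baseChange (R : Type r) (S : Type u) [CommRing R] [CommRing S] [Algebra R S] : Mt R ⥤ Mt S where
  obj V := ⟨V.ι⟩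
  map f := Mt.ofMat ((Mt.mat f).map (algebraMap R S))
  map_id V := Mt.hom_ext (Matrix.map_one _ (map_zero _) (map_one _))
  map_comp f g := Mt.hom_ext Matrix.map_mul

/-- Restriction of functors along the extension of scalars. -/
abbrev restr (R : Type r) (k : Type u) [CommRing R] [Field k] [Algebra R k] :
    (Mt k ⥤ ModuleCat.{u} k) ⥤ (Mt R ⥤ ModuleCat.{u} k) :=
  (Functor.whiskeringLeft _ _ _).obj (baseChange R k)

variable (R : Type r) (k : Type u) [CommRing R] [Field k] [Algebra R k]

lemma baseChange_map_comp_ofMat {V V' : Mt R} {W : Mt k} (f : V ⟶ V') (a : V'.ι → W.ι → k) :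
    (baseChange R k).map f ≫ (Mt.ofMat fun v w ↦ a v w : (baseChange R k).obj V' ⟶ W) =
      Mt.ofMat fun v w ↦ Mt.smulVec f a v w := by
  refine Mt.hom_ext ?_
  rw [Mt.mat_comp]
  ext v w
  change ∑ v', algebraMap R k (Mt.mat f v v') * a v' w = (∑ v', Mt.mat f v v' • a v') w
  rw [Finset.sum_apply]
  exact Finset.sum_congr rfl fun v' _ ↦ (Algebra.smul_def _ _).symm

/-- The restriction of `coRep W U` is of the form `mapFun X U`. -/
def restrCoRepIso (W : Mt k) (U : ModuleCat.{u} k) :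
    (restr R k).obj (coRep.{u, u, 1, u} W U) ≅ mapFun R (W.ι → k) U where
  hom := homMk (G := mapFun R (W.ι → k) U)
    (fun V ↦ LinearMap.pi (φ := fun _ : V.ι → W.ι → k ↦ U) fun a : V.ι → W.ι → k ↦
      LinearMap.proj (R := k) (φ := fun _ : (baseChange R k).obj V ⟶ W ↦ U)
        (Mt.ofMat fun v w ↦ a v w))
    fun {V V'} f x ↦ funext fun a ↦ congrArg (x : ((baseChange R k).obj V ⟶ W) → U)
      (baseChange_map_comp_ofMat R k f a)
  inv := homMk (F := mapFun R (W.ι → k) U)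
    (fun V ↦ LinearMap.pi (φ := fun _ : (baseChange R k).obj V ⟶ W ↦ U) fun a ↦
      LinearMap.proj (R := k) (φ := fun _ : V.ι → W.ι → k ↦ U) fun v w ↦ Mt.mat a v w)
    fun {V V'} f x ↦ funext fun a ↦ congrArg (x : (V.ι → W.ι → k) → U)
      (congrArg (fun f v w ↦ Mt.mat f v w)
        (baseChange_map_comp_ofMat R k f fun v w ↦ Mt.mat a v w).symm)
  hom_inv_id := rfl
  inv_hom_id := rfl

lemma injective_restr_effObj [Module.Free R k] (F : Mt k ⥤ ModuleCat.{u} k) :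
    Injective ((restr R k).obj
      (effObj.{u, u, 1, u} (fun n : ℕ ↦ (⟨Fin n⟩ : Mt k)) F)) := by
  have (n : ℕ) : Injective ((restr R k).obj (coRep.{u, u, 1, u} (⟨Fin n⟩ : Mt k) (F.obj ⟨Fin n⟩))) :=
    Injective.of_iso (restrCoRepIso R k _ _).symm (injective_mapFun _)
  exact inferInstanceAs <| Injective (piFun fun n : ℕ ↦
    (restr R k).obj (coRep.{u, u, 1, u} (⟨Fin n⟩ : Mt k) (F.obj ⟨Fin n⟩)))

lemma exists_injective_restr [Module.Free R k] (F : Mt k ⥤ ModuleCat.{u} k) :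
    ∃ (E : Mt k ⥤ ModuleCat.{u} k) (i : F ⟶ E), Mono i ∧ Injective E ∧
      Injective ((restr R k).obj E) :=
  ⟨_, effHom.{u, u, 1, u} (fun n : ℕ ↦ (⟨Fin n⟩ : Mt k)) F, mono_effHom _ Mt.exists_iso_fin F, inferInstance,
    injective_restr_effObj R k F⟩

end BaseChange

section RestrictLinear

universe r

variable {R : Type r} [CommRing R] {k : Type u} [Field k] [Algebra R k] {M : Type u}
  [AddCommGroup M] [Module k M] {act : k →+* Module.End k M} {act' : R →+* Module.End k M}

lemma restr_linFun_map (h : ∀ c m, act' c m = act (algebraMap R k c) m) {V W : Mt R} (f : V ⟶ W)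
    (x : V.ι → M) : (linFun act').map f x = ((restr R k).obj (linFun act)).map f x := by
  refine funext fun w ↦ (linFun_map_apply act' f x w).trans
    (Eq.trans ?_ (linFun_map_apply act ((baseChange R k).map f) x w).symm)
  exact Finset.sum_congr rfl fun v _ ↦ h _ _

/-- Restricting a linear functor amounts to restricting the action. -/
def restrLinIso (h : ∀ c m, act' c m = act (algebraMap R k c) m) :
    linFun act' ≅ (restr R k).obj (linFun act) where
  hom := homMk (G := (restr R k).obj (linFun act)) (fun V ↦ (LinearMap.id : (V.ι → M) →ₗ[k] _))
    fun f x ↦ restr_linFun_map h f x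
  inv := homMk (F := (restr R k).obj (linFun act)) (fun V ↦ (LinearMap.id : (V.ι → M) →ₗ[k] _))
    fun f x ↦ (restr_linFun_map h f x).symm
  hom_inv_id := rfl
  inv_hom_id := rfl

end RestrictLinear

section TensorComparison

open TensorProduct

variable (k : Type u) [Field k] (p : ℕ) [hp : Fact p.Prime] [Algebra (ZMod p) k]

/-- The inclusion `a ↦ a ⊗ 1`. -/
noncomputable def inclTensor : k →ₗ[k] TensorSq k p := Algebra.linearMap k (TensorSq k p)

lemma actThrough_sndAction_tmul (c a b : k) :
    actThrough (sndAction k p) (TensorSq k p) c (a ⊗ₜ b) = a ⊗ₜ (b * c) := by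
  rw [actThrough_apply, smul_eq_mul]
  refine (Algebra.TensorProduct.tmul_mul_tmul 1 a c b).trans ?_
  rw [one_mul, mul_comm]

/-- The natural transformation `V ↦ (k ⊗ V → k ⊗ (k ⊗ V))`. -/
noncomputable def unitHom : scalarFun k p ⟶ (restr (ZMod p) k).obj (tensorFun k p) :=
  linMap (actN := (actThrough (sndAction k p) (TensorSq k p)).comp (algebraMap (ZMod p) k))
    (inclTensor k p) (fun c m ↦ by
      change (c • m) ⊗ₜ[ZMod p] (1 : k) = actThrough (sndAction k p) (TensorSq k p)
        (algebraMap (ZMod p) k c) (m ⊗ₜ 1)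
      rw [actThrough_sndAction_tmul, one_mul, TensorProduct.smul_tmul, Algebra.algebraMap_eq_smul_one]) ≫
    (restrLinIso fun _ _ ↦ rfl).hom

lemma unitHom_app_linPt (m : k) : (unitHom k p).app (Mt.pt (ZMod p)) (linPt _ m) =
    linPt (R := k) (actThrough (sndAction k p) (TensorSq k p)) (m ⊗ₜ 1) := rfl

variable {k p} in
lemma unitHom_injective {F : Mt k ⥤ ModuleCat.{u} k} {f g : tensorFun k p ⟶ F}
    (h : unitHom k p ≫ (restr (ZMod p) k).map f = unitHom k p ≫ (restr (ZMod p) k).map g) :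
    f = g := by
  refine linFun_hom_ext fun m ↦ ?_
  have hm (φ : tensorFun k p ⟶ F) (m : TensorSq k p) :
    φ.app (Mt.pt k) (linPt _ m) = ptMap φ m := rfl
  rw [hm, hm]
  induction m using TensorProduct.induction_on with
  | zero => rw [map_zero, map_zero]
  | add x y hx hy => rw [map_add, map_add, hx, hy]
  | tmul a b =>
    have h₁ (φ : tensorFun k p ⟶ F) : ptMap φ (a ⊗ₜ b) =
        F.map (Mt.ofVec fun _ ↦ b) ((unitHom k p ≫ (restr (ZMod p) k).map φ).app (Mt.pt (ZMod p))
          (linPt _ a)) := by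
      refine Eq.trans ?_ ((isPrim_ptMap φ).equivariant b (a ⊗ₜ 1)).symm
      rw [actThrough_sndAction_tmul, one_mul]
    rw [h₁, h₁, h]

section Lift

variable {k p} {F : Mt k ⥤ ModuleCat.{u} k} (g : scalarFun k p ⟶ (restr (ZMod p) k).obj F)

/-- The value at one of a natural transformation. -/
noncomputable def basePt : F.obj (Mt.pt k) := ptMap g 1

lemma map_add_basePt {V : Mt k} (a b : V.ι → k) :
    F.map (Mt.ofVec (a + b)) (basePt g) =
      F.map (Mt.ofVec a) (basePt g) + F.map (Mt.ofVec b) (basePt g) := by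
  have H (c : Bool → ZMod p) : F.map (Mt.ofVec fun v ↦ ∑ i, algebraMap (ZMod p) k (c i) * (if i then a v else b v)) (basePt g) =
      F.map (Mt.ofMat fun i v ↦ if i then a v else b v : (⟨Bool⟩ : Mt k) ⟶ V)
        (((restr (ZMod p) k).obj F).map (Mt.ofVec (V := (⟨Bool⟩ : Mt (ZMod p))) c) (ptMap g 1)) := by
    refine Eq.trans ?_ (map_comp_apply F ((baseChange (ZMod p) k).map
      (Mt.ofVec (V := (⟨Bool⟩ : Mt (ZMod p))) c)) _ _)
    exact congrArg (fun f ↦ F.map f (basePt g)) rfl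
  have h := (isPrim_ptMap g).additive (V := ⟨Bool⟩) (fun i ↦ if i then 1 else 0)
    (fun i ↦ if i then 0 else 1) 1
  have h' := (congrArg (F.map (Mt.ofMat fun i v ↦ if i then a v else b v : (⟨Bool⟩ : Mt k) ⟶ V)) h).trans
    (map_add (F.map _).hom _ _)
  have h'' := (H _).trans (h'.trans (congrArg₂ (· + ·) (H _).symm (H _).symm))
  simpa [Pi.add_def] using h''

/-- The dependence on a scalar of the image of `basePt`. -/
noncomputable def baseAddHom : k →+ F.obj (Mt.pt k) :=
  AddMonoidHom.mk' (fun b : k ↦ F.map (Mt.ofVec fun _ ↦ b) (basePt g))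
    fun a b ↦ map_add_basePt g (V := Mt.pt k) (fun _ ↦ a) (fun _ ↦ b)

/-- The linear extension of an additive map. -/
noncomputable def liftAddHom {P : Type u} [AddCommGroup P] [Module k P] (f : k →+ P) :
    TensorSq k p →ₗ[k] P :=
  letI : Module (ZMod p) P := Module.compHom P (algebraMap (ZMod p) k)
  haveI : IsScalarTower (ZMod p) k P := IsScalarTower.of_compHom _ _ _
  LinearMap.liftBaseChange k (AddMonoidHom.toZModLinearMap p f)

lemma liftAddHom_tmul {P : Type u} [AddCommGroup P] [Module k P] (f : k →+ P) (a b : k) :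
    liftAddHom (p := p) f (a ⊗ₜ b) = a • f b := by
  let : Module (ZMod p) P := Module.compHom P (algebraMap (ZMod p) k)
  have : IsScalarTower (ZMod p) k P := IsScalarTower.of_compHom _ _ _
  exact LinearMap.liftBaseChange_tmul (A := k) (AddMonoidHom.toZModLinearMap p f) a b

/-- The linear extension of the value at one of a natural transformation. -/
noncomputable def liftPt : TensorSq k p →ₗ[k] F.obj (Mt.pt k) := liftAddHom (baseAddHom g)

lemma liftPt_tmul (a b : k) : liftPt g (a ⊗ₜ b) = a • F.map (Mt.ofVec fun _ ↦ b) (basePt g) :=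
  liftAddHom_tmul (baseAddHom g) a b

lemma map_liftPt_tmul {V : Mt k} (v : V.ι → k) (a b : k) :
    F.map (Mt.ofVec v) (liftPt g (a ⊗ₜ b)) = a • F.map (Mt.ofVec (b • v)) (basePt g) := by
  rw [liftPt_tmul]
  refine (LinearMap.map_smul (F.map (Mt.ofVec v)).hom a _).trans (congrArg (a • ·) ?_)
  refine (map_comp_apply F _ _ _).symm.trans (congrArg (fun f ↦ F.map f (basePt g)) ?_)
  rw [Mt.ofVec_comp]
  refine congrArg Mt.ofVec (funext fun i ↦ ?_)
  exact Fintype.sum_unique (ι := Unit) fun _ ↦ b * v i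

lemma isPrim_liftPt : IsPrim (actThrough (sndAction k p) (TensorSq k p)) (liftPt g) where
  equivariant c m := by
    induction m using TensorProduct.induction_on with
    | zero => simp
    | add x y hx hy => rw [map_add, map_add, map_add, map_add, hx, hy]
    | tmul a b =>
      rw [map_liftPt_tmul, actThrough_sndAction_tmul, liftPt_tmul]
      rfl
  additive {V} v w m := by
    induction m using TensorProduct.induction_on with
    | zero => simp
    | add x y hx hy => simp only [map_add, hx, hy]; abel
    | tmul a b =>
      rw [map_liftPt_tmul, map_liftPt_tmul, map_liftPt_tmul, smul_add, map_add_basePt, smul_add]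

lemma unitHom_comp_primHom :
    unitHom k p ≫ (restr (ZMod p) k).map (primHom (liftPt g) (isPrim_liftPt g)) = g := by
  refine linFun_hom_ext fun m ↦ ?_
  refine (primHom_app_linPt (liftPt g) (isPrim_liftPt g) (m ⊗ₜ 1)).trans ?_
  rw [liftPt_tmul]
  have : (Mt.ofVec fun _ ↦ 1 : Mt.pt k ⟶ Mt.pt k) = 𝟙 _ :=
    Mt.hom_ext (Matrix.ext fun _ _ ↦ (Matrix.one_apply_eq _).symm)
  rw [this, map_id_apply]
  refine ((ptMap g).map_smul m 1).symm.trans ?_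
  rw [smul_eq_mul, mul_one]
  rfl

end Lift

lemma unitHom_bijective (F : Mt k ⥤ ModuleCat.{u} k) : Function.Bijective
    fun f : tensorFun k p ⟶ F ↦ unitHom k p ≫ (restr (ZMod p) k).map f :=
  ⟨fun _ _ h ↦ unitHom_injective h, fun g ↦ ⟨_, unitHom_comp_primHom g⟩⟩

end TensorComparison

section Restriction

universe w' v v' u₁ u₂

instance whiskeringLeft_linear {k : Type u} [Field k] {C : Type u₁} [Category.{v} C] {D : Type u₂}
    [Category.{v'} D] (T : C ⥤ D) :
    ((Functor.whiskeringLeft C D (ModuleCat.{u} k)).obj T).Linear k where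
  map_smul _ _ := rfl

instance whiskeringLeft_additive {k : Type u} [Field k] {C : Type u₁} [Category.{v} C] {D : Type u₂}
    [Category.{v'} D] (T : C ⥤ D) :
    ((Functor.whiskeringLeft C D (ModuleCat.{u} k)).obj T).Additive where
  map_add := rfl

variable (k : Type u) [Field k] (p : ℕ) [hp : Fact p.Prime] [alg : Algebra (ZMod p) k]

lemma compare_unitHom_bijective [HasExt.{w} (Mt k ⥤ ModuleCat.{u} k)]
    [HasExt.{w'} (Mt (ZMod p) ⥤ ModuleCat.{u} k)] (F : Mt k ⥤ ModuleCat.{u} k) (t : ℕ) :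
    Function.Bijective (compare k (restr (ZMod p) k) (unitHom k p) F t) := by
  refine compare_bijective k (restr (ZMod p) k) (unitHom k p) (unitHom_bijective k p) (fun F ↦ ?_) F t
  obtain ⟨E, i, hi, hE, hE'⟩ := exists_injective_restr (ZMod p) k F
  exact ⟨E, i, hi, fun t ↦ ⟨subsingleton_ext_of_injective E t, subsingleton_ext_of_injective _ t⟩⟩

/-- The identity functor restricts to `scalarFun`. -/
noncomputable def scalarIso : (restr (ZMod p) k).obj (idFun k) ≅ scalarFun k p :=
  (restrLinIso fun c m ↦ Algebra.smul_def c m).symm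

lemma exists_linearEquiv_ext_idFun [PerfectField k] [HasExt.{w} (Mt k ⥤ ModuleCat.{u} k)]
    [HasExt.{w'} (Mt (ZMod p) ⥤ ModuleCat.{u} k)] (t : ℕ) :
    Nonempty (Ext (idFun k) (idFun k) t ≃ₗ[k] Ext (scalarFun k p) (scalarFun k p) t) :=
  ⟨LinearEquiv.ofBijective _ (pull_mulHom_bijective k p t) ≪≫ₗ
    LinearEquiv.ofBijective _ (compare_unitHom_bijective k p (idFun k) t) ≪≫ₗ
    LinearEquiv.ofBijective _ (push_bijective_of_iso k (scalarIso k p) t)⟩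

lemma nonempty_linearEquiv_of_rank_eq_one {M : Type*} [AddCommGroup M] [Module k M]
    (h : Module.rank k M = 1) : Nonempty (M ≃ₗ[k] k) :=
  nonempty_linearEquiv_of_lift_rank_eq (by rw [h, Module.rank_self, Cardinal.lift_one, Cardinal.lift_one])

include hp alg in
lemma ext_idFun_even [PerfectField k] [HasExt.{w} (Mt k ⥤ ModuleCat.{u} k)] (s : ℕ) :
    Nonempty (Ext (idFun k) (idFun k) (2 * s) ≃ₗ[k] k) := by
  have := HasExt.standard (Mt (ZMod p) ⥤ ModuleCat.{u} k)
  obtain ⟨e⟩ := exists_linearEquiv_ext_idFun k p (2 * s)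
  obtain ⟨e'⟩ := nonempty_linearEquiv_of_rank_eq_one k (rank_ext_scalarFun_even k p s)
  exact ⟨e ≪≫ₗ e'⟩

include hp alg in
lemma subsingleton_ext_idFun_odd [PerfectField k] [HasExt.{w} (Mt k ⥤ ModuleCat.{u} k)] (s : ℕ) :
    Subsingleton (Ext (idFun k) (idFun k) (2 * s + 1)) := by
  have := HasExt.standard (Mt (ZMod p) ⥤ ModuleCat.{u} k)
  obtain ⟨e⟩ := exists_linearEquiv_ext_idFun k p (2 * s + 1)
  have := subsingleton_ext_scalarFun_odd k p s
  exact e.injective.subsingleton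

end Restriction

section Equivalence

universe w'

variable (k : Type u) [Field k]

/-- The equivalence from matrices to finite-dimensional vector spaces. -/
noncomputable def toFG : Mt k ⥤ FGModuleCat.{u} k where
  obj V := FGModuleCat.of k (V.ι → k)
  map f := FGModuleCat.ofHom (Matrix.vecMulLinear (Mt.mat f))
  map_id V := by
    refine FGModuleCat.hom_ext (LinearMap.ext fun x ↦ ?_)
    exact Matrix.vecMul_one x
  map_comp f g := by
    refine FGModuleCat.hom_ext (LinearMap.ext fun x ↦ ?_)
    exact (Matrix.vecMul_vecMul x (Mt.mat f) (Mt.mat g)).symm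

instance : (toFG k).Faithful where
  map_injective {V W} f g h := Mt.hom_ext <| Matrix.ext fun i j ↦ by
    have h' : Matrix.vecMulLinear (Mt.mat f) = Matrix.vecMulLinear (Mt.mat g) :=
      congrArg (fun f ↦ f.hom.hom) h
    have : Matrix.vecMul (Pi.single i 1) (Mt.mat f) = Matrix.vecMul (Pi.single i 1) (Mt.mat g) :=
      LinearMap.congr_fun h' (Pi.single i 1)
    rw [Matrix.single_one_vecMul, Matrix.single_one_vecMul] at this
    exact congrFun this j

instance : (toFG k).Full where
  map_surjective {V W} φ := by
    let φ' : (V.ι → k) →ₗ[k] (W.ι → k) := φ.hom.hom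
    refine ⟨Mt.ofMat (Matrix.of fun i j ↦ φ' (Pi.single i 1) j), FGModuleCat.hom_ext ?_⟩
    refine LinearMap.pi_ext' fun i ↦ LinearMap.ext_ring ?_
    change Matrix.vecMul (Pi.single i 1) (Matrix.of fun i j ↦ φ' (Pi.single i 1) j) = φ' (Pi.single i 1)
    rw [Matrix.single_one_vecMul]
    rfl

instance : (toFG k).EssSurj where
  mem_essImage V :=
    ⟨⟨Fin (Module.finrank k V)⟩, ⟨LinearEquiv.toFGModuleCatIso (Module.finBasis k V).equivFun.symm⟩⟩

instance : (toFG k).IsEquivalence where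

/-- Restriction along `toFG` as an equivalence of functor categories. -/
noncomputable def restrEquiv : (FGModuleCat.{u} k ⥤ ModuleCat.{u} k) ≌ (Mt k ⥤ ModuleCat.{u} k) :=
  (toFG k).asEquivalence.symm.congrLeft

lemma idFun_map {V W : Mt k} (f : V ⟶ W) (x : V.ι → k) :
    (idFun k).map f x = Matrix.vecMul x (Mt.mat f) :=
  funext fun w ↦ (linFun_map_apply _ f x w).trans
    (Finset.sum_congr rfl fun v _ ↦ mul_comm (Mt.mat f v w) (x v))

/-- The inclusion functor corresponds to `idFun`. -/
noncomputable def inclusionIso : idFun k ≅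
    ((Functor.whiskeringLeft _ _ (ModuleCat.{u} k)).obj (toFG k)).obj (inclusionFunctor k) where
  hom := homMk (F := idFun k) (G := toFG k ⋙ inclusionFunctor k)
    (fun V ↦ (LinearMap.id : (V.ι → k) →ₗ[k] _)) fun f x ↦ idFun_map k f x
  inv := homMk (G := idFun k) (F := toFG k ⋙ inclusionFunctor k)
    (fun V ↦ (LinearMap.id : (V.ι → k) →ₗ[k] _)) fun f x ↦ (idFun_map k f x).symm
  hom_inv_id := rfl
  inv_hom_id := rfl

lemma compare_inclusionIso_bijective [HasExt.{w} (Mt k ⥤ ModuleCat.{u} k)]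
    [HasExt.{w'} (FGModuleCat.{u} k ⥤ ModuleCat.{u} k)] (F : FGModuleCat.{u} k ⥤ ModuleCat.{u} k)
    (t : ℕ) : Function.Bijective (compare k
      ((Functor.whiskeringLeft _ _ (ModuleCat.{u} k)).obj (toFG k)) (inclusionIso k).hom F t) := by
  have : ((Functor.whiskeringLeft _ _ (ModuleCat.{u} k)).obj (toFG k)).IsEquivalence :=
    (restrEquiv k).isEquivalence_functor
  refine compare_bijective k _ _ (fun F ↦ ?_) (fun F ↦ ?_) F t
  · exact ((inclusionIso k).homFromEquiv.symm.bijective).comp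
      ((Functor.FullyFaithful.ofFullyFaithful
        ((Functor.whiskeringLeft _ _ (ModuleCat.{u} k)).obj (toFG k))).homEquiv.bijective)
  · have : EnoughInjectives (FGModuleCat.{u} k ⥤ ModuleCat.{u} k) :=
      (restrEquiv k).enoughInjectives_iff.2 inferInstance
    have h : Injective (((Functor.whiskeringLeft _ _ (ModuleCat.{u} k)).obj (toFG k)).obj
      (Injective.under F)) := ((restrEquiv k).map_injective_iff _).2 inferInstance
    exact ⟨_, Injective.ι F, inferInstance, fun t ↦
      ⟨subsingleton_ext_of_injective _ t, subsingleton_ext_of_injective _ t⟩⟩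

lemma exists_linearEquiv_ext_inclusionFunctor [HasExt.{w} (Mt k ⥤ ModuleCat.{u} k)]
    [HasExt.{w'} (FGModuleCat.{u} k ⥤ ModuleCat.{u} k)] (t : ℕ) :
    Nonempty (Ext (inclusionFunctor k) (inclusionFunctor k) t ≃ₗ[k] Ext (idFun k) (idFun k) t) :=
  ⟨LinearEquiv.ofBijective _ (compare_inclusionIso_bijective k (inclusionFunctor k) t) ≪≫ₗ
    LinearEquiv.ofBijective _ (push_bijective_of_iso k (inclusionIso k).symm t)⟩

end Equivalence

section Main

variable (k : Type u) [Field k] (p : ℕ) [hp : Fact p.Prime] [hk : CharP k p] [PerfectField k]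
  [HasExt.{w} (FGModuleCat.{u} k ⥤ ModuleCat.{u} k)]

include hp hk

lemma ext_inclusionFunctor_even (s : ℕ) :
    Nonempty (Ext (inclusionFunctor k) (inclusionFunctor k) (2 * s) ≃ₗ[k] k) := by
  let := ZMod.algebra k p
  have := HasExt.standard (Mt k ⥤ ModuleCat.{u} k)
  obtain ⟨e⟩ := exists_linearEquiv_ext_inclusionFunctor k (2 * s)
  obtain ⟨e'⟩ := ext_idFun_even k p s
  exact ⟨e ≪≫ₗ e'⟩

lemma subsingleton_ext_inclusionFunctor_odd (s : ℕ) :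
    Subsingleton (Ext (inclusionFunctor k) (inclusionFunctor k) (2 * s + 1)) := by
  let := ZMod.algebra k p
  have := HasExt.standard (Mt k ⥤ ModuleCat.{u} k)
  obtain ⟨e⟩ := exists_linearEquiv_ext_inclusionFunctor k (2 * s + 1)
  have := subsingleton_ext_idFun_odd k p s
  exact e.injective.subsingleton

/-- One-dimensionality of the even `Ext` groups, in terms of Yoneda composition with scalars. -/
lemma exists_addEquiv_ext_inclusionFunctor_even (s : ℕ) :
    ∃ e : Ext (inclusionFunctor k) (inclusionFunctor k) (2 * s) ≃+ k, ∀ (c : k) x,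
      e ((Ext.mk₀ (c • 𝟙 (inclusionFunctor k))).comp x (zero_add _)) = c * e x := by
  obtain ⟨e⟩ := ext_inclusionFunctor_even k p s
  refine ⟨e.toAddEquiv, fun c x ↦ (congrArg e ?_).trans (e.map_smul c x)⟩
  rw [Ext.mk₀_smul]
  exact (Ext.smul_comp _ _ _ _).trans (congrArg (c • ·) (Ext.mk₀_id_comp x))

end Main

end ExtComputation

/-- For a perfect field `k` of characteristic `p > 0`, `Ext^n_{F(P_k,k)}(I, I)` is a
one-dimensional `k`-vector space if `n` is even, and is zero if `n` is odd. -/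
theorem ext_inclusion_even_odd
    (k : Type u) [Field k] (p : ℕ) [Fact p.Prime] [CharP k p] [PerfectField k]
    [HasExt.{w} (FGModuleCat k ⥤ ModuleCat.{u} k)] (n : ℕ) :
    (Even n → Nonempty (Ext (inclusionFunctor k) (inclusionFunctor k) n ≃ₗ[k] k)) ∧
    (Odd n → ∀ x : Ext (inclusionFunctor k) (inclusionFunctor k) n, x = 0) := by
  refine ⟨?_, ?_⟩
  · rintro ⟨s, rfl⟩
    rw [← two_mul]
    obtain ⟨e, he⟩ := exists_addEquiv_ext_inclusionFunctor_even k p s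
    exact ⟨{ e with map_smul' := he }⟩
  · rintro ⟨s, rfl⟩ x
    have := subsingleton_ext_inclusionFunctor_odd k p s
    exact Subsingleton.elim x 0

end DjamentTouze
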